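/- There exists an absolute constant ε₁ > 0 with the following property: if (v,p) is a suitable weak solution of the Navier–Stokes equations in Q_T = Ω×(0,T), z₀ ∈ Q_T is such that the closure of Q_{z₀,r} is contained in Q_T for some r > 0, and limsup_{ρ→0+} (1/ρ) ∫∫_{Q_{z₀,ρ}} |∇v|² dx dt ≤ ε₁, then z₀ is a regular point of v. -/

import Mathlib

open MeasureTheory Set Filter ENNReal

noncomputable section

/-- Euclidean 3-space. -/
abbrev E3 := EuclideanSpace ℝ (Fin 3)

/-- The parabolic cylinder `Q_{z,r} = B_{x,r} × (t - r², t)`. -/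
def pcyl (z : E3 × ℝ) (r : ℝ) : Set (E3 × ℝ) :=
  (Metric.ball z.1 r) ×ˢ (Ioo (z.2 - r ^ 2) z.2)

/-- The mixed space-time norm `‖f‖_{L^{γ,α}_{x,t}(B × (a,b))}`,
with the essential-supremum modification when an exponent is `∞`. -/
def mixedNorm {F : Type*} [NormedAddCommGroup F]
    (f : E3 × ℝ → F) (B : Set E3) (a b : ℝ) (γ α : ℝ≥0∞) : ℝ≥0∞ :=
  if α = ∞ then
    essSup (fun t => eLpNorm (fun x => f (x, t)) γ (volume.restrict B))
      (volume.restrict (Ioo a b))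
  else
    (∫⁻ t in Ioo a b,
      (eLpNorm (fun x => f (x, t)) γ (volume.restrict B)) ^ α.toReal) ^ (1 / α.toReal)

/-- `f ∈ L^{γ,α}_{x,t}(B × (a,b))`. -/
def MemMixed {F : Type*} [NormedAddCommGroup F]
    (f : E3 × ℝ → F) (B : Set E3) (a b : ℝ) (γ α : ℝ≥0∞) : Prop :=
  mixedNorm f B a b γ α < ∞

/-- Vector in `ℝ³` from coordinates. -/
def vec3 (a b c : ℝ) : E3 := (WithLp.equiv 2 (Fin 3 → ℝ)).symm ![a, b, c]

/-- Cross product in `ℝ³`. -/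
def cross3 (u w : E3) : E3 :=
  vec3 (u 1 * w 2 - u 2 * w 1) (u 2 * w 0 - u 0 * w 2) (u 0 * w 1 - u 1 * w 0)

/-- The unit direction `w/|w|`, interpreted as `0` when `w = 0`. -/
def unitd (w : E3) : E3 := ‖w‖⁻¹ • w

/-- Spatial partial derivative (in direction `i`) of a function on space-time. -/
def sdz {F : Type*} [NormedAddCommGroup F] [NormedSpace ℝ F]
    (φ : E3 × ℝ → F) (i : Fin 3) (z : E3 × ℝ) : F :=
  fderiv ℝ φ z (EuclideanSpace.single i 1, 0)

/-- Time derivative of a function on space-time. -/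
def tdz {F : Type*} [NormedAddCommGroup F] [NormedSpace ℝ F]
    (φ : E3 × ℝ → F) (z : E3 × ℝ) : F :=
  fderiv ℝ φ z (0, 1)

/-- The vorticity `ω = curl v` built from the (weak) velocity gradient
`Dv`, where `Dv z j i` represents `∂_j v_i (z)`. -/
def curlOf (Dv : E3 × ℝ → Fin 3 → Fin 3 → ℝ) (z : E3 × ℝ) : E3 :=
  vec3 (Dv z 1 2 - Dv z 2 1) (Dv z 2 0 - Dv z 0 2) (Dv z 0 1 - Dv z 1 0)

/-- A `3×3` matrix regarded as a Euclidean vector (so that its norm is the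
Frobenius norm). -/
def frob (M : Fin 3 → Fin 3 → ℝ) : EuclideanSpace ℝ (Fin 3 × Fin 3) :=
  (WithLp.equiv 2 (Fin 3 × Fin 3 → ℝ)).symm fun q => M q.1 q.2

/-- `(v, p)` is a suitable weak solution of the Navier–Stokes equations on
`Q_T = Ω × (0,T)`, with weak spatial gradient `Dv` (`Dv z j i = ∂_j v_i (z)`)
and initial data `v₀`. -/
structure IsSuitableWeakSolution (Ω : Set E3) (T : ℝ) (v : E3 × ℝ → E3)
    (Dv : E3 × ℝ → Fin 3 → Fin 3 → ℝ) (p : E3 × ℝ → ℝ) (v₀ : E3 → E3) : Prop where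
  meas_v : Measurable v
  meas_Dv : Measurable Dv
  meas_p : Measurable p
  /-- `Dv` is the weak spatial gradient of `v`. -/
  weak_grad : ∀ ψ : E3 → ℝ, ContDiff ℝ (⊤ : ℕ∞) ψ → HasCompactSupport ψ → tsupport ψ ⊆ Ω →
    ∀ᵐ t ∂(volume.restrict (Ioo 0 T)), ∀ i j : Fin 3,
      ∫ x in Ω, v (x, t) j * fderiv ℝ ψ x (EuclideanSpace.single i 1) =
        - ∫ x in Ω, Dv (x, t) i j * ψ x
  /-- `v ∈ L^∞(0,T;L²(Ω))`. -/
  v_linf_l2 : MemMixed v Ω 0 T 2 ∞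
  /-- `v ∈ L²(0,T;W^{1,2}(Ω))`. -/
  v_l2_w12 : IntegrableOn (fun z => ‖v z‖ ^ 2 + ∑ i, ∑ j, (Dv z i j) ^ 2) (Ω ×ˢ Ioo 0 T)
  /-- `p ∈ L^{3/2}(Q_T)`. -/
  p_l32 : IntegrableOn (fun z => |p z| ^ (3 / 2 : ℝ)) (Ω ×ˢ Ioo 0 T)
  /-- The weak form of the Navier–Stokes equations. -/
  weak_nse : ∀ φ : E3 × ℝ → E3, ContDiff ℝ (⊤ : ℕ∞) φ → HasCompactSupport φ →
    tsupport φ ⊆ Ω ×ˢ Iio T →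
    ∫ z in Ω ×ˢ Ioo 0 T,
        (-(∑ i, v z i * tdz φ z i) + (∑ i, ∑ j, v z j * Dv z j i * φ z i)
          + (∑ i, ∑ j, Dv z j i * sdz φ j z i) - p z * ∑ i, sdz φ i z i)
      = ∫ x in Ω, ∑ i, v₀ x i * φ (x, 0) i
  /-- `div v = 0` weakly. -/
  div_free : ∀ ψ : E3 × ℝ → ℝ, ContDiff ℝ (⊤ : ℕ∞) ψ → HasCompactSupport ψ →
    tsupport ψ ⊆ Ω ×ˢ Ioo 0 T →
    ∫ z in Ω ×ˢ Ioo 0 T, ∑ i, v z i * sdz ψ i z = 0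
  /-- The local energy inequality. -/
  local_energy : ∀ᵐ t ∂(volume.restrict (Ioo 0 T)), ∀ φ : E3 × ℝ → ℝ,
    ContDiff ℝ (⊤ : ℕ∞) φ → HasCompactSupport φ → tsupport φ ⊆ Ω ×ˢ Ioo 0 T → (∀ z, 0 ≤ φ z) →
    (∫ x in Ω, ‖v (x, t)‖ ^ 2 * φ (x, t))
        + 2 * ∫ z in Ω ×ˢ Ioo 0 t, (∑ i, ∑ j, (Dv z i j) ^ 2) * φ z
      ≤ ∫ z in Ω ×ˢ Ioo 0 t,
          (‖v z‖ ^ 2 * (tdz φ z + ∑ i, sdz (fun w => sdz φ i w) i z)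
            + (‖v z‖ ^ 2 + 2 * p z) * ∑ i, v z i * sdz φ i z)

/-- `z` is a regular point of `v`: `v` is essentially bounded on some parabolic
cylinder `Q_{z,r} ⊆ Q_T`. -/
def RegularPoint (Ω : Set E3) (T : ℝ) (v : E3 × ℝ → E3) (z : E3 × ℝ) : Prop :=
  ∃ r > 0, pcyl z r ⊆ Ω ×ˢ Ioo 0 T ∧
    ∃ M : ℝ, ∀ᵐ w ∂(volume.restrict (pcyl z r)), ‖v w‖ ≤ M

/-- `z` is a singular point of `v` in `Q_T`. -/
def SingularPoint (Ω : Set E3) (T : ℝ) (v : E3 × ℝ → E3) (z : E3 × ℝ) : Prop :=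
  z ∈ Ω ×ˢ Ioo 0 T ∧ ¬ RegularPoint Ω T v z


open Metric Topology

local notation "CD" => ContDiff ℝ (⊤ : ℕ∞)
local notation "oR" => ENNReal.ofReal
local notation "ET" => E3 × ℝ
local notation "pz" => (by positivity)

def lk (x : E3) : ℝ≥0∞ := oR (‖x‖ ^ (-(2/3) : ℝ))

lemma lk_def (x : E3) : lk x = oR (‖x‖ ^ (-(2/3) : ℝ)) := rfl

lemma lk_meas : Measurable lk := by unfold lk; fun_prop

attribute [irreducible] lk

lemma lintegral_cs {α : Type*} [MeasurableSpace α] (μ : Measure α) {f g : α → ℝ≥0∞}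
    (hf : AEMeasurable f μ) (hg : AEMeasurable g μ) :
    (∫⁻ a, f a * g a ∂μ) ^ 2 ≤ (∫⁻ a, f a ^ 2 ∂μ) * ∫⁻ a, g a ^ 2 ∂μ := by
  have h := ENNReal.lintegral_mul_le_Lp_mul_Lq μ Real.HolderConjugate.two_two hf hg
  simp only [Pi.mul_apply, rpow_two] at h
  calc _ ≤ _ := pow_le_pow_left' h 2
    _ = _ := by
      rw [mul_pow, ← rpow_two, ← rpow_two, ← rpow_mul, ← rpow_mul]
      norm_num

lemma finrank_E3 : Module.finrank ℝ E3 = 3 := by simp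

lemma lintegral_homothety (x : E3) {s : ℝ} (hs : 0 < s) (F : E3 → ℝ≥0∞) (hF : Measurable F) :
    ∫⁻ y, F (x + s • (y - x)) = oR ((s ^ 3)⁻¹) * ∫⁻ w, F w := by
  have h1 : ∫⁻ y, F (x + s • (y - x)) = ∫⁻ y, F (x + s • y) :=
    lintegral_sub_right_eq_self (fun y => F (x + s • y)) x
  have h2 : ∫⁻ y, F (x + s • y) = ∫⁻ w, F (x + w) ∂(Measure.map (s • ·) (volume : Measure E3)) := by
    rw [lintegral_map (by fun_prop) (by fun_prop)]
  rw [h1, h2, Measure.map_addHaar_smul _ hs.ne', lintegral_smul_measure, finrank_E3,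
    abs_of_pos pz, lintegral_add_left_eq_self]
  rfl

lemma lk_ball : ∃ C : ℝ, 0 < C ∧ ∀ (xo w : E3) (ρ : ℝ), 0 < ρ →
    ∫⁻ x in ball xo ρ, lk (x - w) ^ 4 ≤ oR (C * ρ ^ (1/3 : ℝ)) := by
  have hI : IntegrableOn (fun x : E3 => ‖x‖ ^ (-(8/3) : ℝ)) (ball 0 1) := by
    apply integrableOn_ball_of_norm_le_rpow (C := 1) (α := 8/3)
    · rw [finrank_E3]; norm_num
    · filter_upwards with x
      rw [Real.norm_of_nonneg pz, one_mul]
    · exact (by fun_prop : Measurable (fun x : E3 => ‖x‖ ^ (-(8/3) : ℝ))).aestronglyMeasurable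
    · simp
  have hl4 : ∀ x : E3, lk x ^ 4 = oR (‖x‖ ^ (-(8/3) : ℝ)) := by
    intro x
    rw [lk_def, ← ofReal_pow pz, ← Real.rpow_natCast, ← Real.rpow_mul (norm_nonneg _)]
    norm_num
  have hfin : ∫⁻ x in ball (0 : E3) 1, lk x ^ 4 < ∞ := by
    simp_rw [hl4]
    exact hI.lintegral_lt_top
  set C₀ := (∫⁻ x in ball (0 : E3) 1, lk x ^ 4).toReal
  have hC₀ : ∫⁻ x in ball (0 : E3) 1, lk x ^ 4 = oR C₀ := (ofReal_toReal hfin.ne).symm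
  set V₀ := (volume (ball (0 : E3) 1)).toReal
  have hV₀ : volume (ball (0 : E3) 1) = oR V₀ := (ofReal_toReal measure_ball_lt_top.ne).symm
  have hC0 : 0 ≤ C₀ := toReal_nonneg
  have hV0 : 0 ≤ V₀ := toReal_nonneg
  refine ⟨C₀ + V₀ + 1, by positivity, fun xo w ρ hρ => ?_⟩
  have hscale : ∫⁻ x in ball w ρ, lk (x - w) ^ 4 = oR (C₀ * ρ ^ (1/3 : ℝ)) := by
    rw [← lintegral_indicator measurableSet_ball]
    have h1 := lintegral_homothety w hρ
      ((ball w ρ).indicator fun x => lk (x - w) ^ 4)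
      (((lk_meas.comp (by fun_prop)).pow_const 4).indicator measurableSet_ball)
    have h2 : ∫⁻ y, (ball w ρ).indicator (fun x => lk (x - w) ^ 4) (w + ρ • (y - w)) =
        oR (ρ ^ (-(8/3) : ℝ)) * oR C₀ := by
      rw [← hC₀, ← lintegral_const_mul _ (lk_meas.pow_const 4), ← lintegral_indicator measurableSet_ball,
        ← lintegral_sub_right_eq_self (fun a => (ball (0:E3) 1).indicator (fun a => oR (ρ ^ (-(8/3):ℝ)) * lk a ^ 4) a) w]
      congr 1; ext y
      have : w + ρ • (y - w) ∈ ball w ρ ↔ y - w ∈ ball (0 : E3) 1 := by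
        simp only [mem_ball, dist_zero_right, dist_self_add_left, norm_smul, Real.norm_of_nonneg hρ.le]
        constructor
        · intro h; by_contra h'; push Not at h'; nlinarith
        · intro h; nlinarith
      by_cases hy : y - w ∈ ball (0 : E3) 1
      · rw [indicator_of_mem hy, indicator_of_mem (this.2 hy), hl4, hl4,
          ← ofReal_mul pz, add_sub_cancel_left, norm_smul,
          Real.norm_of_nonneg hρ.le, Real.mul_rpow hρ.le (norm_nonneg _)]
      · rw [indicator_of_notMem hy, indicator_of_notMem (fun h => hy (this.1 h))]
    rw [h2] at h1
    have h3 : oR (ρ^3) * (oR ((ρ ^ 3)⁻¹) *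
        ∫⁻ (w_1 : E3), (ball w ρ).indicator (fun x => lk (x - w) ^ 4) w_1) =
        ∫⁻ (w_1 : E3), (ball w ρ).indicator (fun x => lk (x - w) ^ 4) w_1 := by
      rw [← mul_assoc, ← ofReal_mul pz, mul_inv_cancel₀ pz]; simp
    rw [← h3, ← h1, ← ofReal_mul pz, ← ofReal_mul pz]
    congr 1
    have : ρ ^ (1/3 : ℝ) = ρ^3 * ρ ^ (-(8/3) : ℝ) := by
      rw [← Real.rpow_natCast, ← Real.rpow_add hρ]; norm_num
    rw [this]; ring
  have hsplit : ball xo ρ ⊆ ball w ρ ∪ (ball xo ρ \ ball w ρ) := by intro x; by_cases x ∈ ball w ρ <;> simp_all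
  calc ∫⁻ x in ball xo ρ, lk (x - w) ^ 4 ≤ ∫⁻ x in ball w ρ ∪ (ball xo ρ \ ball w ρ), lk (x - w) ^ 4 :=
        lintegral_mono_set hsplit
    _ ≤ (∫⁻ x in ball w ρ, lk (x - w) ^ 4) + ∫⁻ x in ball xo ρ \ ball w ρ, lk (x - w) ^ 4 :=
        lintegral_union_le _ _ _
    _ ≤ oR (C₀ * ρ ^ (1/3 : ℝ)) + oR (V₀ * ρ ^ (1/3:ℝ)) := by
        rw [hscale]
        gcongr
        calc _ ≤ ∫⁻ x in ball xo ρ \ ball w ρ, oR (ρ ^ (-(8/3) : ℝ)) := by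
              apply setLIntegral_mono measurable_const
              intro x hx
              rw [hl4]
              apply ofReal_le_ofReal
              apply Real.rpow_le_rpow_of_nonpos hρ _ (by norm_num)
              have := hx.2
              simpa [mem_ball, dist_eq_norm] using this
          _ ≤ oR (ρ ^ (-(8/3) : ℝ)) * volume (ball xo ρ) := by
              rw [lintegral_const, Measure.restrict_apply_univ]
              gcongr
              exact sdiff_subset
          _ = _ := by
              rw [Measure.addHaar_ball _ _ hρ.le, finrank_E3, hV₀, ← ofReal_mul pz,
                ← ofReal_mul pz]
              congr 1
              have : ρ ^ (1/3 : ℝ) = ρ^3 * ρ ^ (-(8/3) : ℝ) := by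
                rw [← Real.rpow_natCast, ← Real.rpow_add hρ]; norm_num
              rw [this]; ring
    _ ≤ _ := by
        rw [← ofReal_add pz pz]
        apply ofReal_le_ofReal
        have : 0 ≤ ρ ^ (1/3:ℝ) := by positivity
        nlinarith

lemma lintegral_inv4 (c : ℝ) (hc : 0 < c) :
    ∫⁻ s in Ioi c, oR (s⁻¹ ^ 4) = oR (c⁻¹ ^ 3 / 3) := by
  have h1 : ∀ s ∈ Ioi c, oR (s⁻¹ ^ 4) = oR (s ^ (-4 : ℝ)) := by
    intro s hs
    have : 0 < s := hc.trans hs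
    rw [Real.rpow_neg this.le, inv_pow]; norm_cast
  rw [setLIntegral_congr_fun measurableSet_Ioi h1, ← ofReal_integral_eq_lintegral_ofReal
    (integrableOn_Ioi_rpow_of_lt (by norm_num) hc), integral_Ioi_rpow_of_lt (by norm_num) hc]
  · congr 1
    rw [show (-4 + 1 : ℝ) = -3 by norm_num, Real.rpow_neg hc.le]
    norm_cast; rw [inv_pow]; push_cast; field_simp
  · filter_upwards [ae_restrict_mem measurableSet_Ioi] with s hs
    have : 0 < s := hc.trans hs
    positivity

lemma lk3 (x : E3) : lk x ^ 3 = oR (‖x‖⁻¹ ^ 2) := by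
  rw [lk_def, ← ofReal_pow pz, ← Real.rpow_natCast, ← Real.rpow_mul (norm_nonneg _),
    inv_pow]
  norm_num

lemma smooth_osc (f : E3 → ℝ) (hf : ContDiff ℝ 1 f) (xo x : E3) (r : ℝ) (hr : 0 < r)
    (hx : x ∈ ball xo r) :
    ∫⁻ y in ball xo r, ‖f x - f y‖ₑ ≤
      oR (8 / 3 * r ^ 3) * ∫⁻ w in ball xo r, ‖fderiv ℝ f w‖ₑ * lk (x - w) ^ 3 := by
  have hcont : Continuous (fderiv ℝ f) := hf.continuous_fderiv (by norm_num)
  obtain ⟨g, hg⟩ : ∃ g : E3 → ℝ≥0∞, g = (ball xo r).indicator fun w => ‖fderiv ℝ f w‖ₑ := ⟨_, rfl⟩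
  have hgm : Measurable g := hg ▸ (hcont.measurable.enorm).indicator measurableSet_ball
  obtain ⟨G, hG⟩ : ∃ G : ℝ → E3 → ℝ≥0∞, G = fun s w => g w * (‖w - x‖ₑ * oR s⁻¹ *
    (Ioi (‖w - x‖ / (2 * r))).indicator 1 s) := ⟨_, rfl⟩
  have hset : MeasurableSet {q : ℝ × E3 | ‖q.2 - x‖ / (2 * r) < q.1} :=
    measurableSet_lt (by fun_prop) (by fun_prop)
  have hGm : Measurable (Function.uncurry G) := by
    rw [hG]
    apply Measurable.mul (by fun_prop)
    apply Measurable.mul (by fun_prop)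
    exact (measurable_one.indicator hset : Measurable ({q : ℝ × E3 | ‖q.2 - x‖ / (2 * r) < q.1}.indicator (1 : ℝ × E3 → ℝ≥0∞)))
  have hpt : ∀ y ∈ ball xo r, ‖f x - f y‖ₑ ≤ ∫⁻ s in Ioc (0:ℝ) 1, G s (x + s • (y - x)) := by
    intro y hy
    have h1 : f y - f x = ∫ s in (0:ℝ)..1, fderiv ℝ f (x + s • (y - x)) (y - x) := by
      have := intervalIntegral.integral_eq_sub_of_hasDerivAt (a := 0) (b := 1)
        (f := fun s : ℝ => f (x + s • (y - x))) (f' := fun s => fderiv ℝ f (x + s • (y - x)) (y - x)) ?_ ?_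
      · rw [this]; simp
      · intro s _
        have h2 : HasDerivAt (fun s : ℝ => x + s • (y - x)) (y - x) s := by
          simpa using ((hasDerivAt_id s).smul_const (y - x)).const_add x
        exact ((hf.differentiable (by norm_num)) _).hasFDerivAt.comp_hasDerivAt s h2
      · apply Continuous.intervalIntegrable; fun_prop
    rw [← enorm_neg, neg_sub, h1, intervalIntegral.integral_of_le zero_le_one]
    refine (enorm_integral_le_lintegral_enorm _).trans ?_
    apply setLIntegral_mono' measurableSet_Ioc
    intro s hs
    have hw : x + s • (y - x) ∈ ball xo r :=
      (convex_ball xo r).add_smul_sub_mem hx hy ⟨hs.1.le, hs.2⟩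
    have hxy : ‖y - x‖ < 2 * r := by
      rw [← dist_eq_norm]
      calc dist y x ≤ dist y xo + dist x xo := dist_triangle_right _ _ _
        _ < 2 * r := by rw [mem_ball] at hx hy; linarith
    simp only [hG, hg, indicator_of_mem hw]
    have hn : ‖x + s • (y - x) - x‖ = s * ‖y - x‖ := by
      rw [add_sub_cancel_left, norm_smul, Real.norm_of_nonneg hs.1.le]
    have hmem : s ∈ Ioi (‖x + s • (y - x) - x‖ / (2 * r)) := by
      rw [mem_Ioi, hn, div_lt_iff₀ pz]
      exact mul_lt_mul_of_pos_left hxy hs.1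
    rw [indicator_of_mem hmem, Pi.one_apply, mul_one]
    refine (ContinuousLinearMap.le_opENorm _ _).trans ?_
    gcongr
    rw [← ofReal_norm, ← ofReal_norm, hn, ← ofReal_mul (by have := hs.1; positivity)]
    apply le_of_eq; congr 1
    have := hs.1
    field_simp
  calc ∫⁻ y in ball xo r, ‖f x - f y‖ₑ
      ≤ ∫⁻ y in ball xo r, ∫⁻ s in Ioc (0:ℝ) 1, G s (x + s • (y - x)) :=
        setLIntegral_mono' measurableSet_ball hpt
    _ ≤ ∫⁻ y, ∫⁻ s in Ioc (0:ℝ) 1, G s (x + s • (y - x)) := setLIntegral_le_lintegral _ _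
    _ = ∫⁻ s in Ioc (0:ℝ) 1, ∫⁻ y, G s (x + s • (y - x)) := by
        rw [lintegral_lintegral_swap]
        exact (hGm.comp (by fun_prop : Measurable fun q : ET => (q.2, x + q.2 • (q.1 - x)))).aemeasurable
    _ = ∫⁻ s in Ioc (0:ℝ) 1, ∫⁻ w, oR ((s ^ 3)⁻¹) * G s w := by
        apply setLIntegral_congr_fun measurableSet_Ioc
        intro s hs
        have hm : Measurable (G s) := hGm.comp (by fun_prop : Measurable fun w : E3 => (s, w))
        simp only
        rw [lintegral_homothety x hs.1 (G s) hm, lintegral_const_mul _ hm]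
    _ = ∫⁻ w, ∫⁻ s in Ioc (0:ℝ) 1, oR ((s ^ 3)⁻¹) * G s w := by
        rw [lintegral_lintegral_swap]
        exact (Measurable.mul (by fun_prop) hGm).aemeasurable
    _ ≤ ∫⁻ w, oR (8 / 3 * r ^ 3) * (g w * lk (x - w) ^ 3) := by
        apply lintegral_mono; intro w
        by_cases hwx : w = x
        · subst hwx; simp [hG]
        have hp : 0 < ‖w - x‖ := norm_pos_iff.2 (sub_ne_zero.2 hwx)
        have hc : 0 < ‖w - x‖ / (2 * r) := by positivity
        calc ∫⁻ s in Ioc (0:ℝ) 1, oR ((s ^ 3)⁻¹) * G s w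
            = ∫⁻ s in Ioc (0:ℝ) 1, g w * ‖w - x‖ₑ *
              (Ioi (‖w - x‖ / (2 * r))).indicator (fun s => oR (s⁻¹ ^ 4)) s := by
              apply setLIntegral_congr_fun measurableSet_Ioc
              intro s hs
              simp only [hG]
              have hs0 := hs.1
              by_cases hm : s ∈ Ioi (‖w - x‖ / (2 * r))
              · rw [indicator_of_mem hm, indicator_of_mem hm, Pi.one_apply, mul_one]
                rw [show s⁻¹ ^ 4 = (s ^ 3)⁻¹ * s⁻¹ by field_simp, ofReal_mul pz]
                ring
              · rw [indicator_of_notMem hm, indicator_of_notMem hm]; simp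
          _ ≤ ∫⁻ s, g w * ‖w - x‖ₑ *
              (Ioi (‖w - x‖ / (2 * r))).indicator (fun s => oR (s⁻¹ ^ 4)) s :=
              setLIntegral_le_lintegral _ _
          _ = g w * ‖w - x‖ₑ * oR ((‖w - x‖ / (2 * r))⁻¹ ^ 3 / 3) := by
              rw [lintegral_const_mul _ ((by fun_prop : Measurable fun s : ℝ => oR (s⁻¹ ^ 4)).indicator measurableSet_Ioi),
                lintegral_indicator measurableSet_Ioi, lintegral_inv4 _ hc]
          _ = oR (8 / 3 * r ^ 3) * (g w * lk (x - w) ^ 3) := by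
              rw [lk3, norm_sub_rev x w, mul_assoc, ← ofReal_norm, ← ofReal_mul (norm_nonneg _),
                mul_left_comm, ← ofReal_mul pz]
              congr 2
              field_simp
              ring
          _ ≤ _ := le_rfl
    _ = _ := by
        rw [lintegral_const_mul, ← lintegral_indicator measurableSet_ball]
        · congr 2; ext w
          simp only [hg]
          by_cases hw : w ∈ ball xo r
          · rw [indicator_of_mem hw, indicator_of_mem hw]
          · rw [indicator_of_notMem hw, indicator_of_notMem hw, zero_mul]
        · exact hgm.mul ((lk_meas.comp (by fun_prop)).pow_const 3)

lemma lk_symm (x w : E3) : lk (x - w) = lk (w - x) := by rw [lk_def, lk_def, norm_sub_rev]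

lemma four_pt {α : Type*} [MeasurableSpace α] (μ : Measure α) {g l : α → ℝ≥0∞}
    (hg : Measurable g) (hl : Measurable l) : (∫⁻ w, g w * l w ^ 3 ∂μ) ^ 4 ≤
      (∫⁻ w, g w ^ 2 ∂μ) * (∫⁻ w, l w ^ 4 ∂μ) ^ 2 * ∫⁻ w, g w ^ 2 * l w ^ 4 ∂μ := by
  have h1 := lintegral_cs μ (hg.mul hl).aemeasurable (hl.pow_const 2).aemeasurable
  have h2 := lintegral_cs μ hg.aemeasurable (hg.mul (hl.pow_const 2)).aemeasurable
  have e1 : ∀ w, (g * l) w * l w ^ 2 = g w * l w ^ 3 := fun w => by simp only [Pi.mul_apply]; ring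
  have e2 : ∀ w, (g * l) w ^ 2 = g w * (g w * l w ^ 2) := fun w => by simp only [Pi.mul_apply]; ring
  have e3 : ∀ w, (l w ^ 2) ^ 2 = l w ^ 4 := fun w => by ring
  have e4 : ∀ w, (g w * l w ^ 2) ^ 2 = g w ^ 2 * l w ^ 4 := fun w => by ring
  simp only [Pi.mul_apply, e4] at h2
  simp only [e1, e2, e3] at h1
  calc _ = ((∫⁻ w, g w * l w ^ 3 ∂μ) ^ 2) ^ 2 := by ring
    _ ≤ ((∫⁻ w, g w * (g w * l w ^ 2) ∂μ) * ∫⁻ w, l w ^ 4 ∂μ) ^ 2 := by gcongr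
    _ = (∫⁻ w, g w * (g w * l w ^ 2) ∂μ) ^ 2 * (∫⁻ w, l w ^ 4 ∂μ) ^ 2 := by ring
    _ ≤ ((∫⁻ w, g w ^ 2 ∂μ) * ∫⁻ w, g w ^ 2 * l w ^ 4 ∂μ) * (∫⁻ w, l w ^ 4 ∂μ) ^ 2 := by gcongr
    _ = _ := by ring

lemma lk_four : ∃ C : ℝ, 0 < C ∧ ∀ (xo : E3) (r : ℝ) (g : E3 → ℝ≥0∞), 0 < r → Measurable g →
    ∫⁻ x in ball xo r, (∫⁻ w in ball xo r, g w * lk (x - w) ^ 3) ^ 4 ≤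
      oR (C * r) * (∫⁻ w in ball xo r, g w ^ 2) ^ 2 := by
  obtain ⟨C, hC, hl⟩ := lk_ball
  refine ⟨C ^ 3, by positivity, fun xo r g hr hg => ?_⟩
  have hlx : ∀ x : E3, Measurable fun w => lk (x - w) := fun x => lk_meas.comp (by fun_prop)
  have hlxw : Measurable fun q : E3 × E3 => lk (q.1 - q.2) := lk_meas.comp (by fun_prop)
  obtain ⟨K, hK⟩ : ∃ K, K = oR (C * r ^ (1/3 : ℝ)) := ⟨_, rfl⟩
  have hK3 : K ^ 3 = oR (C ^ 3 * r) := by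
    rw [hK, ← ofReal_pow pz, mul_pow, ← Real.rpow_natCast (r ^ _),
      ← Real.rpow_mul hr.le]
    norm_num
  have hpt : ∀ x, (∫⁻ w in ball xo r, g w * lk (x - w) ^ 3) ^ 4 ≤
      (∫⁻ w in ball xo r, g w ^ 2) * K ^ 2 * ∫⁻ w in ball xo r, g w ^ 2 * lk (x - w) ^ 4 := by
    intro x
    refine (four_pt (volume.restrict (ball xo r)) hg (hlx x)).trans ?_
    gcongr
    rw [hK]
    refine le_trans (le_of_eq ?_) (hl xo x r hr)
    simp_rw [lk_symm]
  calc _ ≤ ∫⁻ x in ball xo r, (∫⁻ w in ball xo r, g w ^ 2) * K ^ 2 *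
        ∫⁻ w in ball xo r, g w ^ 2 * lk (x - w) ^ 4 := lintegral_mono hpt
    _ = (∫⁻ w in ball xo r, g w ^ 2) * K ^ 2 *
        ∫⁻ w in ball xo r, g w ^ 2 * ∫⁻ x in ball xo r, lk (x - w) ^ 4 := by
        have hmm : Measurable fun x : E3 => ∫⁻ w in ball xo r, g w ^ 2 * lk (x - w) ^ 4 :=
          Measurable.lintegral_prod_right'
            (f := fun q : E3 × E3 => g q.2 ^ 2 * lk (q.1 - q.2) ^ 4) (by fun_prop)
        rw [lintegral_const_mul _ hmm,
          lintegral_lintegral_swap (by fun_prop)]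
        congr 2; ext w
        rw [lintegral_const_mul]
        exact (lk_meas.comp (by fun_prop : Measurable fun x : E3 => x - w)).pow_const 4
    _ ≤ (∫⁻ w in ball xo r, g w ^ 2) * K ^ 2 * ∫⁻ w in ball xo r, g w ^ 2 * K := by
        gcongr with w
        rw [hK]; exact hl xo w r hr
    _ = _ := by
        rw [lintegral_mul_const _ (by fun_prop), ← hK3]; ring

def mol (r : ℝ) (hr : 0 < r) (n : ℕ) : ContDiffBump (0 : E3) where
  rIn := r / (2 * (n + 2))
  rOut := r / (n + 2)
  rIn_pos := by positivity
  rIn_lt_rOut := by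
    apply div_lt_div_of_pos_left hr pz
    have : (0:ℝ) ≤ n := n.cast_nonneg
    linarith

def rho (r : ℝ) (hr : 0 < r) (n : ℕ) : E3 → ℝ := (mol r hr n).normed volume

lemma opnorm_sq (L : E3 →L[ℝ] ℝ) : ‖L‖ ^ 2 ≤ ∑ i, (L (EuclideanSpace.single i 1)) ^ 2 := by
  have : ‖L‖ ≤ Real.sqrt (∑ i, (L (EuclideanSpace.single i 1)) ^ 2) := by
    apply L.opNorm_le_bound (Real.sqrt_nonneg _)
    intro x
    have hx : L x = ∑ i, x i * L (EuclideanSpace.single i 1) := by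
      conv_lhs => rw [← (EuclideanSpace.basisFun (Fin 3) ℝ).sum_repr x]
      simp
    rw [hx, EuclideanSpace.norm_eq, ← Real.sqrt_mul pz, Real.norm_eq_abs]
    apply Real.abs_le_sqrt
    have := Finset.sum_mul_sq_le_sq_mul_sq Finset.univ (fun i => x i) (fun i => L (EuclideanSpace.single i 1))
    simpa [mul_comm] using this
  calc ‖L‖ ^ 2 ≤ Real.sqrt (∑ i, (L (EuclideanSpace.single i 1)) ^ 2) ^ 2 := by gcongr
    _ = _ := Real.sq_sqrt pz

lemma rho_smooth (r : ℝ) (hr : 0 < r) (n : ℕ) : CD (rho r hr n) :=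
  (mol r hr n).contDiff_normed

lemma rho_compact (r : ℝ) (hr : 0 < r) (n : ℕ) : HasCompactSupport (rho r hr n) :=
  (mol r hr n).hasCompactSupport_normed

lemma rho_int (r : ℝ) (hr : 0 < r) (n : ℕ) : ∫⁻ x, oR (rho r hr n x) = 1 := by
  rw [← ofReal_integral_eq_lintegral_ofReal]
  · rw [rho, (mol r hr n).integral_normed]; simp
  · exact (rho_smooth r hr n).continuous.integrable_of_hasCompactSupport (rho_compact r hr n)
  · exact ae_of_all _ (fun x => (mol r hr n).nonneg_normed x)

lemma rho_conv_deriv (r : ℝ) (hr : 0 < r) (n : ℕ) (u : E3 → ℝ) (hu : Integrable u) (x : E3) (e : E3) :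
    fderiv ℝ (convolution (rho r hr n) u (ContinuousLinearMap.lsmul ℝ ℝ) volume) x e =
      - ∫ w, u w * fderiv ℝ (fun w => rho r hr n (x - w)) w e := by
  have h1 := (HasCompactSupport.hasFDerivAt_convolution_left (ContinuousLinearMap.lsmul ℝ ℝ)
    (rho_compact r hr n) ((rho_smooth r hr n).of_le (by simp)) hu.locallyIntegrable x).fderiv
  have hd : Differentiable ℝ (rho r hr n) := (rho_smooth r hr n).differentiable (by simp)
  have hc : Continuous (fderiv ℝ (rho r hr n)) := (rho_smooth r hr n).continuous_fderiv (by simp)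
  have hex := ((rho_compact r hr n).fderiv ℝ).convolutionExists_left
    ((ContinuousLinearMap.lsmul ℝ ℝ).precompL E3) hc hu.locallyIntegrable x
  rw [h1, convolution_def, ContinuousLinearMap.integral_apply hex, ← integral_neg,
    ← integral_sub_left_eq_self _ _ x]
  congr 1; ext w
  have h2 : fderiv ℝ (fun w => rho r hr n (x - w)) w = - fderiv ℝ (rho r hr n) (x - w) := by
    have h3 : HasFDerivAt (fun w : E3 => x - w) (-ContinuousLinearMap.id ℝ E3) w :=
      (hasFDerivAt_id w).const_sub x
    exact ((hd (x - w)).hasFDerivAt.comp w h3).fderiv.trans (by ext; simp)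
  rw [h2, _root_.sub_sub_cancel]
  simp [ContinuousLinearMap.precompL_apply, mul_comm]

lemma rho_l2 (r : ℝ) (hr : 0 < r) (n : ℕ) (d : E3 → ℝ) (hd : Measurable d) (x : E3) :
    oR ((∫ w, d w * rho r hr n (x - w)) ^ 2) ≤
      ∫⁻ w, oR (d w ^ 2) * oR (rho r hr n (x - w)) := by
  obtain ⟨k, hk⟩ : ∃ k : E3 → ℝ≥0∞, k = fun w => oR (rho r hr n (x - w)) := ⟨_, rfl⟩
  have hrm : Measurable (rho r hr n) := (rho_smooth r hr n).continuous.measurable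
  have hkm : Measurable k := by rw [hk]; fun_prop
  have hk1 : ∫⁻ w, k w = 1 := by
    rw [hk, lintegral_sub_left_eq_self (fun w => oR (rho r hr n w)) x]
    exact rho_int r hr n
  have h0 : ∀ w, 0 ≤ rho r hr n w := fun w => (mol r hr n).nonneg_normed w
  have hsq : ∀ w, (k w ^ (1/2 : ℝ)) ^ 2 = k w := fun w => by
    rw [← rpow_natCast, ← rpow_mul]; norm_num
  have h1 := lintegral_cs volume (f := fun w => ‖d w‖ₑ * k w ^ (1/2 : ℝ)) (g := fun w => k w ^ (1/2 : ℝ))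
    (by fun_prop) (by fun_prop)
  simp only [hsq, hk1, mul_one, mul_pow] at h1
  calc oR ((∫ w, d w * rho r hr n (x - w)) ^ 2)
      = ‖∫ w, d w * rho r hr n (x - w)‖ₑ ^ 2 := by
        rw [← sq_abs, ofReal_pow (abs_nonneg _), ← Real.norm_eq_abs, ofReal_norm]
    _ ≤ (∫⁻ w, ‖d w‖ₑ * k w ^ (1/2 : ℝ) * k w ^ (1/2 : ℝ)) ^ 2 := by
        gcongr
        refine (enorm_integral_le_lintegral_enorm _).trans (le_of_eq ?_)
        congr 1; ext w
        rw [mul_assoc, ← sq, hsq, enorm_mul, hk]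
        congr 1
        rw [← ofReal_norm, Real.norm_of_nonneg (h0 _)]
    _ ≤ ∫⁻ w, ‖d w‖ₑ ^ 2 * k w := h1
    _ = _ := by
        congr 1; ext w
        rw [hk, ← sq_abs, ofReal_pow (abs_nonneg _), ← Real.norm_eq_abs, ofReal_norm]

lemma sob_poinc : ∃ C : ℝ, 0 < C ∧ ∀ (xo : E3) (r : ℝ) (hr : 0 < r) (u : E3 → ℝ) (D : E3 → Fin 3 → ℝ),
    Measurable u → Measurable D → Integrable u →
    (∀ n, ∀ᵐ x ∂(volume.restrict (ball xo r)), ∀ i : Fin 3,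
      ∫ w, u w * fderiv ℝ (fun w => rho r hr n (x - w)) w (EuclideanSpace.single i 1) =
        - ∫ w, D w i * rho r hr n (x - w)) →
    ∫⁻ x in ball xo r, (∫⁻ y in ball xo r, ‖u x - u y‖ₑ) ^ 4 ≤
      oR (C * r ^ 13) * (∫⁻ w, oR (∑ i, (D w i) ^ 2)) ^ 2 := by
  obtain ⟨C, hC, hfour⟩ := lk_four
  refine ⟨(8/3) ^ 4 * C, by positivity, fun xo r hr u D hu hD hui hw => ?_⟩
  obtain ⟨f, hf⟩ : ∃ f : ℕ → E3 → ℝ, f = fun n => convolution (rho r hr n) u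
    (ContinuousLinearMap.lsmul ℝ ℝ) volume := ⟨_, rfl⟩
  have hfs : ∀ n, ContDiff ℝ 1 (f n) := fun n => by
    rw [hf]
    exact (rho_compact r hr n).contDiff_convolution_left _ ((rho_smooth r hr n).of_le (by simp))
      hui.locallyIntegrable
  have hfm : ∀ n, Measurable (f n) := fun n => (hfs n).continuous.measurable
  have hfdm : ∀ n, Measurable fun w => ‖fderiv ℝ (f n) w‖ₑ := fun n =>
    ((hfs n).continuous_fderiv (by simp)).measurable.enorm
  have hlim : ∀ᵐ x, Tendsto (fun n => f n x) atTop (𝓝 (u x)) := by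
    rw [hf]
    apply ContDiffBump.ae_convolution_tendsto_right_of_locallyIntegrable (K := 2) (φ := mol r hr) _ _
      hui.locallyIntegrable
    · have := (tendsto_const_div_atTop_nhds_zero_nat r).comp (tendsto_add_atTop_nat 2)
      refine this.congr fun n => ?_
      simp [mol]
    · filter_upwards with n
      simp only [mol]
      apply le_of_eq
      field_simp
  have hgrad : ∀ n, ∫⁻ x in ball xo r, ‖fderiv ℝ (f n) x‖ₑ ^ 2 ≤
      ∫⁻ w, oR (∑ i, (D w i) ^ 2) := by
    intro n
    have hrm : Measurable (rho r hr n) := (rho_smooth r hr n).continuous.measurable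
    calc _ ≤ ∫⁻ x in ball xo r, ∑ i, ∫⁻ w, oR (D w i ^ 2) *
          oR (rho r hr n (x - w)) := by
          apply lintegral_mono_ae
          filter_upwards [hw n] with x hx
          calc ‖fderiv ℝ (f n) x‖ₑ ^ 2 = oR (‖fderiv ℝ (f n) x‖ ^ 2) := by
                rw [ofReal_pow (norm_nonneg _), ofReal_norm]
            _ ≤ oR (∑ i, (fderiv ℝ (f n) x (EuclideanSpace.single i 1)) ^ 2) :=
                ofReal_le_ofReal (opnorm_sq _)
            _ = ∑ i, oR ((fderiv ℝ (f n) x (EuclideanSpace.single i 1)) ^ 2) :=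
                ofReal_sum_of_nonneg fun i _ => sq_nonneg _
            _ ≤ _ := by
                apply Finset.sum_le_sum; intro i _
                rw [hf, rho_conv_deriv r hr n u hui x, hx i, neg_neg]
                exact rho_l2 r hr n (fun w => D w i) (by fun_prop) x
      _ ≤ ∫⁻ x, ∑ i, ∫⁻ w, oR (D w i ^ 2) *
          oR (rho r hr n (x - w)) := setLIntegral_le_lintegral _ _
      _ = ∑ i, ∫⁻ w, oR (D w i ^ 2) := by
          rw [lintegral_finsetSum]
          · apply Finset.sum_congr rfl; intro i _
            rw [lintegral_lintegral_swap (by fun_prop)]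
            congr 1; ext w
            rw [lintegral_const_mul _ (by fun_prop),
              lintegral_sub_right_eq_self (fun x => oR (rho r hr n x)) w, rho_int, mul_one]
          · intro i _
            exact Measurable.lintegral_prod_right' (f := fun q : E3 × E3 =>
              oR (D q.2 i ^ 2) * oR (rho r hr n (q.1 - q.2))) (by fun_prop)
      _ = _ := by
          rw [← lintegral_finsetSum _ (by intro i _; fun_prop)]
          congr 1; ext w
          rw [ofReal_sum_of_nonneg fun i _ => sq_nonneg _]
  have hFm : ∀ n, Measurable fun x => ∫⁻ y in ball xo r, ‖f n x - f n y‖ₑ := fun n => by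
    have := hfm n
    exact Measurable.lintegral_prod_right' (f := fun q : E3 × E3 => ‖f n q.1 - f n q.2‖ₑ) (by fun_prop)
  have hbd : ∀ n, ∫⁻ x in ball xo r, (∫⁻ y in ball xo r, ‖f n x - f n y‖ₑ) ^ 4 ≤
      oR ((8/3) ^ 4 * C * r ^ 13) * (∫⁻ w, oR (∑ i, (D w i) ^ 2)) ^ 2 := by
    intro n
    have hlkm : Measurable fun q : E3 × E3 => lk (q.1 - q.2) := lk_meas.comp (by fun_prop)
    have hmm : Measurable fun x : E3 => (∫⁻ w in ball xo r, ‖fderiv ℝ (f n) w‖ₑ * lk (x - w) ^ 3) ^ 4 := by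
      apply Measurable.pow_const
      have := hfdm n
      exact Measurable.lintegral_prod_right' (f := fun q : E3 × E3 =>
        ‖fderiv ℝ (f n) q.2‖ₑ * lk (q.1 - q.2) ^ 3) (by fun_prop)
    calc _ ≤ ∫⁻ x in ball xo r, oR (8 / 3 * r ^ 3) ^ 4 *
          (∫⁻ w in ball xo r, ‖fderiv ℝ (f n) w‖ₑ * lk (x - w) ^ 3) ^ 4 := by
          apply setLIntegral_mono' measurableSet_ball
          intro x hx
          rw [← mul_pow]
          gcongr
          exact smooth_osc (f n) (hfs n) xo x r hr hx
      _ ≤ oR (8 / 3 * r ^ 3) ^ 4 * (oR (C * r) *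
            (∫⁻ w in ball xo r, ‖fderiv ℝ (f n) w‖ₑ ^ 2) ^ 2) := by
          rw [lintegral_const_mul _ hmm]
          gcongr
          exact hfour xo r _ hr (hfdm n)
      _ ≤ oR (8 / 3 * r ^ 3) ^ 4 * (oR (C * r) *
            (∫⁻ w, oR (∑ i, (D w i) ^ 2)) ^ 2) := by
          exact mul_le_mul' le_rfl (mul_le_mul' le_rfl (pow_le_pow_left' (hgrad n) 2))
      _ = _ := by
          rw [← mul_assoc, ← ofReal_pow pz, ← ofReal_mul pz]
          congr 2; ring
  calc _ ≤ ∫⁻ x in ball xo r, (liminf (fun n => ∫⁻ y in ball xo r, ‖f n x - f n y‖ₑ) atTop) ^ 4 := by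
        apply lintegral_mono_ae
        filter_upwards [ae_restrict_of_ae hlim] with x hx
        gcongr
        refine le_trans ?_ (lintegral_liminf_le fun n => ?_)
        · apply lintegral_mono_ae
          filter_upwards [ae_restrict_of_ae hlim] with y hy
          exact ((hx.sub hy).enorm).liminf_eq.ge
        · have := hfm n
          fun_prop
    _ = ∫⁻ x in ball xo r, liminf (fun n => (∫⁻ y in ball xo r, ‖f n x - f n y‖ₑ) ^ 4) atTop := by
        congr 1; ext x
        exact Monotone.map_liminf_of_continuousAt (f := fun a : ℝ≥0∞ => a ^ 4)
          (fun a b h => pow_le_pow_left' h 4) _ (ENNReal.continuous_pow 4).continuousAt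
    _ ≤ liminf (fun n => ∫⁻ x in ball xo r, (∫⁻ y in ball xo r, ‖f n x - f n y‖ₑ) ^ 4) atTop :=
        lintegral_liminf_le fun n => (hFm n).pow_const 4
    _ ≤ _ := liminf_le_of_le (by isBoundedDefault) (fun b hb => by
        obtain ⟨n, hn⟩ := hb.exists
        exact hn.trans (hbd n))

abbrev ee (i : Fin 3) : E3 := EuclideanSpace.single i 1

local notation "pd(" f "," i ")" => fun y => fderiv ℝ f y (ee i)

def lapl (ψ : E3 → ℝ) (w : E3) : ℝ := ∑ i, fderiv ℝ pd(ψ,i) w (ee i)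

def hh (s : ℝ) : ℝ := -(1/2) * (s ^ (-(3/2) : ℝ) * Real.smoothTransition (2 * s - 1))

lemma chi_smooth : CD fun s : ℝ => Real.smoothTransition (2 * s - 1) :=
  Real.smoothTransition.contDiff.comp (by fun_prop)

lemma hh_zero (s : ℝ) (hs : s ≤ 1/2) : hh s = 0 := by
  rw [hh, Real.smoothTransition.zero_of_nonpos (by linarith)]; simp

lemma hh_smooth : CD hh := by
  rw [contDiff_iff_contDiffAt]
  intro s
  rcases lt_or_ge s (1/2) with h | h
  · refine (contDiffAt_const (c := (0:ℝ))).congr_of_eventuallyEq ?_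
    filter_upwards [Iio_mem_nhds h] with y hy
    exact hh_zero y (le_of_lt hy)
  · exact contDiffAt_const.mul ((Real.contDiffAt_rpow_const_of_ne (by linarith)).mul chi_smooth.contDiffAt)

def HH (s : ℝ) : ℝ := 1 + ∫ τ in (1:ℝ)..s, hh τ

lemma HH_deriv (s : ℝ) : HasDerivAt HH (hh s) s := by
  have hc := hh_smooth.continuous
  exact (intervalIntegral.integral_hasDerivAt_right (hc.intervalIntegrable _ _)
    (hc.stronglyMeasurableAtFilter _ _) hc.continuousAt).const_add 1

lemma HH_smooth : CD HH := by
  rw [contDiff_infty_iff_deriv]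
  refine ⟨fun s => (HH_deriv s).differentiableAt, ?_⟩
  rw [show deriv HH = hh from funext fun s => (HH_deriv s).deriv]
  exact hh_smooth

lemma HH_eq (s : ℝ) (hs : 1 ≤ s) : HH s = s ^ (-(1/2) : ℝ) := by
  have h := intervalIntegral.integral_eq_sub_of_hasDerivAt (a := 1) (b := s)
    (f := fun τ : ℝ => τ ^ (-(1/2) : ℝ)) (f' := hh) ?_ (hh_smooth.continuous.intervalIntegrable _ _)
  · rw [HH, h]; simp
  · intro τ hτ
    rw [uIcc_of_le hs] at hτ
    have h1 : 0 < τ := by linarith [hτ.1]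
    have := Real.hasDerivAt_rpow_const (x := τ) (p := -(1/2)) (Or.inl h1.ne')
    have h3 : hh τ = -(1/2) * τ ^ (-(1/2) - 1 : ℝ) := by
      rw [hh, Real.smoothTransition.one_of_one_le (by linarith [hτ.1])]
      norm_num
    rw [h3]; exact this

lemma hh_deriv (s : ℝ) (hs : 0 < s) : 6 * hh s + 4 * s * deriv hh s =
    -2 * s ^ (-(1/2) : ℝ) * deriv (fun s : ℝ => Real.smoothTransition (2 * s - 1)) s := by
  have h1 := Real.hasDerivAt_rpow_const (x := s) (p := -(3/2)) (Or.inl hs.ne')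
  have h2 := ((chi_smooth.differentiable (by simp)) s).hasDerivAt
  have h3 : HasDerivAt hh _ s := (h1.mul h2).const_mul (-(1/2))
  rw [h3.deriv, hh]
  have e1 : s ^ (-(3/2) - 1 : ℝ) = s ^ (-(1/2) : ℝ) * (s⁻¹ * s⁻¹) := by
    rw [← Real.rpow_neg_one, ← Real.rpow_add hs, ← Real.rpow_add hs]; norm_num
  have e2 : s ^ (-(3/2) : ℝ) = s ^ (-(1/2) : ℝ) * s⁻¹ := by
    rw [← Real.rpow_neg_one, ← Real.rpow_add hs]; norm_num
  rw [e1, e2]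
  field_simp
  ring

lemma chi_deriv_nonneg (s : ℝ) : 0 ≤ deriv (fun s : ℝ => Real.smoothTransition (2 * s - 1)) s := by
  apply Monotone.deriv_nonneg
  intro a b hab
  exact Real.smoothTransition.monotone (by linarith)

lemma chi_deriv_ne : ∃ s, 0 < s ∧ deriv (fun s : ℝ => Real.smoothTransition (2 * s - 1)) s ≠ 0 := by
  by_contra h
  push Not at h
  obtain ⟨c, hc, h2⟩ := exists_deriv_eq_slope (fun s : ℝ => Real.smoothTransition (2 * s - 1))
    (a := 1/2) (b := 1) (by norm_num) chi_smooth.continuous.continuousOn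
    (chi_smooth.differentiable (by simp)).differentiableOn
  rw [h c (by linarith [hc.1])] at h2
  norm_num at h2

lemma lapl_radial (y : E3) : lapl (fun y : E3 => HH (‖y‖ ^ 2)) y =
    6 * hh (‖y‖ ^ 2) + 4 * ‖y‖ ^ 2 * deriv hh (‖y‖ ^ 2) := by
  have h0 : ∀ y : E3, HasFDerivAt (fun y : E3 => ‖y‖ ^ 2) (2 • innerSL ℝ y) y := fun y =>
    (hasStrictFDerivAt_norm_sq y).hasFDerivAt
  have h1 : ∀ i, (fun y : E3 => fderiv ℝ (fun y : E3 => HH (‖y‖ ^ 2)) y (ee i)) =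
      fun y => hh (‖y‖ ^ 2) * (2 * y i) := by
    intro i; ext y
    have := (HH_deriv (‖y‖ ^ 2)).hasFDerivAt.comp y (h0 y)
    rw [show (fun y : E3 => HH (‖y‖ ^ 2)) = HH ∘ fun y => ‖y‖ ^ 2 from rfl, this.fderiv]
    simp [EuclideanSpace.inner_single_right]
    ring
  rw [lapl]
  have h2 : ∀ i, fderiv ℝ (fun y : E3 => hh (‖y‖ ^ 2) * (2 * y i)) y (ee i) =
      2 * hh (‖y‖ ^ 2) + 4 * (y i) ^ 2 * deriv hh (‖y‖ ^ 2) := by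
    intro i
    have hd := ((hh_smooth.differentiable (by simp)) (‖y‖ ^ 2)).hasDerivAt.hasFDerivAt.comp y (h0 y)
    have hl : HasFDerivAt (fun y : E3 => 2 * y i) ((2 : ℝ) • (EuclideanSpace.proj i : E3 →L[ℝ] ℝ)) y := by
      exact (EuclideanSpace.proj i : E3 →L[ℝ] ℝ).hasFDerivAt.const_mul 2
    have := hd.mul hl
    rw [show (fun y : E3 => hh (‖y‖ ^ 2) * (2 * y i)) = (hh ∘ fun y : E3 => ‖y‖ ^ 2) * fun y : E3 => 2 * y i from rfl,
      this.fderiv]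
    simp [EuclideanSpace.inner_single_right]
    ring
  simp_rw [h1, h2]
  rw [EuclideanSpace.norm_sq_eq]
  simp [Fin.sum_univ_three]
  ring

lemma exists_newton : ∃ N : E3 → ℝ, CD N ∧ (∀ y, ‖fderiv ℝ N y‖ ≤ ‖y‖⁻¹ ^ 2) ∧
    (∀ y, 1 ≤ ‖y‖ → N y = ‖y‖⁻¹) ∧ (∀ y, lapl N y ≤ 0) ∧ (∃ y, lapl N y ≠ 0) ∧
    (∀ y, 1 < ‖y‖ → lapl N y = 0) := by
  have h0 : ∀ y : E3, HasFDerivAt (fun y : E3 => ‖y‖ ^ 2) (2 • innerSL ℝ y) y := fun y =>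
    (hasStrictFDerivAt_norm_sq y).hasFDerivAt
  have hl : ∀ y : E3, y ≠ 0 → lapl (fun y : E3 => HH (‖y‖ ^ 2)) y = -2 * (‖y‖ ^ 2) ^ (-(1/2) : ℝ) *
      deriv (fun s : ℝ => Real.smoothTransition (2 * s - 1)) (‖y‖ ^ 2) := fun y hy => by
    rw [lapl_radial, hh_deriv _ pz]
  refine ⟨fun y => HH (‖y‖ ^ 2), HH_smooth.comp (contDiff_norm_sq ℝ), fun y => ?_, fun y hy => ?_,
    fun y => ?_, ?_, fun y hy => ?_⟩
  · have := (HH_deriv (‖y‖ ^ 2)).hasFDerivAt.comp y (h0 y)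
    rw [show (fun y : E3 => HH (‖y‖ ^ 2)) = HH ∘ fun y => ‖y‖ ^ 2 from rfl, this.fderiv]
    by_cases hy : y = 0
    · subst hy; simp
    have hp : 0 < ‖y‖ := norm_pos_iff.2 hy
    apply ContinuousLinearMap.opNorm_le_bound _ pz
    intro v
    simp only [ContinuousLinearMap.comp_apply,
      ContinuousLinearMap.toSpanSingleton_apply,
      _root_.smul_apply, innerSL_apply_apply, smul_eq_mul, nsmul_eq_mul]
    have hin := abs_real_inner_le_norm y v
    have hb : |hh (‖y‖ ^ 2)| ≤ 1/2 * ‖y‖⁻¹ ^ 3 := by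
      have h3 : (‖y‖ ^ 2) ^ (-(3/2) : ℝ) = ‖y‖⁻¹ ^ 3 := by
        rw [← Real.rpow_natCast, ← Real.rpow_mul hp.le, inv_pow, ← Real.rpow_natCast, ← Real.rpow_neg hp.le]
        norm_num
      rw [hh, h3, abs_mul, abs_mul, abs_of_nonneg (Real.smoothTransition.nonneg _), abs_of_nonneg (by positivity : 0 ≤ ‖y‖⁻¹ ^ 3)]
      have := Real.smoothTransition.le_one (2 * ‖y‖ ^ 2 - 1)
      have h4 : 0 ≤ ‖y‖⁻¹ ^ 3 := by positivity
      rw [show |(-(1/2) : ℝ)| = 1/2 by norm_num]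
      nlinarith
    rw [norm_mul, norm_mul, Real.norm_eq_abs, Real.norm_eq_abs, Real.norm_eq_abs]
    calc _ ≤ (2 * (‖y‖ * ‖v‖)) * (1/2 * ‖y‖⁻¹ ^ 3) := by
          norm_num
          gcongr
          simpa using hb
      _ = _ := by field_simp
  · simp only
    rw [HH_eq _ (by nlinarith), ← Real.rpow_natCast, ← Real.rpow_mul (norm_nonneg _),
      ← Real.rpow_neg_one]
    norm_num
  · by_cases hy : y = 0
    · subst hy; rw [lapl_radial]; simp [hh_zero]
    · rw [hl y hy]
      have := chi_deriv_nonneg (‖y‖ ^ 2)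
      have h2 : 0 ≤ (‖y‖ ^ 2) ^ (-(1/2) : ℝ) := by positivity
      nlinarith [mul_nonneg h2 this]
  · obtain ⟨s, hs, h⟩ := chi_deriv_ne
    refine ⟨Real.sqrt s • ee 0, ?_⟩
    have hn : ‖Real.sqrt s • ee 0‖ ^ 2 = s := by
      rw [norm_smul]; simp [Real.sq_sqrt hs.le]
    have h0 : Real.sqrt s • ee 0 ≠ 0 := by
      intro h; rw [h] at hn; simp at hn; exact hs.ne hn
    rw [hl _ h0, hn]
    have : 0 < s ^ (-(1/2) : ℝ) := by positivity
    exact mul_ne_zero (mul_ne_zero (by norm_num) this.ne') h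
  · have hy0 : y ≠ 0 := by intro h; subst h; simp at hy; linarith
    rw [hl y hy0]
    have : deriv (fun s : ℝ => Real.smoothTransition (2 * s - 1)) (‖y‖ ^ 2) = 0 := by
      have he : (fun s : ℝ => Real.smoothTransition (2 * s - 1)) =ᶠ[𝓝 (‖y‖ ^ 2)] fun _ => 1 := by
        filter_upwards [Ioi_mem_nhds (show 1 < ‖y‖ ^ 2 by nlinarith)] with s hs
        have : 1 < s := hs
        exact Real.smoothTransition.one_of_one_le (by linarith)
      rw [he.deriv_eq]; simp
    rw [this, mul_zero]

def newt : E3 → ℝ := exists_newton.choose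
def eta (y : E3) : ℝ := - lapl newt y

lemma newt_spec : CD newt ∧ (∀ y, ‖fderiv ℝ newt y‖ ≤ ‖y‖⁻¹ ^ 2) ∧
    (∀ y, 1 ≤ ‖y‖ → newt y = ‖y‖⁻¹) ∧ (∀ y, lapl newt y ≤ 0) ∧ (∃ y, lapl newt y ≠ 0) ∧
    (∀ y, 1 < ‖y‖ → lapl newt y = 0) := exists_newton.choose_spec

lemma partial_smooth {f : E3 → ℝ} (hf : CD f) (e : E3) :
    CD fun y => fderiv ℝ f y e :=
  (hf.fderiv_right (by simp)).clm_apply contDiff_const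

lemma lapl_smooth {f : E3 → ℝ} (hf : CD f) : CD (lapl f) :=
  ContDiff.sum fun i _ => partial_smooth (partial_smooth hf (ee i)) (ee i)

lemma eta_smooth : CD eta := (lapl_smooth newt_spec.1).neg

lemma eta_zero (y : E3) (hy : 1 < ‖y‖) : eta y = 0 := by rw [eta, newt_spec.2.2.2.2.2 y hy, neg_zero]

lemma eta_compact : HasCompactSupport eta := by
  apply HasCompactSupport.intro (isCompact_closedBall (0 : E3) 1)
  intro y hy
  apply eta_zero
  simpa using hy

lemma eta_int_pos : 0 < ∫ y, eta y := by
  obtain ⟨y, hy⟩ := newt_spec.2.2.2.2.1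
  exact eta_smooth.continuous.integral_pos_of_hasCompactSupport_nonneg_nonzero eta_compact
    (fun y => by have := newt_spec.2.2.2.1 y; simp only [Pi.zero_apply, eta]; linarith)
    (x := y) (by simpa [eta] using hy)

def NN (δ : ℝ) (y : E3) : ℝ := δ⁻¹ * newt (δ⁻¹ • y)

lemma fderiv_scale {f : E3 → ℝ} (hf : CD f) (a b : ℝ) (x y : E3) :
    fderiv ℝ (fun y => a * f (b • y + x)) y = (a * b) • fderiv ℝ f (b • y + x) := by
  have h1 : HasFDerivAt (fun y : E3 => b • y + x) (b • ContinuousLinearMap.id ℝ E3) y :=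
    ((hasFDerivAt_id y).const_smul b).add_const x
  have h2 := ((((hf.differentiable (by simp)) (b • y + x)).hasFDerivAt.comp y h1).const_mul a)
  refine h2.fderiv.trans ?_
  ext v; simp; ring

lemma lapl_scale {f : E3 → ℝ} (hf : CD f) (a b : ℝ) (x y : E3) :
    lapl (fun y => a * f (b • y + x)) y = a * b ^ 2 * lapl f (b • y + x) := by
  simp only [lapl, Finset.mul_sum]
  apply Finset.sum_congr rfl; intro i _
  have h1 : (fun y => fderiv ℝ (fun y => a * f (b • y + x)) y (ee i)) =
      fun y => (a * b) * pd(f,i) (b • y + x) := by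
    ext y; rw [fderiv_scale hf]; simp
  rw [h1, fderiv_scale (partial_smooth hf (ee i))]
  simp only [ContinuousLinearMap.smul_apply, smul_eq_mul]; ring

lemma lapl_sub {f g : E3 → ℝ} (hf : CD f) (hg : CD g) (y : E3) :
    lapl (fun y => f y - g y) y = lapl f y - lapl g y := by
  simp only [lapl, ← Finset.sum_sub_distrib]
  apply Finset.sum_congr rfl; intro i _
  have h1 : (fun y => fderiv ℝ (fun y => f y - g y) y (ee i)) =
      fun y => fderiv ℝ f y (ee i) - fderiv ℝ g y (ee i) := by
    ext y
    rw [fderiv_fun_sub ((hf.differentiable (by simp)) y) ((hg.differentiable (by simp)) y)]; rfl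
  rw [h1, fderiv_fun_sub ((((partial_smooth hf (ee i))).differentiable (by simp)) y)
    ((((partial_smooth hg (ee i))).differentiable (by simp)) y)]; rfl

lemma NN_eq (δ : ℝ) : NN δ = fun y => δ⁻¹ * newt (δ⁻¹ • y + 0) := by ext y; simp [NN]

lemma NN_smooth (δ : ℝ) : CD (NN δ) :=
  contDiff_const.mul (newt_spec.1.comp (by fun_prop))

lemma NN_fderiv (δ : ℝ) (hδ : 0 < δ) (y : E3) : ‖fderiv ℝ (NN δ) y‖ ≤ ‖y‖⁻¹ ^ 2 := by
  rw [NN_eq, fderiv_scale newt_spec.1, norm_smul]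
  have := newt_spec.2.1 (δ⁻¹ • y + 0)
  rw [add_zero, norm_smul, Real.norm_of_nonneg pz] at this
  rw [add_zero, Real.norm_of_nonneg pz]
  calc _ ≤ δ⁻¹ * δ⁻¹ * (δ⁻¹ * ‖y‖)⁻¹ ^ 2 := by gcongr
    _ = _ := by field_simp

lemma NN_far (δ : ℝ) (hδ : 0 < δ) (y : E3) (hy : δ ≤ ‖y‖) : NN δ y = ‖y‖⁻¹ := by
  have h : 1 ≤ ‖δ⁻¹ • y‖ := by
    rw [norm_smul, Real.norm_of_nonneg pz, inv_mul_eq_div, one_le_div hδ]; exact hy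
  rw [NN, newt_spec.2.2.1 _ h, norm_smul, Real.norm_of_nonneg pz]
  field_simp

lemma NN_lapl (δ : ℝ) (y : E3) : lapl (NN δ) y = - (δ⁻¹ ^ 3 * eta (δ⁻¹ • y)) := by
  rw [NN_eq, lapl_scale newt_spec.1, add_zero, eta]; ring

def MM (r : ℝ) (n : ℕ) (y : E3) : ℝ := NN (r / (n + 2)) y - NN r y

lemma MM_smooth (r : ℝ) (n : ℕ) : CD (MM r n) := (NN_smooth _).sub (NN_smooth _)

lemma MM_zero (r : ℝ) (hr : 0 < r) (n : ℕ) (y : E3) (hy : r ≤ ‖y‖) : MM r n y = 0 := by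
  rw [MM, NN_far r hr y hy, NN_far _ pz y, sub_self]
  refine le_trans (div_le_self hr.le ?_) hy
  have : (0:ℝ) ≤ n := n.cast_nonneg
  linarith

def psi (r : ℝ) (n : ℕ) (x w : E3) : ℝ := MM r n (x - w)

lemma psi_eq (r : ℝ) (n : ℕ) (x : E3) : psi r n x = fun w => 1 * MM r n ((-1 : ℝ) • w + x) := by
  ext w; rw [psi, one_mul]; congr 1; simp; abel

lemma psi_smooth (r : ℝ) (n : ℕ) (x : E3) : CD (psi r n x) :=
  (MM_smooth r n).comp (by fun_prop)

lemma psi_lapl (r : ℝ) (n : ℕ) (x w : E3) : lapl (psi r n x) w =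
    r⁻¹ ^ 3 * eta (r⁻¹ • (x - w)) - (r / (n + 2))⁻¹ ^ 3 * eta ((r / (n + 2))⁻¹ • (x - w)) := by
  rw [psi_eq, lapl_scale (MM_smooth r n), show (-1 : ℝ) • w + x = x - w by simp; abel]
  rw [show MM r n = fun y => NN (r / (n + 2)) y - NN r y from rfl, lapl_sub (NN_smooth _) (NN_smooth _),
    NN_lapl, NN_lapl]
  ring

lemma two_ofReal (a : ℝ) : 2 * oR a = oR (2 * a) := by
  rw [ofReal_mul (by norm_num), ofReal_ofNat]

lemma psi_fderiv (r : ℝ) (hr : 0 < r) (n : ℕ) (x w : E3) :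
    ‖fderiv ℝ (psi r n x) w‖ₑ ≤ 2 * lk (x - w) ^ 3 := by
  rw [psi_eq, fderiv_scale (MM_smooth r n), show (-1 : ℝ) • w + x = x - w by simp; abel, lk3]
  rw [show MM r n = fun y => NN (r / (n + 2)) y - NN r y from rfl,
    fderiv_fun_sub (((NN_smooth _).differentiable (by simp)) _) (((NN_smooth _).differentiable (by simp)) _)]
  rw [one_mul, neg_one_smul, enorm_neg, ← ofReal_norm, two_ofReal]
  apply ofReal_le_ofReal
  refine (norm_sub_le _ _).trans ?_
  have h1 := NN_fderiv (r / (n + 2)) pz (x - w)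
  have h2 := NN_fderiv r hr (x - w)
  linarith

lemma psi_tsupport (r : ℝ) (hr : 0 < r) (n : ℕ) (x : E3) : tsupport (psi r n x) ⊆ closedBall x r := by
  apply closure_minimal _ isClosed_closedBall
  intro w hw
  by_contra h
  apply hw
  apply MM_zero r hr
  rw [mem_closedBall, dist_comm, dist_eq_norm] at h
  linarith

lemma press_lim (P : E3 → ℝ) (hP : Integrable P) (r : ℝ) (hr : 0 < r) : ∀ᵐ x, Tendsto (fun n : ℕ =>
    ∫ w, P w * ((r / (n + 2))⁻¹ ^ 3 * eta ((r / (n + 2))⁻¹ • (x - w)))) atTop (𝓝 ((∫ y, eta y) * P x)) := by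
  obtain ⟨B, hB⟩ := eta_compact.exists_bound_of_continuous eta_smooth.continuous
  have hc := eta_int_pos
  obtain ⟨c, hcc⟩ : ∃ c, c = ∫ y, eta y := ⟨_, rfl⟩
  rw [← hcc] at hc ⊢
  have hδ0 : ∀ n : ℕ, 0 < r / ((n:ℝ) + 2) := fun n => by positivity
  have htend : Tendsto (fun n : ℕ => r / ((n:ℝ) + 2)) atTop (𝓝 0) := by
    have := (tendsto_const_div_atTop_nhds_zero_nat r).comp (tendsto_add_atTop_nat 2)
    refine this.congr fun n => ?_
    simp
  filter_upwards [(Besicovitch.vitaliFamily (volume : Measure E3)).ae_tendsto_average_norm_sub hP.locallyIntegrable] with x hx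
  have hx2 := hx.comp ((Besicovitch.tendsto_filterAt volume x).comp (tendsto_nhdsWithin_iff.2
    ⟨htend, Eventually.of_forall hδ0⟩))
  have h := tendsto_integral_smul_of_tendsto_average_norm_sub (μ := (volume : Measure E3)) (l := atTop)
    (a := fun n : ℕ => closedBall x (r / ((n:ℝ) + 2))) (f := P) (c := P x)
    (g := fun n w => c⁻¹ * ((r / ((n:ℝ) + 2))⁻¹ ^ 3 * eta ((r / ((n:ℝ) + 2))⁻¹ • (x - w))))
    (c⁻¹ * B * volume.real (ball (0:E3) 1)) hx2 (Eventually.of_forall fun n => hP.integrableOn) ?_ ?_ ?_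
  · have h2 := h.const_mul c
    refine h2.congr fun n => ?_
    rw [← integral_const_mul]
    congr 1; ext w
    simp only [smul_eq_mul]
    field_simp
  · refine tendsto_const_nhds.congr fun n => ?_
    rw [integral_const_mul, integral_const_mul,
      integral_sub_left_eq_self (fun w => eta ((r / ((n:ℝ) + 2))⁻¹ • w)) volume x,
      Measure.integral_comp_inv_smul_of_nonneg _ _ (hδ0 n).le, finrank_E3, ← hcc, smul_eq_mul]
    have := (hδ0 n).ne'
    field_simp
  · filter_upwards with n w hw
    by_contra h
    apply hw
    simp only
    rw [eta_zero, mul_zero, mul_zero]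
    rw [norm_smul, Real.norm_of_nonneg (by have := hδ0 n; positivity), inv_mul_eq_div, one_lt_div (hδ0 n)]
    rw [mem_closedBall, dist_comm, dist_eq_norm] at h
    linarith
  · filter_upwards with n w
    have hv : volume.real (closedBall x (r / ((n:ℝ) + 2))) = (r / ((n:ℝ) + 2)) ^ 3 * volume.real (ball (0:E3) 1) := by
      rw [Measure.addHaar_real_closedBall _ _ (hδ0 n).le, finrank_E3]
    have hv0 : 0 < volume.real (ball (0:E3) 1) := by
      rw [measureReal_def]; exact toReal_pos (measure_ball_pos _ _ one_pos).ne' measure_ball_lt_top.ne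
    have h1 := hδ0 n
    rw [hv, abs_mul, abs_mul, abs_of_pos (inv_pos.2 hc), abs_of_pos pz]
    have h2 := hB ((r / ((n:ℝ) + 2))⁻¹ • (x - w))
    rw [Real.norm_eq_abs] at h2
    calc _ ≤ c⁻¹ * ((r / ((n:ℝ) + 2))⁻¹ ^ 3 * B) := by gcongr
      _ = _ := by field_simp

lemma press_rep : ∃ C : ℝ, 0 < C ∧ ∀ (xo : E3) (r : ℝ) (P : E3 → ℝ) (F : E3 → E3), 0 < r →
    Integrable P →
    (∀ n, ∀ᵐ x ∂(volume.restrict (ball xo r)),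
      ∫ w, P w * lapl (psi r n x) w = ∫ w, ∑ i, F w i * fderiv ℝ (psi r n x) w (ee i)) →
    ∃ G : E3 → ℝ, (∀ x x', ‖G x - G x'‖ₑ ≤ oR (C * r⁻¹ ^ 4 * ‖x - x'‖) * ∫⁻ w, ‖P w‖ₑ) ∧
      ∀ᵐ x ∂(volume.restrict (ball xo r)), ‖P x - G x‖ₑ ≤
        oR C * ∫⁻ w, ‖F w‖ₑ * lk (x - w) ^ 3 := by
  obtain ⟨L, hL⟩ := eta_smooth.lipschitzWith_of_hasCompactSupport eta_compact (by simp)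
  obtain ⟨B, hB⟩ := eta_compact.exists_bound_of_continuous eta_smooth.continuous
  have hc := eta_int_pos
  obtain ⟨c, hcc⟩ : ∃ c, c = ∫ y, eta y := ⟨_, rfl⟩
  rw [← hcc] at hc
  refine ⟨c⁻¹ * (L + 2), by positivity, fun xo r P F hr hP hw => ?_⟩
  have hint : ∀ (a : ℝ) (x : E3), Integrable fun w => P w * (a⁻¹ ^ 3 * eta (a⁻¹ • (x - w))) := by
    intro a x
    apply hP.mul_bdd (c := |a⁻¹ ^ 3| * B)
    · have := eta_smooth.continuous
      exact Continuous.aestronglyMeasurable (by fun_prop)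
    · filter_upwards with w
      rw [norm_mul, Real.norm_eq_abs]
      gcongr
      exact hB _
  refine ⟨fun x => c⁻¹ * ∫ w, P w * (r⁻¹ ^ 3 * eta (r⁻¹ • (x - w))), fun x x' => ?_, ?_⟩
  · rw [← mul_sub, ← integral_sub (hint r x) (hint r x'), enorm_mul]
    calc _ ≤ ‖c⁻¹‖ₑ * ∫⁻ w, oR (r⁻¹ ^ 4 * L * ‖x - x'‖) * ‖P w‖ₑ := by
          gcongr
          refine (enorm_integral_le_lintegral_enorm _).trans (lintegral_mono fun w => ?_)
          rw [← mul_sub, enorm_mul, mul_comm]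
          gcongr
          rw [← ofReal_norm]
          apply ofReal_le_ofReal
          rw [← mul_sub, norm_mul, Real.norm_of_nonneg pz]
          have := hL.dist_le_mul (r⁻¹ • (x - w)) (r⁻¹ • (x' - w))
          rw [dist_eq_norm (eta _), dist_eq_norm (r⁻¹ • (x - w)), ← smul_sub, norm_smul,
            Real.norm_of_nonneg (inv_nonneg.2 hr.le), sub_sub_sub_cancel_right] at this
          calc _ ≤ r⁻¹ ^ 3 * (L * (r⁻¹ * ‖x - x'‖)) := by gcongr
            _ = _ := by ring
      _ = ‖c⁻¹‖ₑ * (oR (r⁻¹ ^ 4 * L * ‖x - x'‖) * ∫⁻ w, ‖P w‖ₑ) := by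
          rw [lintegral_const_mul'' _ hP.1.enorm]
      _ ≤ _ := by
          rw [← mul_assoc, ← ofReal_norm, Real.norm_of_nonneg pz, ← ofReal_mul pz]
          refine mul_le_mul' (ofReal_le_ofReal ?_) le_rfl
          have h1 : 0 ≤ c⁻¹ * r⁻¹ ^ 4 * ‖x - x'‖ := by positivity
          nlinarith
  · have hw' := ae_all_iff.2 hw
    filter_upwards [hw', ae_restrict_of_ae (press_lim P hP r hr)] with x hx hlim
    rw [← hcc] at hlim
    have hb : ∀ n : ℕ, ‖(∫ w, P w * ((r / (n + 2))⁻¹ ^ 3 * eta ((r / (n + 2))⁻¹ • (x - w)))) -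
        ∫ w, P w * (r⁻¹ ^ 3 * eta (r⁻¹ • (x - w)))‖ₑ ≤ 2 * ∫⁻ w, ‖F w‖ₑ * lk (x - w) ^ 3 := by
      intro n
      have h1 := hx n
      simp only [psi_lapl, mul_sub (P _)] at h1
      rw [integral_sub (hint _ _) (hint _ _)] at h1
      rw [← enorm_neg, neg_sub, h1, ← lintegral_const_mul' _ _ (by simp)]
      refine (enorm_integral_le_lintegral_enorm _).trans (lintegral_mono fun w => ?_)
      have h2 : ∑ i, F w i * fderiv ℝ (psi r n x) w (ee i) = fderiv ℝ (psi r n x) w (F w) := by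
        conv_rhs => rw [← (EuclideanSpace.basisFun (Fin 3) ℝ).sum_repr (F w)]
        simp
      rw [h2, mul_comm ‖F w‖ₑ, ← mul_assoc]
      refine (ContinuousLinearMap.le_opENorm _ _).trans ?_
      gcongr
      exact psi_fderiv r hr n x w
    have hlim2 := le_of_tendsto ((hlim.sub_const (∫ w, P w * (r⁻¹ ^ 3 * eta (r⁻¹ • (x - w))))).enorm)
      (Eventually.of_forall hb)
    calc ‖P x - c⁻¹ * ∫ w, P w * (r⁻¹ ^ 3 * eta (r⁻¹ • (x - w)))‖ₑ =
        ‖c⁻¹ * (c * P x - ∫ w, P w * (r⁻¹ ^ 3 * eta (r⁻¹ • (x - w))))‖ₑ := by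
          congr 1; field_simp
      _ ≤ ‖c⁻¹‖ₑ * (2 * ∫⁻ w, ‖F w‖ₑ * lk (x - w) ^ 3) := by rw [enorm_mul]; gcongr
      _ ≤ _ := by
          rw [← mul_assoc, ← ofReal_norm, Real.norm_of_nonneg pz, mul_comm (oR _),
            two_ofReal]
          refine mul_le_mul' (ofReal_le_ofReal ?_) le_rfl
          have : (0:ℝ) ≤ L := L.2
          have : 0 ≤ c⁻¹ := by positivity
          nlinarith

def bb : ℝ := volume.real (ball (0:E3) 1)

lemma bb_pos : 0 < bb := by
  rw [bb, measureReal_def]; exact toReal_pos (measure_ball_pos _ _ one_pos).ne' measure_ball_lt_top.ne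

lemma vol_ball (x : E3) (r : ℝ) (hr : 0 < r) : volume (ball x r) = oR (bb * r ^ 3) := by
  rw [Measure.addHaar_ball _ _ hr.le, finrank_E3, mul_comm, ofReal_mul bb_pos.le, bb, ofReal_measureReal]

def Vn (u : E3 → E3) (xo : E3) (R : ℝ) : ℝ≥0∞ := ∫⁻ w in ball xo R, ‖u w‖ₑ ^ 2
def Hn (D : E3 → Fin 3 → Fin 3 → ℝ) (xo : E3) (R : ℝ) : ℝ≥0∞ :=
  ∫⁻ w in ball xo R, oR (∑ i, ∑ j, (D w i j) ^ 2)
def An (p : E3 → ℝ) (xo : E3) (R : ℝ) : ℝ≥0∞ := ∫⁻ x in ball xo R, ∫⁻ y in ball xo R, ‖p x - p y‖ₑ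
def fv (u : E3 → E3) (D : E3 → Fin 3 → Fin 3 → ℝ) (w : E3) : E3 :=
  WithLp.toLp 2 fun i => ∑ j, u w j * D w j i
def fn (u : E3 → E3) (D : E3 → Fin 3 → Fin 3 → ℝ) (xo : E3) (R : ℝ) : ℝ≥0∞ :=
  ∫⁻ w in ball xo R, ‖fv u D w‖ₑ

structure Slice (u : E3 → E3) (D : E3 → Fin 3 → Fin 3 → ℝ) (p : E3 → ℝ) (xo : E3) (r : ℝ)
    (hr : 0 < r) : Prop where
  mu : Measurable u
  mD : Measurable D
  mp : Measurable p
  ui : IntegrableOn u (ball xo (2 * r))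
  pi : IntegrableOn p (ball xo (2 * r))
  sob : ∀ n, ∀ᵐ x ∂(volume.restrict (ball xo r)), ∀ i j : Fin 3,
      ∫ w in ball xo (2 * r), u w j * fderiv ℝ (fun w => rho r hr n (x - w)) w (ee i) =
        - ∫ w in ball xo (2 * r), D w i j * rho r hr n (x - w)
  prs : ∀ n, ∀ᵐ x ∂(volume.restrict (ball xo r)),
      ∫ w in ball xo (2 * r), p w * lapl (psi r n x) w =
        ∫ w in ball xo (2 * r), ∑ i, fv u D w i * fderiv ℝ (psi r n x) w (ee i)

lemma sum3_pow4 (a : Fin 3 → ℝ≥0∞) : (∑ j, a j) ^ 4 ≤ 81 * ∑ j, a j ^ 4 := by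
  obtain ⟨i, -, hi⟩ := Finset.exists_max_image Finset.univ a ⟨0, Finset.mem_univ 0⟩
  calc (∑ j, a j) ^ 4 ≤ (∑ _j : Fin 3, a i) ^ 4 := by gcongr with j; exact hi j (Finset.mem_univ j)
    _ = 81 * a i ^ 4 := by simp [mul_pow]; norm_num
    _ ≤ _ := by gcongr; exact Finset.single_le_sum (f := fun j => a j ^ 4) (fun _ _ => zero_le) (Finset.mem_univ i)

lemma enorm_le_sum (a : E3) : ‖a‖ₑ ≤ ∑ j, ‖a j‖ₑ := by
  conv_lhs => rw [← (EuclideanSpace.basisFun (Fin 3) ℝ).sum_repr a]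
  refine (enorm_sum_le _ _).trans ?_
  apply Finset.sum_le_sum
  intro i _
  have h1 : ‖EuclideanSpace.basisFun (Fin 3) ℝ i‖ₑ = 1 := by
    rw [← ofReal_norm, (EuclideanSpace.basisFun (Fin 3) ℝ).orthonormal.1 i, ofReal_one]
  rw [enorm_smul, h1, mul_one]
  simp

lemma meas_osc {F : Type*} [NormedAddCommGroup F] [MeasurableSpace F] [BorelSpace F]
    [SecondCountableTopology F] {f : E3 → F} (hf : Measurable f) (μ : Measure E3) [SFinite μ] :
    Measurable fun x => ∫⁻ y, ‖f x - f y‖ₑ ∂μ :=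
  Measurable.lintegral_prod_right' (f := fun q : E3 × E3 => ‖f q.1 - f q.2‖ₑ) (by fun_prop)

lemma sobv : ∃ C : ℝ, 0 < C ∧ ∀ u D p xo r (hr : 0 < r), Slice u D p xo r hr →
    ∫⁻ x in ball xo r, (∫⁻ y in ball xo r, ‖u x - u y‖ₑ) ^ 4 ≤
      oR (C * r ^ 13) * Hn D xo (2 * r) ^ 2 := by
  obtain ⟨C, hC, h⟩ := sob_poinc
  refine ⟨243 * C, by positivity, fun u D p xo r hr hS => ?_⟩
  have muj : ∀ j : Fin 3, Measurable fun x => u x j := fun j =>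
    (PiLp.continuous_apply 2 (fun _ : Fin 3 => ℝ) j).measurable.comp hS.mu
  have hmeas2 : ∀ j : Fin 3, Measurable fun x => ∫⁻ y in ball xo r, ‖u x j - u y j‖ₑ := by
    exact fun j => meas_osc (muj j) _
  have hj : ∀ j : Fin 3, ∫⁻ x in ball xo r, (∫⁻ y in ball xo r, ‖u x j - u y j‖ₑ) ^ 4 ≤
      oR (C * r ^ 13) * Hn D xo (2 * r) ^ 2 := by
    intro j
    have hh := h xo r hr ((ball xo (2 * r)).indicator fun x => u x j)
      (fun w i => (ball xo (2 * r)).indicator (fun w => D w i j) w)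
      ((muj j).indicator measurableSet_ball) ?_ ?_ ?_
    · have hsub : ball xo r ⊆ ball xo (2 * r) := ball_subset_ball (by linarith)
      calc _ = _ := ?_
        _ ≤ _ := hh
        _ ≤ _ := ?_
      · refine setLIntegral_congr_fun measurableSet_ball fun x hx => ?_
        congr 1
        refine setLIntegral_congr_fun measurableSet_ball fun y hy => ?_
        simp only [indicator_of_mem (hsub hx), indicator_of_mem (hsub hy)]
      · refine mul_le_mul' le_rfl (pow_le_pow_left' ?_ 2)
        rw [Hn, ← lintegral_indicator measurableSet_ball]
        refine lintegral_mono fun w => ?_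
        by_cases hw : w ∈ ball xo (2 * r)
        · simp only [indicator_of_mem hw]
          apply ofReal_le_ofReal
          gcongr with i
          exact Finset.single_le_sum (f := fun j => D w i j ^ 2) (fun _ _ => sq_nonneg _) (Finset.mem_univ j)
        · simp [indicator_of_notMem hw]
    · have := hS.mD
      refine measurable_pi_lambda _ fun i => Measurable.indicator (by fun_prop) measurableSet_ball
    · rw [integrable_indicator_iff measurableSet_ball]
      exact Integrable.mono hS.ui (muj j).aestronglyMeasurable (ae_of_all _ fun x => PiLp.norm_apply_le (u x) j)
    · intro n
      filter_upwards [hS.sob n] with x hx i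
      have := hx i j
      rw [← integral_indicator measurableSet_ball, ← integral_indicator measurableSet_ball] at this
      simp only [indicator_mul_left] at this
      exact this
  calc _ ≤ ∫⁻ x in ball xo r, 81 * ∑ j, (∫⁻ y in ball xo r, ‖u x j - u y j‖ₑ) ^ 4 := by
        refine lintegral_mono fun x => ?_
        refine le_trans (pow_le_pow_left' ?_ 4) (sum3_pow4 _)
        rw [← lintegral_finsetSum _ (fun j _ => ((muj j).const_sub (u x j)).enorm)]
        exact lintegral_mono fun y => enorm_le_sum (u x - u y)
    _ = 81 * ∑ j, ∫⁻ x in ball xo r, (∫⁻ y in ball xo r, ‖u x j - u y j‖ₑ) ^ 4 := by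
        rw [lintegral_const_mul' _ _ (by simp), lintegral_finsetSum _ (fun j _ => (hmeas2 j).pow_const 4)]
    _ ≤ 81 * ∑ j : Fin 3, oR (C * r ^ 13) * Hn D xo (2 * r) ^ 2 := by
        gcongr with j; exact hj j
    _ = _ := by
        rw [Finset.sum_const, Finset.card_univ, Fintype.card_fin, nsmul_eq_mul, ← mul_assoc, ← mul_assoc,
          show 243 * C * r ^ 13 = 243 * (C * r ^ 13) by ring, ofReal_mul (p := 243) (by norm_num),
          ofReal_ofNat]
        norm_num

lemma pow4_add (a b : ℝ≥0∞) : (a + b) ^ 4 ≤ 16 * (a ^ 4 + b ^ 4) := by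
  wlog h : a ≤ b generalizing a b
  · rw [add_comm a, add_comm (a ^ 4)]; exact this b a (le_of_not_ge h)
  calc (a + b) ^ 4 ≤ (b + b) ^ 4 := by gcongr
    _ = 16 * b ^ 4 := by ring
    _ ≤ _ := by gcongr; exact le_add_self

lemma int_u_sq (u : E3 → E3) (mu : Measurable u) (xo : E3) (r : ℝ) (hr : 0 < r) :
    (∫⁻ y in ball xo r, ‖u y‖ₑ) ^ 2 ≤ oR (bb * r ^ 3) * Vn u xo r := by
  have := lintegral_cs (volume.restrict (ball xo r)) (f := fun _ => 1) (g := fun y => ‖u y‖ₑ)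
    (by fun_prop) (by fun_prop)
  simpa [vol_ball xo r hr, Vn] using this

lemma Vn_mono (u : E3 → E3) (xo : E3) {r R : ℝ} (h : r ≤ R) : Vn u xo r ≤ Vn u xo R :=
  lintegral_mono_set (ball_subset_ball h)

lemma u_four : ∃ C : ℝ, 0 < C ∧ ∀ u D p xo r (hr : 0 < r), Slice u D p xo r hr →
    ∫⁻ x in ball xo r, ‖u x‖ₑ ^ 4 ≤
      oR (C * r) * Hn D xo (2 * r) ^ 2 + oR (C * r⁻¹ ^ 3) * Vn u xo (2 * r) ^ 2 := by
  obtain ⟨C, hC, h⟩ := sobv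
  have hb := bb_pos
  refine ⟨16 * bb⁻¹ ^ 4 * C + 16 * bb⁻¹, by positivity, fun u D p xo r hr hS => ?_⟩
  have mu := hS.mu
  obtain ⟨J, hJ⟩ : ∃ J : E3 → ℝ≥0∞, J = fun x => ∫⁻ y in ball xo r, ‖u x - u y‖ₑ := ⟨_, rfl⟩
  have hJm : Measurable J := by
    rw [hJ]; exact meas_osc mu _
  obtain ⟨N, hN⟩ : ∃ N : ℝ≥0∞, N = ∫⁻ y in ball xo r, ‖u y‖ₑ := ⟨_, rfl⟩
  have hpt : ∀ x, oR (bb * r ^ 3) * ‖u x‖ₑ ≤ J x + N := by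
    intro x
    calc _ = ∫⁻ y in ball xo r, ‖u x‖ₑ := by simp [vol_ball xo r hr, mul_comm]
      _ ≤ ∫⁻ y in ball xo r, (‖u x - u y‖ₑ + ‖u y‖ₑ) := by
          refine lintegral_mono fun y => ?_
          calc ‖u x‖ₑ = ‖(u x - u y) + u y‖ₑ := by simp
            _ ≤ _ := enorm_add_le _ _
      _ = _ := by rw [lintegral_add_right _ (by fun_prop), hJ, hN]
  have hpt4 : ∀ x, ‖u x‖ₑ ^ 4 ≤ oR (16 * (bb * r ^ 3)⁻¹ ^ 4) * (J x ^ 4 + N ^ 4) := by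
    intro x
    have h0 : ‖u x‖ₑ ≤ oR ((bb * r ^ 3)⁻¹) * (J x + N) := by
      calc ‖u x‖ₑ = oR ((bb * r ^ 3)⁻¹) * (oR (bb * r ^ 3) * ‖u x‖ₑ) := by
            rw [← mul_assoc, ← ofReal_mul pz, inv_mul_cancel₀ pz]; simp
        _ ≤ _ := mul_le_mul' le_rfl (hpt x)
    calc _ ≤ (oR ((bb * r ^ 3)⁻¹) * (J x + N)) ^ 4 := pow_le_pow_left' h0 4
      _ = oR ((bb * r ^ 3)⁻¹ ^ 4) * (J x + N) ^ 4 := by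
          rw [mul_pow, ofReal_pow pz]
      _ ≤ oR ((bb * r ^ 3)⁻¹ ^ 4) * (16 * (J x ^ 4 + N ^ 4)) := mul_le_mul' le_rfl (pow4_add _ _)
      _ = _ := by
          rw [← mul_assoc, mul_comm (oR _), ofReal_mul (by norm_num), ofReal_ofNat]
  have hN4 : N ^ 4 ≤ oR ((bb * r ^ 3) ^ 2) * Vn u xo (2 * r) ^ 2 := by
    calc N ^ 4 = (N ^ 2) ^ 2 := by ring
      _ ≤ (oR (bb * r ^ 3) * Vn u xo (2 * r)) ^ 2 := by
          refine pow_le_pow_left' ((hN ▸ int_u_sq u mu xo r hr).trans (mul_le_mul' le_rfl (Vn_mono u xo (by linarith)))) 2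
      _ = _ := by rw [mul_pow, ofReal_pow pz]
  have hs := h u D p xo r hr hS
  calc _ ≤ ∫⁻ x in ball xo r, oR (16 * (bb * r ^ 3)⁻¹ ^ 4) * (J x ^ 4 + N ^ 4) := lintegral_mono hpt4
    _ = oR (16 * (bb * r ^ 3)⁻¹ ^ 4) * (∫⁻ x in ball xo r, J x ^ 4) +
        oR (16 * (bb * r ^ 3)⁻¹ ^ 4) * (N ^ 4 * oR (bb * r ^ 3)) := by
        rw [lintegral_const_mul' _ _ ofReal_ne_top, lintegral_add_right _ (by fun_prop), mul_add]
        simp [vol_ball xo r hr]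
    _ ≤ oR (16 * (bb * r ^ 3)⁻¹ ^ 4) * (oR (C * r ^ 13) * Hn D xo (2 * r) ^ 2) +
        oR (16 * (bb * r ^ 3)⁻¹ ^ 4) * ((oR ((bb * r ^ 3) ^ 2) * Vn u xo (2 * r) ^ 2)
          * oR (bb * r ^ 3)) := by
        rw [hJ]; gcongr
    _ ≤ _ := by
        rw [← mul_assoc, ← ofReal_mul pz, mul_right_comm (oR ((bb * r ^ 3) ^ 2)),
          ← ofReal_mul pz, ← mul_assoc (oR _) (oR _),
          ← ofReal_mul pz]
        have e1 : 16 * (bb * r ^ 3)⁻¹ ^ 4 * (C * r ^ 13) = (16 * bb⁻¹ ^ 4 * C) * r := by field_simp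
        have e2 : 16 * (bb * r ^ 3)⁻¹ ^ 4 * ((bb * r ^ 3) ^ 2 * (bb * r ^ 3)) = 16 * bb⁻¹ * r⁻¹ ^ 3 := by
          field_simp
        rw [e1, e2]
        refine add_le_add (mul_le_mul' (ofReal_le_ofReal ?_) le_rfl)
          (mul_le_mul' (ofReal_le_ofReal ?_) le_rfl)
        · have : 0 ≤ 16 * bb⁻¹ * r := by positivity
          nlinarith
        · have : 0 ≤ 16 * bb⁻¹ ^ 4 * C * r⁻¹ ^ 3 := by positivity
          nlinarith

lemma lapl_tsupp (f : E3 → ℝ) : tsupport (lapl f) ⊆ tsupport f := by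
  apply closure_minimal _ (isClosed_tsupport f)
  intro y hy
  obtain ⟨i, -, hi⟩ := Finset.exists_ne_zero_of_sum_ne_zero (show lapl f y ≠ 0 from hy)
  have h1 := subset_tsupport _ (show y ∈ Function.support (pd(pd(f,i),i)) from hi)
  exact tsupport_fderiv_apply_subset ℝ _ (tsupport_fderiv_apply_subset ℝ _ h1)

lemma int_partial_zero {f : E3 → ℝ} (hf : CD f) (hc : HasCompactSupport f) (e : E3) :
    ∫ y, fderiv ℝ f y e = 0 := by
  have hs := partial_smooth hf e
  have h := integral_mul_fderiv_eq_neg_fderiv_mul_of_integrable (μ := (volume : Measure E3)) (𝕜 := ℝ)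
    (f := fun _ : E3 => (1:ℝ)) (g := f) (v := e) (by simp)
    (by simpa using hs.continuous.integrable_of_hasCompactSupport (hc.fderiv_apply ℝ e))
    (by simpa using hf.continuous.integrable_of_hasCompactSupport hc)
    (fun x _ => by fun_prop) (fun x _ => (hf.differentiable (by simp)) x)
  simpa using h

lemma int_lapl_zero {f : E3 → ℝ} (hf : CD f) (hc : HasCompactSupport f) :
    ∫ y, lapl f y = 0 := by
  unfold lapl
  rw [integral_finsetSum]
  · exact Finset.sum_eq_zero fun i _ => int_partial_zero (partial_smooth hf (ee i)) (hc.fderiv_apply ℝ (ee i)) (ee i)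
  · intro i _
    exact (partial_smooth (partial_smooth hf (ee i)) (ee i)).continuous.integrable_of_hasCompactSupport
      ((hc.fderiv_apply ℝ (ee i)).fderiv_apply ℝ (ee i))

lemma good_pt (xo : E3) (r : ℝ) (hr : 0 < r) {g : E3 → ℝ≥0∞} (hg : Measurable g) :
    ∃ y, oR (bb * r ^ 3) * g y ≤ ∫⁻ x in ball xo r, g x := by
  have hb := bb_pos
  have h0 : oR (bb * r ^ 3) ≠ 0 := by simp; positivity
  obtain ⟨y, -, hy⟩ := exists_le_setLAverage (μ := volume) (s := ball xo r) (f := g)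
    (by rw [vol_ball xo r hr]; exact h0) measure_ball_lt_top.ne hg.aemeasurable
  refine ⟨y, ?_⟩
  rw [setLAverage_eq, vol_ball xo r hr] at hy
  calc _ ≤ _ := mul_le_mul' le_rfl hy
    _ = _ := ENNReal.mul_div_cancel h0 ofReal_ne_top

lemma fv_meas {u : E3 → E3} {D : E3 → Fin 3 → Fin 3 → ℝ} (hu : Measurable u) (hD : Measurable D) :
    Measurable (fv u D) := by
  apply (PiLp.continuous_toLp 2 (fun _ : Fin 3 => ℝ)).measurable.comp
  refine measurable_pi_lambda _ fun i => Finset.measurable_fun_sum _ fun j _ => ?_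
  have h1 := (PiLp.continuous_apply 2 (fun _ : Fin 3 => ℝ) j).measurable.comp hu
  exact h1.mul ((measurable_pi_apply i).comp ((measurable_pi_apply j).comp hD))

lemma fv_le (u : E3 → E3) (D : E3 → Fin 3 → Fin 3 → ℝ) (w : E3) :
    ‖fv u D w‖ ≤ ‖u w‖ * Real.sqrt (∑ i, ∑ j, (D w i j) ^ 2) := by
  have h0 : 0 ≤ ∑ i, ∑ j, (D w i j) ^ 2 := Finset.sum_nonneg fun i _ => Finset.sum_nonneg fun j _ => sq_nonneg _
  apply le_of_sq_le_sq _ pz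
  rw [mul_pow, Real.sq_sqrt h0, EuclideanSpace.real_norm_sq_eq, EuclideanSpace.real_norm_sq_eq, Finset.sum_comm (f := fun i j => D w i j ^ 2),
    Finset.mul_sum]
  apply Finset.sum_le_sum
  intro i _
  exact Finset.sum_mul_sq_le_sq_mul_sq Finset.univ (fun j => u w j) (fun j => D w j i)

lemma fn_sq {u : E3 → E3} {D : E3 → Fin 3 → Fin 3 → ℝ} (hu : Measurable u) (hD : Measurable D) (xo : E3) (R : ℝ) :
    fn u D xo R ^ 2 ≤ Vn u xo R * Hn D xo R := by
  have hS : Measurable fun w => ∑ i, ∑ j, (D w i j) ^ 2 :=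
    Finset.measurable_fun_sum _ fun i _ => Finset.measurable_fun_sum _ fun j _ =>
      ((measurable_pi_apply j).comp ((measurable_pi_apply i).comp hD)).pow_const 2
  have h := lintegral_cs (volume.restrict (ball xo R)) (f := fun w => ‖u w‖ₑ)
    (g := fun w => oR (Real.sqrt (∑ i, ∑ j, (D w i j) ^ 2))) hu.enorm.aemeasurable
    (hS.sqrt.ennreal_ofReal.aemeasurable)
  have e : ∀ w, oR (Real.sqrt (∑ i, ∑ j, (D w i j) ^ 2)) ^ 2 = oR (∑ i, ∑ j, (D w i j) ^ 2) := by
    intro w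
    rw [← ofReal_pow (Real.sqrt_nonneg _), Real.sq_sqrt
      (Finset.sum_nonneg fun i _ => Finset.sum_nonneg fun j _ => sq_nonneg _)]
  simp only [e] at h
  refine le_trans (pow_le_pow_left' ?_ 2) h
  refine lintegral_mono fun w => ?_
  rw [← ofReal_norm, ← ofReal_norm, ← ofReal_mul (norm_nonneg _)]
  exact ofReal_le_ofReal (fv_le u D w)

def Ik (u : E3 → E3) (D : E3 → Fin 3 → Fin 3 → ℝ) (xo : E3) (R : ℝ) (x : E3) : ℝ≥0∞ :=
  ∫⁻ w in ball xo R, ‖fv u D w‖ₑ * lk (x - w) ^ 3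

lemma press_osc : ∃ C : ℝ, 0 < C ∧ ∀ u D p xo r (hr : 0 < r), Slice u D p xo r hr →
    ∀ᵐ x ∂(volume.restrict (ball xo r)), ∀ᵐ y ∂(volume.restrict (ball xo r)),
      ‖p x - p y‖ₑ ≤ oR C * (Ik u D xo (2 * r) x + Ik u D xo (2 * r) y) +
        oR (C * r⁻¹ ^ 7 * ‖x - y‖) * An p xo (2 * r) := by
  obtain ⟨C, hC, h⟩ := press_rep
  have hb := bb_pos
  refine ⟨C + C * bb⁻¹, by positivity, fun u D p xo r hr hS => ?_⟩
  obtain ⟨y₀, hy₀⟩ := good_pt xo (2 * r) pz (meas_osc hS.mp (volume.restrict (ball xo (2 * r))))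
  obtain ⟨κ, hκ⟩ : ∃ κ, κ = p y₀ := ⟨_, rfl⟩
  rw [← hκ] at hy₀
  have hsub : ball xo r ⊆ ball xo (2 * r) := ball_subset_ball (by linarith)
  have hpk : IntegrableOn (fun w => p w - κ) (ball xo (2 * r)) :=
    Integrable.sub hS.pi (integrableOn_const (by finiteness) (by simp))
  have hkey := h xo r ((ball xo (2 * r)).indicator fun w => p w - κ)
    ((ball xo (2 * r)).indicator (fv u D)) hr ((integrable_indicator_iff measurableSet_ball).2 hpk) ?_
  · obtain ⟨G, hG1, hG2⟩ := hkey
    have hP1 : ∫⁻ w, ‖(ball xo (2 * r)).indicator (fun w => p w - κ) w‖ₑ ≤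
        oR (bb⁻¹ * r⁻¹ ^ 3) * An p xo (2 * r) := by
      calc _ = ∫⁻ w in ball xo (2 * r), ‖κ - p w‖ₑ := by
            rw [← lintegral_indicator measurableSet_ball]
            congr 1; ext w
            by_cases hw : w ∈ ball xo (2 * r)
            · simp only [indicator_of_mem hw]; rw [← enorm_neg, neg_sub]
            · simp only [indicator_of_notMem hw, enorm_zero]
        _ = oR ((bb * (2 * r) ^ 3)⁻¹) * (oR (bb * (2 * r) ^ 3) *
            ∫⁻ w in ball xo (2 * r), ‖κ - p w‖ₑ) := by
            rw [← mul_assoc, ← ofReal_mul pz, inv_mul_cancel₀ pz]; simp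
        _ ≤ _ := by
            refine mul_le_mul' (ofReal_le_ofReal ?_) hy₀
            rw [mul_inv, mul_pow, mul_inv, inv_pow]
            have h1 : 0 ≤ (r ^ 3)⁻¹ := by positivity
            have h2 : (2 ^ 3 : ℝ)⁻¹ * (r ^ 3)⁻¹ ≤ (r ^ 3)⁻¹ := by norm_num; linarith
            gcongr
    filter_upwards [hG2, ae_restrict_mem measurableSet_ball] with x hx hxb
    filter_upwards [hG2, ae_restrict_mem measurableSet_ball] with y hy hyb
    rw [indicator_of_mem (hsub hxb)] at hx
    rw [indicator_of_mem (hsub hyb)] at hy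
    have hI : ∀ z, ∫⁻ w, ‖(ball xo (2 * r)).indicator (fv u D) w‖ₑ * lk (z - w) ^ 3 = Ik u D xo (2 * r) z := by
      intro z
      rw [Ik, ← lintegral_indicator measurableSet_ball]
      congr 1; ext w
      by_cases hw : w ∈ ball xo (2 * r)
      · simp only [indicator_of_mem hw]
      · simp only [indicator_of_notMem hw, enorm_zero, zero_mul]
    rw [hI] at hx hy
    have hCC : oR C ≤ oR (C + C * bb⁻¹) := ofReal_le_ofReal (by
      have : 0 ≤ C * bb⁻¹ := by positivity
      linarith)
    calc ‖p x - p y‖ₑ = ‖(p x - κ - G x) - (p y - κ - G y) + (G x - G y)‖ₑ := by congr 1; ring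
      _ ≤ ‖(p x - κ - G x) - (p y - κ - G y)‖ₑ + ‖G x - G y‖ₑ := enorm_add_le _ _
      _ ≤ (‖p x - κ - G x‖ₑ + ‖p y - κ - G y‖ₑ) + ‖G x - G y‖ₑ := by gcongr; exact enorm_sub_le
      _ ≤ (oR C * Ik u D xo (2 * r) x + oR C * Ik u D xo (2 * r) y) +
          oR (C * r⁻¹ ^ 4 * ‖x - y‖) * (oR (bb⁻¹ * r⁻¹ ^ 3) * An p xo (2 * r)) := by
          refine add_le_add (add_le_add hx hy) ((hG1 x y).trans (mul_le_mul' le_rfl hP1))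
      _ ≤ _ := by
          rw [← mul_add, ← mul_assoc, ← ofReal_mul pz]
          refine add_le_add (mul_le_mul' hCC le_rfl) (mul_le_mul' (ofReal_le_ofReal ?_) le_rfl)
          have : 0 ≤ C * r⁻¹ ^ 7 * ‖x - y‖ := by positivity
          nlinarith
  · intro n
    filter_upwards [hS.prs n, ae_restrict_mem measurableSet_ball] with x hx hxb
    have hcb : closedBall x r ⊆ ball xo (2 * r) := by
      intro w hw
      rw [mem_ball] at hxb ⊢
      rw [mem_closedBall] at hw
      have := dist_triangle w x xo
      linarith
    have hcs : HasCompactSupport (psi r n x) :=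
      (isCompact_closedBall x r).of_isClosed_subset (isClosed_tsupport _) (psi_tsupport r hr n x)
    have hls : HasCompactSupport (lapl (psi r n x)) :=
      hcs.of_isClosed_subset (isClosed_tsupport _) (lapl_tsupp _)
    have hlc := (lapl_smooth (psi_smooth r n x)).continuous
    have h0 : ∫ w in ball xo (2 * r), lapl (psi r n x) w = 0 := by
      rw [setIntegral_eq_integral_of_forall_compl_eq_zero, int_lapl_zero (psi_smooth r n x) hcs]
      intro w hw
      by_contra hne
      exact hw (hcb (psi_tsupport r hr n x (lapl_tsupp _ (subset_tsupport _ hne))))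
    have hli : Integrable (lapl (psi r n x)) := hlc.integrable_of_hasCompactSupport hls
    obtain ⟨B, hB⟩ := hls.exists_bound_of_continuous hlc
    have hpi : IntegrableOn (fun w => p w * lapl (psi r n x) w) (ball xo (2 * r)) :=
      Integrable.mul_bdd (c := B) hS.pi hlc.aestronglyMeasurable (ae_of_all _ hB)
    have hL : ∫ w, (ball xo (2 * r)).indicator (fun w => p w - κ) w * lapl (psi r n x) w =
        ∫ w in ball xo (2 * r), p w * lapl (psi r n x) w := by
      simp only [← indicator_mul_left]
      rw [integral_indicator measurableSet_ball]
      simp only [sub_mul]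
      rw [integral_sub hpi (hli.integrableOn.const_mul κ), integral_const_mul, h0, mul_zero, sub_zero]
    rw [hL, hx, ← integral_indicator measurableSet_ball]
    congr 1; ext w
    by_cases hw : w ∈ ball xo (2 * r)
    · simp only [indicator_of_mem hw]
    · simp only [indicator_of_notMem hw]; simp

lemma lk3_ball : ∃ C : ℝ, 0 < C ∧ ∀ (xo w : E3) (ρ : ℝ), 0 < ρ →
    ∫⁻ x in ball xo ρ, lk (x - w) ^ 3 ≤ oR (C * ρ) := by
  obtain ⟨C, hC, h⟩ := lk_ball
  have hb := bb_pos
  refine ⟨C + bb, by positivity, fun xo w ρ hρ => ?_⟩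
  have hpt : ∀ y : E3, lk y ^ 3 ≤ oR (ρ ^ (2/3 : ℝ)) * lk y ^ 4 + oR (ρ⁻¹ ^ 2) := by
    intro y
    rcases eq_or_ne y 0 with rfl | hy
    · rw [lk3]; simp
    have hy' : 0 < ‖y‖ := norm_pos_iff.2 hy
    rcases le_total ‖y‖ ρ with h1 | h1
    · refine le_trans ?_ le_self_add
      have : 1 ≤ oR (ρ ^ (2/3 : ℝ)) * lk y := by
        rw [lk_def, ← ofReal_mul pz, Real.rpow_neg hy'.le, ← div_eq_mul_inv,
          ← ofReal_one]
        apply ofReal_le_ofReal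
        rw [one_le_div pz]
        gcongr
      calc lk y ^ 3 = 1 * lk y ^ 3 := (one_mul _).symm
        _ ≤ (oR (ρ ^ (2/3 : ℝ)) * lk y) * lk y ^ 3 := mul_le_mul' this le_rfl
        _ = _ := by ring
    · refine le_trans ?_ le_add_self
      rw [lk3]
      apply ofReal_le_ofReal
      gcongr
  calc _ ≤ ∫⁻ x in ball xo ρ, (oR (ρ ^ (2/3 : ℝ)) * lk (x - w) ^ 4 + oR (ρ⁻¹ ^ 2)) :=
        lintegral_mono fun x => hpt (x - w)
    _ = oR (ρ ^ (2/3 : ℝ)) * (∫⁻ x in ball xo ρ, lk (x - w) ^ 4) +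
        oR (ρ⁻¹ ^ 2) * oR (bb * ρ ^ 3) := by
        rw [lintegral_add_right _ (by fun_prop), lintegral_const_mul' _ _ ofReal_ne_top]
        simp [vol_ball xo ρ hρ]
    _ ≤ oR (ρ ^ (2/3 : ℝ)) * oR (C * ρ ^ (1/3 : ℝ)) +
        oR (ρ⁻¹ ^ 2) * oR (bb * ρ ^ 3) := by gcongr; exact h xo w ρ hρ
    _ = _ := by
        rw [← ofReal_mul pz, ← ofReal_mul pz,
          ← ofReal_add pz pz]
        congr 1
        have e1 : ρ ^ (2/3 : ℝ) * (C * ρ ^ (1/3 : ℝ)) = C * ρ := by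
          rw [mul_left_comm, ← Real.rpow_add hρ]; norm_num
        rw [e1]; field_simp

lemma meas_ker : Measurable fun q : E3 × E3 => lk (q.1 - q.2) ^ 3 :=
  (lk_meas.comp (measurable_fst.sub measurable_snd)).pow_const 3

lemma Ik_meas {u : E3 → E3} {D : E3 → Fin 3 → Fin 3 → ℝ} (hu : Measurable u) (hD : Measurable D) (xo : E3) (R : ℝ) :
    Measurable (Ik u D xo R) :=
  Measurable.lintegral_prod_right' (f := fun q : E3 × E3 => ‖fv u D q.2‖ₑ * lk (q.1 - q.2) ^ 3)
    (((fv_meas hu hD).comp measurable_snd).enorm.mul meas_ker)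

lemma gI {u : E3 → E3} {D : E3 → Fin 3 → Fin 3 → ℝ} (hu : Measurable u) (hD : Measurable D) (xo : E3) (R : ℝ)
    (g : E3 → ℝ≥0∞) (hg : Measurable g) (s : Set E3) (S : ℝ≥0∞)
    (hS : ∀ w, ∫⁻ x in s, g x * lk (x - w) ^ 3 ≤ S) :
    ∫⁻ x in s, g x * Ik u D xo R x ≤ S * fn u D xo R := by
  have hf := (fv_meas hu hD).enorm
  have hm : Measurable fun q : E3 × E3 => g q.1 * (‖fv u D q.2‖ₑ * lk (q.1 - q.2) ^ 3) :=
    (hg.comp measurable_fst).mul ((hf.comp measurable_snd).mul meas_ker)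
  calc _ = ∫⁻ x in s, ∫⁻ w in ball xo R, g x * (‖fv u D w‖ₑ * lk (x - w) ^ 3) := by
        congr 1; ext x
        rw [Ik, lintegral_const_mul]
        exact hf.mul ((lk_meas.comp (measurable_const.sub measurable_id)).pow_const 3)
    _ = ∫⁻ w in ball xo R, ∫⁻ x in s, g x * (‖fv u D w‖ₑ * lk (x - w) ^ 3) :=
        lintegral_lintegral_swap hm.aemeasurable
    _ = ∫⁻ w in ball xo R, ‖fv u D w‖ₑ * ∫⁻ x in s, g x * lk (x - w) ^ 3 := by
        congr 1; ext w
        rw [← lintegral_const_mul]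
        · congr 1; ext x; ring
        · exact hg.mul ((lk_meas.comp (measurable_id.sub measurable_const)).pow_const 3)
    _ ≤ ∫⁻ w in ball xo R, ‖fv u D w‖ₑ * S := lintegral_mono fun w => mul_le_mul' le_rfl (hS w)
    _ = _ := by rw [lintegral_mul_const _ hf, mul_comm, fn]

lemma dbl_int (s : Set E3) (I g : E3 → ℝ≥0∞) (hI : Measurable I) (hg : Measurable g) (c K : ℝ≥0∞) :
    ∫⁻ x in s, ∫⁻ y in s, (c * (I x + I y) + K) * g x =
      c * (volume s * ∫⁻ x in s, g x * I x) + c * ((∫⁻ x in s, I x) * ∫⁻ x in s, g x) +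
        K * volume s * ∫⁻ x in s, g x := by
  have h1 : ∀ x, ∫⁻ y in s, (c * (I x + I y) + K) * g x =
      (c * volume s) * (g x * I x) + (c * (∫⁻ y in s, I y)) * g x + (K * volume s) * g x := by
    intro x
    rw [lintegral_mul_const _ (by fun_prop), lintegral_add_left (by fun_prop), lintegral_const_mul _ (by fun_prop),
      lintegral_add_left (by fun_prop)]
    simp only [lintegral_const, Measure.restrict_apply_univ]
    ring
  simp only [h1]
  rw [lintegral_add_left (by fun_prop), lintegral_add_left (by fun_prop), lintegral_const_mul _ (by fun_prop),
    lintegral_const_mul _ (by fun_prop), lintegral_const_mul _ (by fun_prop)]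
  ring

lemma press_decay : ∃ C : ℝ, 0 < C ∧ ∀ u D p xo r (hr : 0 < r), Slice u D p xo r hr → ∀ ρ, 0 < ρ → ρ ≤ r →
    An p xo ρ ≤ oR (C * ρ ^ 4) * fn u D xo (2 * r) + oR (C * (ρ * r⁻¹) ^ 7) * An p xo (2 * r) := by
  obtain ⟨C, hC, h⟩ := press_osc
  obtain ⟨C3, hC3, h3⟩ := lk3_ball
  have hb := bb_pos
  refine ⟨2 * C * bb * C3 + 2 * C * bb ^ 2, by positivity, fun u D p xo r hr hS ρ hρ hρr => ?_⟩
  have hm := Ik_meas hS.mu hS.mD xo (2 * r)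
  have hsub : ball xo ρ ⊆ ball xo r := ball_subset_ball hρr
  have h0 := ae_restrict_of_ae_restrict_of_subset hsub (h u D p xo r hr hS)
  have hI : ∫⁻ x in ball xo ρ, Ik u D xo (2 * r) x ≤ oR (C3 * ρ) * fn u D xo (2 * r) := by
    have := gI hS.mu hS.mD xo (2 * r) (fun _ => 1) measurable_const (ball xo ρ) (oR (C3 * ρ))
      (fun w => by simpa using h3 xo w ρ hρ)
    simpa using this
  calc An p xo ρ ≤ ∫⁻ x in ball xo ρ, ∫⁻ y in ball xo ρ, (oR C * (Ik u D xo (2 * r) x + Ik u D xo (2 * r) y) +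
        oR (C * r⁻¹ ^ 7 * (2 * ρ)) * An p xo (2 * r)) * 1 := by
        apply lintegral_mono_ae
        filter_upwards [h0, ae_restrict_mem measurableSet_ball] with x hx hxb
        apply lintegral_mono_ae
        filter_upwards [ae_restrict_of_ae_restrict_of_subset hsub hx, ae_restrict_mem measurableSet_ball] with y hy hyb
        rw [mul_one]
        refine hy.trans (add_le_add le_rfl (mul_le_mul' (ofReal_le_ofReal ?_) le_rfl))
        gcongr
        rw [← dist_eq_norm]
        have := dist_triangle_right x y xo
        rw [mem_ball] at hxb hyb
        linarith
    _ = _ := dbl_int (ball xo ρ) (Ik u D xo (2 * r)) (fun _ => 1) hm measurable_const _ _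
    _ = oR (2 * C * (bb * ρ ^ 3)) * (∫⁻ x in ball xo ρ, Ik u D xo (2 * r) x) +
        oR (C * r⁻¹ ^ 7 * (2 * ρ) * (bb * ρ ^ 3) * (bb * ρ ^ 3)) * An p xo (2 * r) := by
        simp only [one_mul, lintegral_const, Measure.restrict_apply_univ, vol_ball xo ρ hρ]
        rw [ofReal_mul (p := C * r⁻¹ ^ 7 * (2 * ρ) * (bb * ρ ^ 3)) pz,
          ofReal_mul (p := C * r⁻¹ ^ 7 * (2 * ρ)) pz, ofReal_mul (p := 2 * C) pz,
          ofReal_mul (p := 2) pz, ofReal_ofNat]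
        ring
    _ ≤ oR (2 * C * (bb * ρ ^ 3)) * (oR (C3 * ρ) * fn u D xo (2 * r)) +
        oR (C * r⁻¹ ^ 7 * (2 * ρ) * (bb * ρ ^ 3) * (bb * ρ ^ 3)) * An p xo (2 * r) := by gcongr
    _ ≤ _ := by
        rw [← mul_assoc, ← ofReal_mul pz]
        refine add_le_add (mul_le_mul' (ofReal_le_ofReal ?_) le_rfl)
          (mul_le_mul' (ofReal_le_ofReal ?_) le_rfl)
        · have : 0 ≤ 2 * C * bb ^ 2 * ρ ^ 4 := by positivity
          linarith
        · have : 0 ≤ 2 * C * bb * C3 * (ρ * r⁻¹) ^ 7 := by positivity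
          linarith

lemma le_of_pow4 {a b : ℝ≥0∞} (h : a ^ 4 ≤ b ^ 4) : a ≤ b := by
  by_contra hh
  push Not at hh
  exact absurd h (not_le.2 (ENNReal.pow_lt_pow_left (by norm_num) hh))

def Tn (u : E3 → E3) (p : E3 → ℝ) (xo : E3) (r : ℝ) : ℝ≥0∞ :=
  ∫⁻ x in ball xo r, ∫⁻ y in ball xo r, ‖(‖u x‖ ^ 2 + 2 * p x) - (‖u y‖ ^ 2 + 2 * p y)‖ₑ * ‖u x‖ₑ

lemma four_holder (μ : Measure E3) {J g : E3 → ℝ≥0∞} (hJ : Measurable J) (hg : Measurable g) :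
    (∫⁻ x, J x * g x ^ 2 ∂μ) ^ 4 ≤ (∫⁻ x, J x ^ 4 ∂μ) * (∫⁻ x, g x ^ 4 ∂μ) * (∫⁻ x, g x ^ 2 ∂μ) ^ 2 := by
  have h1 := lintegral_cs μ (hJ.mul hg).aemeasurable hg.aemeasurable
  have h2 := lintegral_cs μ (hJ.pow_const 2).aemeasurable (hg.pow_const 2).aemeasurable
  calc _ = ((∫⁻ x, (J * g) x * g x ∂μ) ^ 2) ^ 2 := by
        rw [← pow_mul]; congr 2; ext x; simp only [Pi.mul_apply]; ring
    _ ≤ ((∫⁻ x, (J * g) x ^ 2 ∂μ) * ∫⁻ x, g x ^ 2 ∂μ) ^ 2 := pow_le_pow_left' h1 2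
    _ = (∫⁻ x, J x ^ 2 * g x ^ 2 ∂μ) ^ 2 * (∫⁻ x, g x ^ 2 ∂μ) ^ 2 := by
        rw [mul_pow]; simp only [Pi.mul_apply, mul_pow]
    _ ≤ _ := by
        refine mul_le_mul' (h2.trans (le_of_eq ?_)) le_rfl
        simp only [← pow_mul]

lemma three_holder (μ : Measure E3) {l g : E3 → ℝ≥0∞} (hl : Measurable l) (hg : Measurable g) :
    (∫⁻ x, g x * l x ^ 3 ∂μ) ^ 4 ≤ (∫⁻ x, g x ^ 4 ∂μ) * (∫⁻ x, l x ^ 4 ∂μ) ^ 3 := by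
  have h1 := lintegral_cs μ (hg.mul hl).aemeasurable (hl.pow_const 2).aemeasurable
  have h2 := lintegral_cs μ (hg.pow_const 2).aemeasurable (hl.pow_const 2).aemeasurable
  calc _ = ((∫⁻ x, (g * l) x * l x ^ 2 ∂μ) ^ 2) ^ 2 := by
        rw [← pow_mul]; congr 2; ext x; simp only [Pi.mul_apply]; ring
    _ ≤ ((∫⁻ x, (g * l) x ^ 2 ∂μ) * ∫⁻ x, (l x ^ 2) ^ 2 ∂μ) ^ 2 := pow_le_pow_left' h1 2
    _ = (∫⁻ x, g x ^ 2 * l x ^ 2 ∂μ) ^ 2 * (∫⁻ x, l x ^ 4 ∂μ) ^ 2 := by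
        rw [mul_pow]; simp only [Pi.mul_apply, mul_pow, ← pow_mul]
    _ ≤ ((∫⁻ x, (g x ^ 2) ^ 2 ∂μ) * ∫⁻ x, (l x ^ 2) ^ 2 ∂μ) * (∫⁻ x, l x ^ 4 ∂μ) ^ 2 := mul_le_mul' h2 le_rfl
    _ = _ := by simp only [← pow_mul]; norm_num; ring

lemma T1_sym (u : E3 → E3) (hu : Measurable u) (s : Set E3) :
    ∫⁻ x in s, ∫⁻ y in s, ‖u x - u y‖ₑ * (2 * ‖u x‖ₑ ^ 2 + ‖u y‖ₑ ^ 2) =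
      3 * ∫⁻ x in s, (∫⁻ y in s, ‖u x - u y‖ₑ) * ‖u x‖ₑ ^ 2 := by
  have hJ := meas_osc hu (volume.restrict s)
  have e1 : ∀ x, ∫⁻ y in s, ‖u x - u y‖ₑ * (2 * ‖u x‖ₑ ^ 2 + ‖u y‖ₑ ^ 2) =
      2 * ((∫⁻ y in s, ‖u x - u y‖ₑ) * ‖u x‖ₑ ^ 2) + ∫⁻ y in s, ‖u x - u y‖ₑ * ‖u y‖ₑ ^ 2 := by
    intro x
    simp only [mul_add]
    rw [lintegral_add_left (by fun_prop), lintegral_mul_const _ (by fun_prop)]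
    ring
  simp only [e1]
  rw [lintegral_add_left (by fun_prop), lintegral_const_mul _ (by fun_prop)]
  have e2 : ∫⁻ x in s, ∫⁻ y in s, ‖u x - u y‖ₑ * ‖u y‖ₑ ^ 2 =
      ∫⁻ x in s, (∫⁻ y in s, ‖u x - u y‖ₑ) * ‖u x‖ₑ ^ 2 := by
    rw [lintegral_lintegral_swap (by fun_prop)]
    congr 1; ext x
    rw [← lintegral_mul_const _ (by fun_prop)]
    congr 1; ext y
    rw [enorm_sub_rev]
  rw [e2]; ring

lemma obm {a b X : ℝ≥0∞} {α β : ℝ} {i j : ℕ} (hα : 0 ≤ α) (ha : a ≤ oR α * X ^ i)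
    (hb : b ≤ oR β * X ^ j) : a * b ≤ oR (α * β) * X ^ (i + j) :=
  (mul_le_mul' ha hb).trans (le_of_eq (by rw [ofReal_mul hα, pow_add]; ring))

lemma obp {a X : ℝ≥0∞} {α : ℝ} {i : ℕ} (n : ℕ) (hα : 0 ≤ α) (ha : a ≤ oR α * X ^ i) :
    a ^ n ≤ oR (α ^ n) * X ^ (i * n) :=
  (pow_le_pow_left' ha n).trans (le_of_eq (by rw [ofReal_pow hα, pow_mul]; ring))

lemma oba {a b X : ℝ≥0∞} {α β : ℝ} {i : ℕ} (hα : 0 ≤ α) (hβ : 0 ≤ β) (ha : a ≤ oR α * X ^ i)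
    (hb : b ≤ oR β * X ^ i) : a + b ≤ oR (α + β) * X ^ i :=
  (add_le_add ha hb).trans (le_of_eq (by rw [ofReal_add hα hβ]; ring))

lemma obx {a X : ℝ≥0∞} {α β : ℝ} {i j : ℕ} (hX : 1 ≤ X) (hij : i ≤ j) (hαβ : α ≤ β)
    (ha : a ≤ oR α * X ^ i) : a ≤ oR β * X ^ j :=
  ha.trans (mul_le_mul' (ofReal_le_ofReal hαβ) (pow_le_pow_right₀ hX hij))

lemma ob4 {a X : ℝ≥0∞} {k s : ℝ} (hk : 0 ≤ k) (hs : 0 ≤ s) (h : a ^ 4 ≤ oR (k * s ^ 4) * X ^ 4) :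
    a ≤ oR ((1 + k) * s) * X ^ 1 := by
  apply le_of_pow4
  rw [pow_one, mul_pow, ← ofReal_pow pz]
  refine h.trans (mul_le_mul' (ofReal_le_ofReal ?_) le_rfl)
  rw [mul_pow]
  refine mul_le_mul_of_nonneg_right ?_ pz
  nlinarith [sq_nonneg k, pow_nonneg hk 3, pow_nonneg hk 4]

set_option maxHeartbeats 1000000 in
lemma Tn_bound : ∃ C : ℝ, 0 < C ∧ ∀ u D p xo r (hr : 0 < r), Slice u D p xo r hr →
    ∀ (μ ε δ : ℝ) (X : ℝ≥0∞), 0 ≤ μ → 0 ≤ ε → 0 ≤ δ → 1 ≤ X → Vn u xo (2 * r) ≤ oR (μ ^ 2 * r) →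
    Hn D xo (2 * r) ≤ oR (ε ^ 2 * r⁻¹) * X → An p xo (2 * r) ≤ oR (δ ^ 2 * r ^ 4) * X →
    Tn u p xo r ≤ oR (C * (r ^ 3 * (ε * μ * (ε + μ) + μ * δ ^ 2))) * X := by
  obtain ⟨Cs, hCs, hsob⟩ := sobv
  obtain ⟨Cu, hCu, hu4⟩ := u_four
  obtain ⟨Cp, hCp, hpo⟩ := press_osc
  obtain ⟨Cl, hCl, hl4⟩ := lk_ball
  obtain ⟨C3, hC3, hl3⟩ := lk3_ball
  have hb := bb_pos
  obtain ⟨K1, hK1⟩ : ∃ K, K = Cs * Cu := ⟨_, rfl⟩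
  obtain ⟨K2, hK2⟩ : ∃ K, K = Cl ^ 3 * Cu := ⟨_, rfl⟩
  obtain ⟨K3, hK3⟩ : ∃ K, K = Cp * bb + Cp * C3 * (1 + bb ^ 3 * (Cl ^ 3)⁻¹) := ⟨_, rfl⟩
  obtain ⟨K4, hK4⟩ : ∃ K, K = 2 * Cp * bb * (1 + bb) := ⟨_, rfl⟩
  have p1 : 0 < K1 := by rw [hK1]; positivity
  have p2 : 0 < K2 := by rw [hK2]; positivity
  have p3 : 0 < K3 := by rw [hK3]; positivity
  have p4 : 0 < K4 := by rw [hK4]; positivity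
  refine ⟨3 * (1 + K1) + 2 * (K3 * (1 + K2)) + 2 * K4, by positivity,
    fun u D p xo r hr hS μ ε δ X hμ hε hδ hX hV hH hA => ?_⟩
  have mu := hS.mu
  have hrr : r * r⁻¹ = 1 := mul_inv_cancel₀ hr.ne'
  have hV' : Vn u xo (2 * r) ≤ oR (μ ^ 2 * r) * X ^ 0 := by simpa using hV
  have hH' : Hn D xo (2 * r) ≤ oR (ε ^ 2 * r⁻¹) * X ^ 1 := by simpa using hH
  have hA' : An p xo (2 * r) ≤ oR (δ ^ 2 * r ^ 4) * X ^ 1 := by simpa using hA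
  have c0 : ∀ c : ℝ, oR c ≤ oR c * X ^ 0 := fun c => by simp
  obtain ⟨U4, hU4⟩ : ∃ U, U = ∫⁻ x in ball xo r, ‖u x‖ₑ ^ 4 := ⟨_, rfl⟩
  obtain ⟨G, hG⟩ : ∃ G, G = ∫⁻ x in ball xo r, ‖u x‖ₑ := ⟨_, rfl⟩
  have bU4 : U4 ≤ oR (Cu * r⁻¹ * (ε + μ) ^ 4) * X ^ 2 := by
    rw [hU4]
    refine (hu4 u D p xo r hr hS).trans ?_
    have h1 := obm pz (c0 (Cu * r)) (obp 2 pz hH')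
    have h2 := obm pz (c0 (Cu * r⁻¹ ^ 3)) (obp 2 pz hV')
    have h2' := obx hX (show 0 + 0 * 2 ≤ 0 + 1 * 2 by norm_num) le_rfl h2
    refine obx hX (by norm_num) ?_ (oba pz pz h1 h2')
    have e1 : Cu * r * (ε ^ 2 * r⁻¹) ^ 2 = Cu * r⁻¹ * ε ^ 4 := by
      linear_combination (Cu * ε ^ 4 * r⁻¹) * hrr
    have e2 : Cu * r⁻¹ ^ 3 * (μ ^ 2 * r) ^ 2 = Cu * r⁻¹ * μ ^ 4 := by
      linear_combination (Cu * μ ^ 4 * r⁻¹ * (r * r⁻¹ + 1)) * hrr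
    rw [e1, e2, ← mul_add]
    refine mul_le_mul_of_nonneg_left ?_ pz
    have : 0 ≤ ε * μ := by positivity
    nlinarith [mul_nonneg this (sq_nonneg ε), mul_nonneg this (sq_nonneg μ), sq_nonneg (ε * μ)]
  have bT1 : ∫⁻ x in ball xo r, (∫⁻ y in ball xo r, ‖u x - u y‖ₑ) * ‖u x‖ₑ ^ 2 ≤
      oR ((1 + K1) * (r ^ 3 * (ε * μ * (ε + μ)))) * X ^ 1 := by
    apply ob4 p1.le pz
    refine (four_holder (volume.restrict (ball xo r)) (meas_osc mu _) mu.enorm).trans ?_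
    have hVr : ∫⁻ x in ball xo r, ‖u x‖ₑ ^ 2 ≤ oR (μ ^ 2 * r) * X ^ 0 :=
      (Vn_mono u xo (show r ≤ 2 * r by linarith)).trans hV'
    have hj := (hsob u D p xo r hr hS).trans (obm pz (c0 (Cs * r ^ 13)) (obp 2 pz hH'))
    rw [hU4] at bU4
    have := obm pz (obm pz hj bU4) (obp 2 pz hVr)
    refine obx hX (by norm_num) (le_of_eq ?_) this
    rw [hK1]
    field_simp
  obtain ⟨S, hSS⟩ : ∃ S : ℝ≥0∞, S ^ 4 = oR (Cl ^ 3 * r) * U4 := by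
    refine ⟨(oR (Cl ^ 3 * r) * U4) ^ (1/4 : ℝ), ?_⟩
    rw [← rpow_natCast, ← rpow_mul]; norm_num
  have hgl : ∀ w, ∫⁻ x in ball xo r, ‖u x‖ₑ * lk (x - w) ^ 3 ≤ S := by
    intro w
    apply le_of_pow4
    refine (three_holder (volume.restrict (ball xo r)) (lk_meas.comp (measurable_id.sub measurable_const)) mu.enorm).trans ?_
    rw [hSS, ← hU4, mul_comm]
    refine mul_le_mul' ((pow_le_pow_left' (hl4 xo w r hr) 3).trans ?_) le_rfl
    rw [← ofReal_pow pz, mul_pow, ← Real.rpow_natCast (r ^ (1/3 : ℝ)), ← Real.rpow_mul hr.le]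
    norm_num
  have hGS : G ≤ oR ((1 + bb ^ 3 * (Cl ^ 3)⁻¹) * r ^ 2) * S := by
    have h := three_holder (volume.restrict (ball xo r)) (l := fun _ => 1) measurable_const mu.enorm
    simp only [one_pow, mul_one, lintegral_const, Measure.restrict_apply_univ, one_mul, vol_ball xo r hr] at h
    rw [← hG, ← hU4] at h
    have := ob4 (a := G) (X := S) (k := bb ^ 3 * (Cl ^ 3)⁻¹) (s := r ^ 2) pz pz ?_
    · simpa using this
    · rw [hSS, ← mul_assoc, ← ofReal_mul pz]
      refine h.trans ?_
      rw [mul_comm, ← ofReal_pow pz]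
      refine mul_le_mul' (ofReal_le_ofReal (le_of_eq ?_)) le_rfl
      field_simp
  have hGm : G ≤ oR ((1 + bb) * (r ^ 2 * μ)) * X ^ 0 := by
    have h := int_u_sq u mu xo r hr
    rw [← hG] at h
    have h2 := obm pz (c0 (bb * r ^ 3)) ((Vn_mono u xo (show r ≤ 2 * r by linarith)).trans hV')
    have : G ≤ oR ((1 + bb) * (r ^ 2 * μ)) := by
      rw [← ENNReal.pow_le_pow_left_iff (n := 2) (by norm_num), ← ofReal_pow pz]
      refine (h.trans h2).trans ?_
      simp only [pow_zero, mul_one, add_zero]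
      refine ofReal_le_ofReal ?_
      have : 0 ≤ r ^ 4 * μ ^ 2 := by positivity
      nlinarith [mul_nonneg this hb.le, mul_nonneg this (sq_nonneg bb)]
    simpa using this
  have hSf : S * fn u D xo (2 * r) ≤ oR ((1 + K2) * (ε * μ * (ε + μ))) * X ^ 1 := by
    apply ob4 p2.le pz
    have hf := obp 2 pz ((fn_sq mu hS.mD xo (2 * r)).trans (obm pz hV' hH'))
    rw [mul_pow, hSS, show fn u D xo (2 * r) ^ 4 = (fn u D xo (2 * r) ^ 2) ^ 2 by rw [← pow_mul]]
    refine obx hX (by norm_num) (le_of_eq ?_) (obm pz (obm pz (c0 (Cl ^ 3 * r)) bU4) hf)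
    rw [hK2]
    field_simp
  have bP : ∫⁻ x in ball xo r, ∫⁻ y in ball xo r, ‖p x - p y‖ₑ * ‖u x‖ₑ ≤
      oR (r ^ 3 * (K3 * (1 + K2) * (ε * μ * (ε + μ)) + K4 * (μ * δ ^ 2))) * X ^ 1 := by
    have hI : ∫⁻ x in ball xo r, Ik u D xo (2 * r) x ≤ oR (C3 * r) * fn u D xo (2 * r) := by
      have := gI mu hS.mD xo (2 * r) (fun _ => 1) measurable_const (ball xo r) (oR (C3 * r))
        (fun w => by simpa using hl3 xo w r hr)
      simpa using this
    have hgI := gI mu hS.mD xo (2 * r) (fun x => ‖u x‖ₑ) mu.enorm (ball xo r) S hgl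
    calc _ ≤ ∫⁻ x in ball xo r, ∫⁻ y in ball xo r, (oR Cp * (Ik u D xo (2 * r) x + Ik u D xo (2 * r) y) +
          oR (Cp * r⁻¹ ^ 7 * (2 * r)) * An p xo (2 * r)) * ‖u x‖ₑ := by
          apply lintegral_mono_ae
          filter_upwards [hpo u D p xo r hr hS, ae_restrict_mem measurableSet_ball] with x hx hxb
          apply lintegral_mono_ae
          filter_upwards [hx, ae_restrict_mem measurableSet_ball] with y hy hyb
          refine mul_le_mul' (hy.trans (add_le_add le_rfl (mul_le_mul' (ofReal_le_ofReal ?_) le_rfl))) le_rfl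
          gcongr
          rw [← dist_eq_norm]
          have := dist_triangle_right x y xo
          rw [mem_ball] at hxb hyb
          linarith
      _ = _ := dbl_int (ball xo r) (Ik u D xo (2 * r)) (fun x => ‖u x‖ₑ) (Ik_meas mu hS.mD xo (2 * r)) mu.enorm _ _
      _ ≤ oR Cp * (oR (bb * r ^ 3) * (S * fn u D xo (2 * r))) +
          oR Cp * (oR (C3 * r) * fn u D xo (2 * r) *
            (oR ((1 + bb ^ 3 * (Cl ^ 3)⁻¹) * r ^ 2) * S)) +
          oR (Cp * r⁻¹ ^ 7 * (2 * r)) * An p xo (2 * r) * oR (bb * r ^ 3) * G := by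
          rw [← hG, vol_ball xo r hr]
          exact add_le_add (add_le_add (mul_le_mul' le_rfl (mul_le_mul' le_rfl hgI))
            (mul_le_mul' le_rfl (mul_le_mul' hI hGS))) le_rfl
      _ = oR (K3 * r ^ 3) * (S * fn u D xo (2 * r)) +
          oR (Cp * r⁻¹ ^ 7 * (2 * r)) * An p xo (2 * r) * oR (bb * r ^ 3) * G := by
          congr 1
          rw [show K3 * r ^ 3 = Cp * (bb * r ^ 3) + Cp * (C3 * r) * ((1 + bb ^ 3 * (Cl ^ 3)⁻¹) * r ^ 2) by rw [hK3]; ring,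
            ofReal_add pz pz, ofReal_mul (p := Cp * (C3 * r)) pz,
            ofReal_mul hCp.le, ofReal_mul hCp.le]
          ring
      _ ≤ _ := by
          have h1 := obm pz (c0 (K3 * r ^ 3)) hSf
          have h2 := obm pz (obm pz (obm pz (c0 (Cp * r⁻¹ ^ 7 * (2 * r))) hA')
            (c0 (bb * r ^ 3))) hGm
          refine obx hX (by norm_num) (le_of_eq ?_) (oba pz pz h1 h2)
          rw [hK4]
          field_simp
  have hpt : ∀ x y, ‖(‖u x‖ ^ 2 + 2 * p x) - (‖u y‖ ^ 2 + 2 * p y)‖ₑ * ‖u x‖ₑ ≤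
      ‖u x - u y‖ₑ * (2 * ‖u x‖ₑ ^ 2 + ‖u y‖ₑ ^ 2) + 2 * (‖p x - p y‖ₑ * ‖u x‖ₑ) := by
    intro x y
    have key : |(‖u x‖ ^ 2 + 2 * p x) - (‖u y‖ ^ 2 + 2 * p y)| * ‖u x‖ ≤
        ‖u x - u y‖ * (2 * ‖u x‖ ^ 2 + ‖u y‖ ^ 2) + 2 * (|p x - p y| * ‖u x‖) := by
      have h1 : |‖u x‖ - ‖u y‖| ≤ ‖u x - u y‖ := abs_norm_sub_norm_le _ _
      have h2 : |(‖u x‖ ^ 2 + 2 * p x) - (‖u y‖ ^ 2 + 2 * p y)| ≤ ‖u x - u y‖ * (‖u x‖ + ‖u y‖) + 2 * |p x - p y| := by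
        rw [show (‖u x‖ ^ 2 + 2 * p x) - (‖u y‖ ^ 2 + 2 * p y) = (‖u x‖ - ‖u y‖) * (‖u x‖ + ‖u y‖) + 2 * (p x - p y) by ring]
        refine (abs_add_le _ _).trans ?_
        rw [abs_mul, abs_mul, abs_of_nonneg (show 0 ≤ ‖u x‖ + ‖u y‖ by positivity), abs_two]
        gcongr
      have h3 := mul_le_mul_of_nonneg_right h2 (norm_nonneg (u x))
      have h4 : (‖u x‖ + ‖u y‖) * ‖u x‖ ≤ 2 * ‖u x‖ ^ 2 + ‖u y‖ ^ 2 := by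
        nlinarith [sq_nonneg (‖u x‖ - ‖u y‖)]
      have h5 := mul_le_mul_of_nonneg_left h4 (norm_nonneg (u x - u y))
      nlinarith
    rw [← Real.norm_eq_abs, ← Real.norm_eq_abs] at key
    have := ofReal_le_ofReal key
    rw [ofReal_add pz pz, ofReal_mul pz,
      ofReal_mul pz, ofReal_mul pz, ofReal_mul pz,
      ofReal_add pz pz, ofReal_mul pz,
      ofReal_pow pz, ofReal_pow pz] at this
    simpa only [ofReal_norm, ofReal_ofNat] using this
  have hmp := hS.mp
  calc Tn u p xo r ≤ ∫⁻ x in ball xo r, ∫⁻ y in ball xo r, (‖u x - u y‖ₑ * (2 * ‖u x‖ₑ ^ 2 + ‖u y‖ₑ ^ 2) +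
        2 * (‖p x - p y‖ₑ * ‖u x‖ₑ)) := lintegral_mono fun x => lintegral_mono fun y => hpt x y
    _ = (∫⁻ x in ball xo r, ∫⁻ y in ball xo r, ‖u x - u y‖ₑ * (2 * ‖u x‖ₑ ^ 2 + ‖u y‖ₑ ^ 2)) +
        2 * ∫⁻ x in ball xo r, ∫⁻ y in ball xo r, ‖p x - p y‖ₑ * ‖u x‖ₑ := by
        rw [← lintegral_const_mul, ← lintegral_add_left]
        · congr 1; ext x
          rw [lintegral_add_left (by fun_prop), lintegral_const_mul _ (by fun_prop)]
        · exact Measurable.lintegral_prod_right' (f := fun q : E3 × E3 => ‖u q.1 - u q.2‖ₑ * (2 * ‖u q.1‖ₑ ^ 2 + ‖u q.2‖ₑ ^ 2))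
            (by fun_prop)
        · exact Measurable.lintegral_prod_right' (f := fun q : E3 × E3 => ‖p q.1 - p q.2‖ₑ * ‖u q.1‖ₑ) (by fun_prop)
    _ ≤ _ := by
        rw [T1_sym u mu]
        have h3 : (3 : ℝ≥0∞) ≤ oR 3 * X ^ 0 := by simp
        have h2 : (2 : ℝ≥0∞) ≤ oR 2 * X ^ 0 := by simp
        have := oba pz pz (obm (by norm_num) h3 bT1) (obm (by norm_num) h2 bP)
        rw [show X = X ^ (0 + 1) by simp]
        refine obx (by simpa using hX) (by norm_num) ?_ this
        have q1 : 0 ≤ r ^ 3 * (ε * μ * (ε + μ)) := by positivity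
        have q2 : 0 ≤ r ^ 3 * (μ * δ ^ 2) := by positivity
        nlinarith [mul_nonneg p1.le q2, mul_nonneg p4.le q1, mul_nonneg (mul_pos p3 (add_pos one_pos p2)).le q2]

lemma dom_int {X : Type*} [TopologicalSpace X] [MeasurableSpace X] {μ : Measure X} {f F g : X → ℝ} (mf : Measurable f)
    (hF : Integrable F μ) (h : ∀ z, |f z| ≤ 1 + F z) (gc : Continuous g) (gs : HasCompactSupport g)
    (gi : Integrable g μ) : Integrable (fun z => f z * g z) μ := by
  obtain ⟨C, hC⟩ := gc.bounded_above_of_compact_support gs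
  refine ((hF.norm.mul_const C).add gi.norm).mono (mf.aestronglyMeasurable.mul gi.aestronglyMeasurable) (ae_of_all _ fun z => ?_)
  have h1 := h z
  have h2 := hC z
  have h3 : 0 ≤ |g z| := abs_nonneg _
  have h5 := le_abs_self (F z)
  simp only [Pi.add_apply, Real.norm_eq_abs] at *
  rw [abs_mul, abs_of_nonneg (a := |F z| * C + |g z|) (by have := h3.trans h2; positivity)]
  nlinarith [mul_le_mul_of_nonneg_right h1 h3, mul_le_mul_of_nonneg_left h2 (abs_nonneg (F z)), mul_le_mul_of_nonneg_right h5 h3]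

lemma comp_sq_le (a : E3) (i : Fin 3) : a i ^ 2 ≤ ‖a‖ ^ 2 := by
  rw [EuclideanSpace.norm_sq_eq]
  have := Finset.single_le_sum (f := fun j => ‖a j‖ ^ 2) (fun _ _ => by positivity) (Finset.mem_univ i)
  simpa only [Real.norm_eq_abs, sq_abs] using this

lemma D_sq_le (d : Fin 3 → Fin 3 → ℝ) (i j : Fin 3) : d i j ^ 2 ≤ ∑ i, ∑ j, d i j ^ 2 :=
  (Finset.single_le_sum (f := fun j => d i j ^ 2) (fun _ _ => by positivity) (Finset.mem_univ j)).trans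
    (Finset.single_le_sum (f := fun i => ∑ j, d i j ^ 2) (fun _ _ => by positivity) (Finset.mem_univ i))

lemma mcomp {X : Type*} [MeasurableSpace X] {v : X → E3} (mv : Measurable v) (i : Fin 3) : Measurable fun z => v z i :=
  (PiLp.continuous_apply 2 (fun _ : Fin 3 => ℝ) i).measurable.comp mv

lemma mDcomp {X : Type*} [MeasurableSpace X] {D : X → Fin 3 → Fin 3 → ℝ} (mD : Measurable D) (i j : Fin 3) :
    Measurable fun z => D z i j := (measurable_pi_apply j).comp ((measurable_pi_apply i).comp mD)

lemma int_fam {X : Type*} [TopologicalSpace X] [MeasurableSpace X] {μ : Measure X} {v : X → E3}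
    {D : X → Fin 3 → Fin 3 → ℝ} (mv : Measurable v) (mD : Measurable D)
    (hF : Integrable (fun z => ‖v z‖ ^ 2 + ∑ i, ∑ j, (D z i j) ^ 2) μ) {g : X → ℝ} (gc : Continuous g)
    (gs : HasCompactSupport g) (gi : Integrable g μ) :
    (∀ i, Integrable (fun z => v z i * g z) μ) ∧ (∀ i j, Integrable (fun z => D z i j * g z) μ) ∧
    (∀ i j, Integrable (fun z => v z j * D z j i * g z) μ) := by
  have hn : ∀ z, 0 ≤ ∑ i, ∑ j, (D z i j) ^ 2 := fun z => by positivity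
  refine ⟨fun i => dom_int (mcomp mv i) hF (fun z => ?_) gc gs gi, fun i j => dom_int (mDcomp mD i j) hF (fun z => ?_) gc gs gi,
    fun i j => dom_int ((mcomp mv j).mul (mDcomp mD j i)) hF (fun z => ?_) gc gs gi⟩
  · have := comp_sq_le (v z) i
    have := hn z
    rw [abs_le]; constructor <;> nlinarith [sq_nonneg (v z i - 1), sq_nonneg (v z i + 1)]
  · have := D_sq_le (D z) i j
    rw [abs_le]; constructor <;> nlinarith [sq_nonneg (D z i j - 1), sq_nonneg (D z i j + 1), sq_nonneg ‖v z‖]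
  · have h1 := D_sq_le (D z) j i
    have h2 := comp_sq_le (v z) j
    rw [abs_le]; constructor <;> nlinarith [sq_nonneg (D z j i - v z j), sq_nonneg (D z j i + v z j)]

lemma int_p {X : Type*} [TopologicalSpace X] [MeasurableSpace X] {μ : Measure X} {p : X → ℝ} (mp : Measurable p)
    (hF : Integrable (fun z => |p z| ^ (3 / 2 : ℝ)) μ) {g : X → ℝ} (gc : Continuous g)
    (gs : HasCompactSupport g) (gi : Integrable g μ) : Integrable (fun z => p z * g z) μ := by
  refine dom_int mp hF (fun z => ?_) gc gs gi
  rcases le_total (|p z|) 1 with h | h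
  · have : 0 ≤ |p z| ^ (3/2 : ℝ) := by positivity
    linarith
  · have := Real.rpow_le_rpow_of_exponent_le h (show (1:ℝ) ≤ 3/2 by norm_num)
    rw [Real.rpow_one] at this
    linarith

lemma prodm (Ω : Set E3) (T : ℝ) : (volume : Measure (ET)).restrict (Ω ×ˢ Ioo 0 T) =
    (volume.restrict Ω).prod (volume.restrict (Ioo 0 T)) := by
  rw [Measure.volume_eq_prod, Measure.prod_restrict]

lemma loc_zero {Ω : Set E3} {T : ℝ} {G : ET → ℝ} (hG : IntegrableOn G (Ω ×ˢ Ioo 0 T))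
    (h : ∀ η : ℝ → ℝ, CD η → HasCompactSupport η → tsupport η ⊆ Ioo 0 T →
      ∫ z in Ω ×ˢ Ioo 0 T, η z.2 * G z = 0) :
    ∀ᵐ t ∂(volume.restrict (Ioo 0 T)), ∫ x in Ω, G (x, t) = 0 := by
  rw [ae_restrict_iff' measurableSet_Ioo]
  have hG' := hG
  rw [IntegrableOn, prodm] at hG'
  apply isOpen_Ioo.ae_eq_zero_of_integral_contDiff_smul_eq_zero
  · exact IntegrableOn.locallyIntegrableOn hG'.integral_prod_right
  · intro η hη hc hs
    have h1 := h η hη hc hs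
    obtain ⟨C, hC⟩ := hη.continuous.bounded_above_of_compact_support hc
    have hint : Integrable (fun z : ET => η z.2 * G z) ((volume.restrict Ω).prod (volume.restrict (Ioo 0 T))) :=
      hG'.bdd_mul (c := C) ((hη.continuous.comp continuous_snd).aestronglyMeasurable) (ae_of_all _ fun z => hC z.2)
    rw [prodm, integral_prod_symm _ hint] at h1
    rw [← h1, ← setIntegral_eq_integral_of_forall_compl_eq_zero (s := Ioo 0 T)]
    · simp only [integral_const_mul, smul_eq_mul]
    · intro t ht
      rw [image_eq_zero_of_notMem_tsupport (fun hh => ht (hs hh)), zero_smul]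

lemma tens_der {η : ℝ → ℝ} {h : ET → ℝ} (hη : CD η)
    (hh : CD h) (i : Fin 3) (z : ET) :
    sdz (fun z => η z.2 * h z) i z = η z.2 * sdz h i z := by
  have h1 : HasFDerivAt (fun z : ET => η z.2) ((fderiv ℝ η z.2).comp (ContinuousLinearMap.snd ℝ E3 ℝ)) z :=
    ((hη.differentiable (by simp)) z.2).hasFDerivAt.comp z hasFDerivAt_snd
  have h2 := h1.fun_mul ((hh.differentiable (by simp)) z).hasFDerivAt
  rw [sdz, h2.fderiv]
  simp [sdz]

lemma sdz_fst {h : E3 → ℝ} (hh : CD h) (i : Fin 3) (z : ET) :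
    sdz (fun z : ET => h z.1) i z = fderiv ℝ h z.1 (ee i) := by
  have h1 : HasFDerivAt (fun z : ET => h z.1) ((fderiv ℝ h z.1).comp (ContinuousLinearMap.fst ℝ E3 ℝ)) z :=
    ((hh.differentiable (by simp)) z.1).hasFDerivAt.comp z hasFDerivAt_fst
  rw [sdz, h1.fderiv]
  simp

lemma tens_tdz {η : ℝ → ℝ} {h : E3 → ℝ} (hη : CD η)
    (hh : CD h) (z : ET) :
    tdz (fun z => η z.2 * h z.1) z = deriv η z.2 * h z.1 := by
  have h1 : HasFDerivAt (fun z : ET => η z.2) ((fderiv ℝ η z.2).comp (ContinuousLinearMap.snd ℝ E3 ℝ)) z :=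
    ((hη.differentiable (by simp)) z.2).hasFDerivAt.comp z hasFDerivAt_snd
  have h3 : HasFDerivAt (fun z : ET => h z.1) ((fderiv ℝ h z.1).comp (ContinuousLinearMap.fst ℝ E3 ℝ)) z :=
    ((hh.differentiable (by simp)) z.1).hasFDerivAt.comp z hasFDerivAt_fst
  rw [tdz, (h1.fun_mul h3).fderiv]
  simp [mul_comm]

lemma tens_tsupp {η : ℝ → ℝ} {h : E3 → ℝ} :
    tsupport (fun z : ET => η z.2 * h z.1) ⊆ tsupport h ×ˢ tsupport η := by
  apply closure_minimal _ ((isClosed_tsupport h).prod (isClosed_tsupport η))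
  intro z hz
  exact ⟨subset_tsupport _ (right_ne_zero_of_mul hz), subset_tsupport _ (left_ne_zero_of_mul hz)⟩

lemma comp_fderiv {φ : ET → E3} (hφ : CD φ) (z e : ET) (i : Fin 3) :
    (fderiv ℝ φ z e) i = fderiv ℝ (fun z => φ z i) z e := by
  have h := ((hφ.differentiable (by simp)) z).hasFDerivAt
  have h2 := (EuclideanSpace.proj (𝕜 := ℝ) (ι := Fin 3) i).hasFDerivAt.comp z h
  have h3 : HasFDerivAt (fun z => φ z i) ((EuclideanSpace.proj (𝕜 := ℝ) (ι := Fin 3) i).comp (fderiv ℝ φ z)) z := h2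
  rw [h3.fderiv]; rfl

lemma sdz_smooth {φ : ET → ℝ} (hφ : CD φ) (i : Fin 3) : CD (sdz φ i) :=
  (hφ.fderiv_right (by simp)).clm_apply contDiff_const

lemma sdz_cs {φ : ET → ℝ} (hφ : HasCompactSupport φ) (i : Fin 3) : HasCompactSupport (sdz φ i) :=
  HasCompactSupport.fderiv_apply ℝ hφ _

lemma cs_int {X : Type*} [TopologicalSpace X] [R1Space X] [MeasurableSpace X] [OpensMeasurableSpace X] {μ : Measure X}
    [IsFiniteMeasureOnCompacts μ] {g : X → ℝ} (gc : Continuous g) (gs : HasCompactSupport g) (s : Set X) :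
    Integrable g (μ.restrict s) := (gc.integrable_of_hasCompactSupport gs).integrableOn

lemma div_slice {Ω T v Dv p v₀} (hs : IsSuitableWeakSolution Ω T v Dv p v₀) {ψ : ET → ℝ}
    (hψ : CD ψ) (hc : HasCompactSupport ψ) (hsup : tsupport ψ ⊆ Ω ×ˢ Ioo 0 T) :
    ∀ᵐ t ∂(volume.restrict (Ioo 0 T)), ∫ x in Ω, ∑ i, v (x, t) i * sdz ψ i (x, t) = 0 := by
  apply loc_zero (G := fun z => ∑ i, v z i * sdz ψ i z)
  · exact integrable_finsetSum _ fun i _ => (int_fam hs.meas_v hs.meas_Dv hs.v_l2_w12 (sdz_smooth hψ i).continuous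
      (sdz_cs hc i) (cs_int (sdz_smooth hψ i).continuous (sdz_cs hc i) _)).1 i
  · intro η hη _ _
    have h := hs.div_free (fun z => η z.2 * ψ z) ((hη.comp contDiff_snd).mul hψ) hc.mul_left
      ((tsupport_mul_subset_right (f := fun z : ET => η z.2)).trans hsup)
    refine Eq.trans ?_ h
    congr 1; ext z
    rw [Finset.mul_sum]
    refine Finset.sum_congr rfl fun i _ => ?_
    rw [tens_der hη hψ]; ring

lemma fderiv_comm2 {ψ : E3 → ℝ} (hψ : CD ψ) (a b : E3) (x : E3) :
    fderiv ℝ (fun y => fderiv ℝ ψ y a) x b = fderiv ℝ (fun y => fderiv ℝ ψ y b) x a := by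
  have hd : DifferentiableAt ℝ (fderiv ℝ ψ) x := ((hψ.fderiv_right (m := (⊤ : ℕ∞)) (by simp)).differentiable (by simp)) x
  have e : ∀ c d : E3, fderiv ℝ (fun y => fderiv ℝ ψ y c) x d = fderiv ℝ (fderiv ℝ ψ) x d c := by
    intro c d
    rw [fderiv_clm_apply hd (differentiableAt_const c)]
    simp
  rw [e, e]
  have := ((hψ.of_le (m := 2) (WithTop.coe_le_coe.2 le_top)).contDiffAt (x := x)).isSymmSndFDerivAt (by simp)
  exact this b a

lemma int4 {X : Type*} [MeasurableSpace X] {μ : Measure X} {a b c d : X → ℝ} (ha : Integrable a μ) (hb : Integrable b μ)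
    (hc : Integrable c μ) (hd : Integrable d μ) (h : ∫ z, (-a z + b z + c z - d z) ∂μ = 0) (h1 : ∫ z, a z ∂μ = 0)
    (h3 : ∫ z, c z ∂μ = 0) : ∫ z, (b z - d z) ∂μ = 0 := by
  have e := integral_sub ((ha.neg.add hb).add hc) hd
  have e2 := integral_add (ha.neg.add hb) hc
  have e3 := integral_add ha.neg hb
  have e4 := integral_neg (μ := μ) a
  have e5 := integral_sub hb hd
  simp only [Pi.add_apply, Pi.neg_apply] at e e2 e3 e4 e5
  rw [e5]; linarith

set_option maxHeartbeats 1000000 in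
lemma lap_test {Ω T v Dv p v₀} (hs : IsSuitableWeakSolution Ω T v Dv p v₀) {ψ : E3 → ℝ}
    (hψ : CD ψ) (hc : HasCompactSupport ψ) (hsup : tsupport ψ ⊆ Ω) {η : ℝ → ℝ}
    (hη : CD η) (hηc : HasCompactSupport η) (hηs : tsupport η ⊆ Ioo 0 T) :
    ∫ z in Ω ×ˢ Ioo 0 T, ∑ i, ∑ j, Dv z j i * (η z.2 * fderiv ℝ pd(ψ,i) z.1 (ee j)) = 0 := by
  have s1 : ∀ i, CD pd(ψ,i) := fun i => partial_smooth hψ _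
  have c1 : ∀ i, HasCompactSupport pd(ψ,i) := fun i => HasCompactSupport.fderiv_apply ℝ hc _
  have t1 : ∀ i, tsupport pd(ψ,i) ⊆ tsupport ψ := fun i => tsupport_fderiv_apply_subset ℝ _
  have s2 : ∀ i j, CD pd(pd(ψ,i),j) :=
    fun i j => partial_smooth (s1 i) _
  have c2 : ∀ i j, HasCompactSupport pd(pd(ψ,i),j) :=
    fun i j => HasCompactSupport.fderiv_apply ℝ (c1 i) _
  have t2 : ∀ i j, tsupport (pd(pd(ψ,i),j)) ⊆ tsupport ψ :=
    fun i j => (tsupport_fderiv_apply_subset ℝ _).trans (t1 i)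
  have sl := lapl_smooth hψ
  have cl : HasCompactSupport (lapl ψ) := hc.of_isClosed_subset (isClosed_tsupport _) (lapl_tsupp ψ)
  have hF := hs.v_l2_w12
  have hP := hs.p_l32
  have hF' := hF
  have hP' := hP
  rw [IntegrableOn, prodm] at hF' hP'
  have gcs : ∀ (η : ℝ → ℝ) (g : E3 → ℝ), HasCompactSupport η → HasCompactSupport g →
      HasCompactSupport fun z : ET => η z.2 * g z.1 := fun η g h1 h2 =>
    (h2.isCompact.prod h1.isCompact).of_isClosed_subset (isClosed_tsupport _) tens_tsupp
  have gcc : ∀ (η : ℝ → ℝ) (g : E3 → ℝ), Continuous η → Continuous g → Continuous fun z : ET => η z.2 * g z.1 :=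
    fun η g h1 h2 => (h1.comp continuous_snd).mul (h2.comp continuous_fst)
  have gI : ∀ (g : E3 → ℝ), Continuous g → HasCompactSupport g → 
        Continuous (fun z : ET => η z.2 * g z.1) ∧ Integrable (fun z : ET => η z.2 * g z.1) (volume.restrict (Ω ×ˢ Ioo 0 T)) := by
      intro g h1 h2
      have := gcc _ _ hη.continuous h1
      exact ⟨this, cs_int this (gcs η g hηc h2) _⟩
  have fam : ∀ (g : E3 → ℝ), Continuous g → HasCompactSupport g → _ := fun g h1 h2 =>
      int_fam hs.meas_v hs.meas_Dv hF (gI g h1 h2).1 (gcs η g hηc h2) (gI g h1 h2).2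
  have i3 : ∀ i j, Integrable (fun z => Dv z j i * (η z.2 * fderiv ℝ pd(ψ,i) z.1 (ee j))) (volume.restrict (Ω ×ˢ Ioo 0 T)) :=
    fun i j => (fam _ (s2 i j).continuous (c2 i j)).2.1 j i
  have hd := hs.div_free (fun z => η z.2 * lapl ψ z.1) ((hη.comp contDiff_snd).mul (sl.comp contDiff_fst))
    (gcs _ _ hηc cl) (tens_tsupp.trans (prod_mono ((lapl_tsupp ψ).trans hsup) hηs))
  have hdl : ∀ i z, sdz (fun z : ET => η z.2 * lapl ψ z.1) i z = η z.2 * fderiv ℝ (lapl ψ) z.1 (ee i) := by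
    intro i z
    have := tens_der hη (sl.comp (contDiff_fst (E := E3) (F := ℝ))) i z
    have h2 := sdz_fst sl i z
    simp only [Function.comp_def] at this h2
    rw [this, h2]
  simp only [hdl] at hd
  have ci : ∀ i, HasCompactSupport fun y => fderiv ℝ (lapl ψ) y (ee i) := fun i => HasCompactSupport.fderiv_apply ℝ cl _
  have j1 : Integrable (fun z : ET => ∑ i, v z i * (η z.2 * fderiv ℝ (lapl ψ) z.1 (ee i)))
      (volume.restrict (Ω ×ˢ Ioo 0 T)) := integrable_finsetSum _ fun i _ =>
    (fam _ (partial_smooth sl (ee i)).continuous (ci i)).1 i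
  have j2 : Integrable (fun z : ET => ∑ i, ∑ j, Dv z j i * (η z.2 * fderiv ℝ pd(ψ,i) z.1 (ee j)))
      (volume.restrict (Ω ×ˢ Ioo 0 T)) := integrable_finsetSum _ fun i _ => integrable_finsetSum _ fun j _ => i3 i j
  rw [prodm] at hd j1 j2 ⊢
  rw [integral_prod_symm _ j1] at hd
  rw [integral_prod_symm _ j2, ← neg_eq_zero, ← integral_neg]
  refine Eq.trans ?_ hd
  apply integral_congr_ae
  have wg : ∀ᵐ t ∂(volume.restrict (Ioo 0 T)), ∀ i j : Fin 3,
      ∫ x in Ω, v (x, t) i * fderiv ℝ (pd(pd(ψ,i),j)) x (ee j) =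
      - ∫ x in Ω, Dv (x, t) j i * fderiv ℝ pd(ψ,i) x (ee j) := by
    rw [ae_all_iff]; intro i; rw [ae_all_iff]; intro j
    filter_upwards [hs.weak_grad _ (s2 i j) (c2 i j) ((t2 i j).trans hsup)] with t ht using ht j i
  filter_upwards [wg, hF'.prod_left_ae] with t ht htF
  have mvt : Measurable fun x => v (x, t) := hs.meas_v.comp measurable_prodMk_right
  have mDt : Measurable fun x => Dv (x, t) := hs.meas_Dv.comp measurable_prodMk_right
  have famt : ∀ (g : E3 → ℝ), Continuous g → HasCompactSupport g → _ := fun g h1 h2 =>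
    int_fam mvt mDt htF h1 h2 (cs_int h1 h2 Ω)
  have s3 : ∀ i j, Continuous fun x => fderiv ℝ (pd(pd(ψ,i),j)) x (ee j) :=
    fun i j => (partial_smooth (s2 i j) _).continuous
  have c3 : ∀ i j, HasCompactSupport fun x => fderiv ℝ (pd(pd(ψ,i),j)) x (ee j) :=
    fun i j => HasCompactSupport.fderiv_apply ℝ (c2 i j) _
  have eL : ∀ i x, fderiv ℝ (lapl ψ) x (ee i) = ∑ j, fderiv ℝ (pd(pd(ψ,i),j)) x (ee j) := by
    intro i x
    have : lapl ψ = fun y => ∑ j, fderiv ℝ pd(ψ,j) y (ee j) := rfl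
    rw [this, fderiv_fun_sum fun j _ => ((s2 j j).differentiable (by simp)) x, _root_.sum_apply]
    refine Finset.sum_congr rfl fun j _ => ?_
    rw [fderiv_comm2 (s1 j) (ee j) (ee i)]
    congr 2
    ext y
    exact fderiv_comm2 hψ _ _ _
  have I1 : ∀ i j, Integrable (fun x => Dv (x, t) j i * (η t * fderiv ℝ pd(ψ,i) x (ee j))) (volume.restrict Ω) := by
    intro i j
    refine (((famt _ (s2 i j).continuous (c2 i j)).2.1 j i).const_mul (η t)).congr (ae_of_all _ fun x => ?_)
    simp only []; ring
  have I2 : ∀ i, Integrable (fun x => v (x, t) i * (η t * fderiv ℝ (lapl ψ) x (ee i))) (volume.restrict Ω) := by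
    intro i
    refine (((famt _ (partial_smooth sl (ee i)).continuous (ci i)).1 i).const_mul (η t)).congr (ae_of_all _ fun x => ?_)
    simp only []; ring
  have L : ∫ x in Ω, ∑ i, ∑ j, Dv (x, t) j i * (η t * fderiv ℝ pd(ψ,i) x (ee j)) =
      η t * ∑ i, ∑ j, ∫ x in Ω, Dv (x, t) j i * fderiv ℝ pd(ψ,i) x (ee j) := by
    rw [integral_finsetSum _ fun i _ => integrable_finsetSum _ fun j _ => I1 i j, Finset.mul_sum]
    refine Finset.sum_congr rfl fun i _ => ?_
    rw [integral_finsetSum _ fun j _ => I1 i j, Finset.mul_sum]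
    refine Finset.sum_congr rfl fun j _ => ?_
    rw [← integral_const_mul]; congr 1; ext x; ring
  have Rr : ∫ x in Ω, ∑ i, v (x, t) i * (η t * fderiv ℝ (lapl ψ) x (ee i)) =
      η t * ∑ i, ∑ j, ∫ x in Ω, v (x, t) i * fderiv ℝ (pd(pd(ψ,i),j)) x (ee j) := by
    rw [integral_finsetSum _ fun i _ => I2 i, Finset.mul_sum]
    refine Finset.sum_congr rfl fun i _ => ?_
    rw [← integral_finsetSum _ fun j _ => (famt _ (s3 i j) (c3 i j)).1 i, ← integral_const_mul]
    congr 1; ext x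
    rw [eL, ← Finset.mul_sum]; ring
  show -(∫ x in Ω, ∑ i, ∑ j, Dv (x, t) j i * (η t * fderiv ℝ pd(ψ,i) x (ee j))) =
    ∫ x in Ω, ∑ i, v (x, t) i * (η t * fderiv ℝ (lapl ψ) x (ee i))
  rw [L, Rr]
  simp only [ht, Finset.sum_neg_distrib]; ring

set_option maxHeartbeats 1000000 in
lemma press_slice {Ω T v Dv p v₀} (hs : IsSuitableWeakSolution Ω T v Dv p v₀) {ψ : E3 → ℝ}
    (hψ : CD ψ) (hc : HasCompactSupport ψ) (hsup : tsupport ψ ⊆ Ω) :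
    ∀ᵐ t ∂(volume.restrict (Ioo 0 T)), ∫ x in Ω, p (x, t) * lapl ψ x =
      ∫ x in Ω, ∑ i, fv (fun x => v (x, t)) (fun x => Dv (x, t)) x i * fderiv ℝ ψ x (ee i) := by
  have s1 : ∀ i, CD pd(ψ,i) := fun i => partial_smooth hψ _
  have c1 : ∀ i, HasCompactSupport pd(ψ,i) := fun i => HasCompactSupport.fderiv_apply ℝ hc _
  have t1 : ∀ i, tsupport pd(ψ,i) ⊆ tsupport ψ := fun i => tsupport_fderiv_apply_subset ℝ _
  have s2 : ∀ i j, CD pd(pd(ψ,i),j) :=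
    fun i j => partial_smooth (s1 i) _
  have c2 : ∀ i j, HasCompactSupport pd(pd(ψ,i),j) :=
    fun i j => HasCompactSupport.fderiv_apply ℝ (c1 i) _
  have t2 : ∀ i j, tsupport (pd(pd(ψ,i),j)) ⊆ tsupport ψ :=
    fun i j => (tsupport_fderiv_apply_subset ℝ _).trans (t1 i)
  have sl := lapl_smooth hψ
  have cl : HasCompactSupport (lapl ψ) := hc.of_isClosed_subset (isClosed_tsupport _) (lapl_tsupp ψ)
  have hF := hs.v_l2_w12
  have hP := hs.p_l32
  have hF' := hF
  have hP' := hP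
  rw [IntegrableOn, prodm] at hF' hP'
  have gcs : ∀ (η : ℝ → ℝ) (g : E3 → ℝ), HasCompactSupport η → HasCompactSupport g →
      HasCompactSupport fun z : ET => η z.2 * g z.1 := fun η g h1 h2 =>
    (h2.isCompact.prod h1.isCompact).of_isClosed_subset (isClosed_tsupport _) tens_tsupp
  have gcc : ∀ (η : ℝ → ℝ) (g : E3 → ℝ), Continuous η → Continuous g → Continuous fun z : ET => η z.2 * g z.1 :=
    fun η g h1 h2 => (h1.comp continuous_snd).mul (h2.comp continuous_fst)
  have key : ∀ η : ℝ → ℝ, CD η → HasCompactSupport η → tsupport η ⊆ Ioo 0 T →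
      ∫ z in Ω ×ˢ Ioo 0 T, η z.2 * ((∑ i, ∑ j, v z j * Dv z j i * fderiv ℝ ψ z.1 (ee i)) - p z * lapl ψ z.1) = 0 := by
    intro η hη hηc hηs
    have gI : ∀ (g : E3 → ℝ), Continuous g → HasCompactSupport g → 
        Continuous (fun z : ET => η z.2 * g z.1) ∧ Integrable (fun z : ET => η z.2 * g z.1) (volume.restrict (Ω ×ˢ Ioo 0 T)) := by
      intro g h1 h2
      have := gcc _ _ hη.continuous h1
      exact ⟨this, cs_int this (gcs η g hηc h2) _⟩
    have fam : ∀ (g : E3 → ℝ), Continuous g → HasCompactSupport g → _ := fun g h1 h2 =>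
      int_fam hs.meas_v hs.meas_Dv hF (gI g h1 h2).1 (gcs η g hηc h2) (gI g h1 h2).2
    obtain ⟨φ, hφ⟩ : ∃ φ : ET → E3, φ = fun z => WithLp.toLp 2 fun i => η z.2 * fderiv ℝ ψ z.1 (ee i) := ⟨_, rfl⟩
    have φi : ∀ i, (fun z => φ z i) = fun z => η z.2 * fderiv ℝ ψ z.1 (ee i) := fun i => by rw [hφ]
    have φsm : CD φ := by
      rw [contDiff_euclidean]
      intro i
      rw [φi]
      exact (hη.comp contDiff_snd).mul ((s1 i).comp contDiff_fst)
    have φts : tsupport φ ⊆ tsupport ψ ×ˢ tsupport η := by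
      apply closure_minimal _ ((isClosed_tsupport _).prod (isClosed_tsupport _))
      intro z hz
      have : ∃ i, φ z i ≠ 0 := by
        by_contra hh
        push Not at hh
        exact hz (by ext i; simpa using hh i)
      obtain ⟨i, hi⟩ := this
      have hz2 : z ∈ Function.support fun z : ET => η z.2 * fderiv ℝ ψ z.1 (ee i) := by rw [← φi]; exact hi
      have := tens_tsupp (h := pd(ψ,i)) (subset_tsupport _ hz2)
      exact ⟨t1 i this.1, this.2⟩
    have h := hs.weak_nse φ φsm ((hc.isCompact.prod hηc.isCompact).of_isClosed_subset (isClosed_tsupport _) φts)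
      (φts.trans (prod_mono hsup fun t ht => (hηs ht).2))
    have hR : ∫ x in Ω, ∑ i, v₀ x i * φ (x, 0) i = 0 := by
      have : ∀ x i, φ (x, 0) i = 0 := by
        intro x i
        have h0 : η 0 = 0 := image_eq_zero_of_notMem_tsupport fun hh => lt_irrefl _ (hηs hh).1
        simp [hφ, h0]
      simp [this]
    have dsd : ∀ i j z, sdz φ j z i = η z.2 * fderiv ℝ pd(ψ,i) z.1 (ee j) := by
      intro i j z
      rw [sdz, comp_fderiv φsm, φi]
      have := tens_der hη ((s1 i).comp (contDiff_fst (E := E3) (F := ℝ))) j z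
      have h2 := sdz_fst (s1 i) j z
      simp only [sdz, Function.comp_def] at this h2 ⊢
      rw [this, h2]
    have dtd : ∀ i z, tdz φ z i = deriv η z.2 * fderiv ℝ ψ z.1 (ee i) := by
      intro i z
      rw [tdz, comp_fderiv φsm, φi]
      exact tens_tdz hη (s1 i) z
    have dη : CD (deriv η) := ((contDiff_infty_iff_deriv (𝕜 := ℝ)).1 hη).2
    have h1 : ∫ z in Ω ×ˢ Ioo 0 T, ∑ i, v z i * tdz φ z i = 0 := by
      have hd := hs.div_free (fun z => deriv η z.2 * ψ z.1) ((dη.comp contDiff_snd).mul (hψ.comp contDiff_fst))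
        (gcs _ _ hηc.deriv hc) (tens_tsupp.trans (prod_mono hsup ((closure_minimal support_deriv_subset (isClosed_tsupport _)).trans hηs)))
      refine Eq.trans ?_ hd
      congr 1; ext z
      refine Finset.sum_congr rfl fun i _ => ?_
      rw [dtd]
      have := tens_der dη (hψ.comp (contDiff_fst (E := E3) (F := ℝ))) i z
      have h2 := sdz_fst hψ i z
      simp only [Function.comp_def] at this h2
      rw [this, h2]
    have i3 : ∀ i j, Integrable (fun z => Dv z j i * sdz φ j z i) (volume.restrict (Ω ×ˢ Ioo 0 T)) := by
      intro i j
      simp only [dsd]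
      exact (fam _ (s2 i j).continuous (c2 i j)).2.1 j i
    have h3 : ∫ z in Ω ×ˢ Ioo 0 T, ∑ i, ∑ j, Dv z j i * sdz φ j z i = 0 := by
      simp only [dsd]; exact lap_test hs hψ hc hsup hη hηc hηs
    have i1 : Integrable (fun z => ∑ i, v z i * tdz φ z i) (volume.restrict (Ω ×ˢ Ioo 0 T)) := by
      refine integrable_finsetSum _ fun i _ => ?_
      simp only [dtd]
      have hcont := gcc _ _ dη.continuous (s1 i).continuous
      have hgs := gcs _ _ hηc.deriv (c1 i)
      have hin := cs_int (μ := (volume : Measure (ET))) hcont hgs (Ω ×ˢ Ioo 0 T)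
      exact (int_fam hs.meas_v hs.meas_Dv hF hcont hgs hin).1 i
    have i2 : Integrable (fun z => ∑ i, ∑ j, v z j * Dv z j i * φ z i) (volume.restrict (Ω ×ˢ Ioo 0 T)) := by
      refine integrable_finsetSum _ fun i _ => integrable_finsetSum _ fun j _ => ?_
      have h5 : ∀ z, φ z i = η z.2 * fderiv ℝ ψ z.1 (ee i) := fun z => congrFun (φi i) z
      simp only [h5]
      exact (fam _ (s1 i).continuous (c1 i)).2.2 i j
    have i3' : Integrable (fun z => ∑ i, ∑ j, Dv z j i * sdz φ j z i) (volume.restrict (Ω ×ˢ Ioo 0 T)) :=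
      integrable_finsetSum _ fun i _ => integrable_finsetSum _ fun j _ => i3 i j
    have e4 : ∀ z, p z * ∑ i, sdz φ i z i = p z * (η z.2 * lapl ψ z.1) := fun z => by
      simp only [dsd, lapl, Finset.mul_sum]
    have i4 : Integrable (fun z => p z * ∑ i, sdz φ i z i) (volume.restrict (Ω ×ˢ Ioo 0 T)) := by
      simp only [e4]
      exact int_p hs.meas_p hP (gI _ sl.continuous cl).1 (gcs _ _ hηc cl) (gI _ sl.continuous cl).2
    rw [hR] at h
    replace h := int4 i1 i2 i3' i4 h h1 h3
    refine Eq.trans ?_ h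
    congr 1; ext z
    rw [e4, hφ, mul_sub, Finset.mul_sum]
    congr 1
    · refine Finset.sum_congr rfl fun i _ => ?_
      rw [Finset.mul_sum]
      refine Finset.sum_congr rfl fun j _ => ?_
      simp only []; ring
    · ring
  have key2 := loc_zero (Ω := Ω) (T := T) (G := fun z => (∑ i, ∑ j, v z j * Dv z j i * fderiv ℝ ψ z.1 (ee i)) - p z * lapl ψ z.1) ?_ key
  · filter_upwards [key2, hF'.prod_left_ae, hP'.prod_left_ae] with t ht htF htP
    have mvt : Measurable fun x => v (x, t) := hs.meas_v.comp measurable_prodMk_right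
    have mDt : Measurable fun x => Dv (x, t) := hs.meas_Dv.comp measurable_prodMk_right
    have mpt : Measurable fun x => p (x, t) := hs.meas_p.comp measurable_prodMk_right
    have q1 : Integrable (fun x => ∑ i, ∑ j, v (x, t) j * Dv (x, t) j i * fderiv ℝ ψ x (ee i)) (volume.restrict Ω) :=
      integrable_finsetSum _ fun i _ => integrable_finsetSum _ fun j _ =>
        (int_fam mvt mDt htF (s1 i).continuous (c1 i) (cs_int (s1 i).continuous (c1 i) Ω)).2.2 i j
    have q2 : Integrable (fun x => p (x, t) * lapl ψ x) (volume.restrict Ω) :=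
      int_p mpt htP sl.continuous cl (cs_int sl.continuous cl Ω)
    rw [integral_sub q1 q2, sub_eq_zero] at ht
    rw [← ht]
    simp only [fv, Finset.sum_mul]
  · obtain ⟨η, hη, hηc, h1⟩ : ∃ η : ℝ → ℝ, Continuous η ∧ HasCompactSupport η ∧ ∀ t ∈ Ioo 0 T, η t = 1 := by
      let f : ContDiffBump (0:ℝ) := ⟨|T| + 1, |T| + 2, by positivity, by linarith⟩
      refine ⟨f, f.continuous, f.hasCompactSupport, fun t ht => f.one_of_mem_closedBall ?_⟩
      rw [mem_closedBall, dist_zero_right, Real.norm_eq_abs, abs_of_pos ht.1]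
      have := le_abs_self T
      show t ≤ |T| + 1
      linarith [ht.2]
    have gc : ∀ g : E3 → ℝ, Continuous g → Continuous (fun z : ET => η z.2 * g z.1) := fun g hg => gcc _ _ hη hg
    have J1 : ∀ i j, Integrable (fun z => v z j * Dv z j i * (η z.2 * fderiv ℝ ψ z.1 (ee i))) (volume.restrict (Ω ×ˢ Ioo 0 T)) := by
      intro i j
      have hcont := gc _ (s1 i).continuous
      have hgs := gcs _ _ hηc (c1 i)
      have hin := cs_int (μ := (volume : Measure (ET))) hcont hgs (Ω ×ˢ Ioo 0 T)
      exact (int_fam hs.meas_v hs.meas_Dv hF hcont hgs hin).2.2 i j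
    have J2 : Integrable (fun z => p z * (η z.2 * lapl ψ z.1)) (volume.restrict (Ω ×ˢ Ioo 0 T)) := by
      have hcont := gc _ sl.continuous
      have hgs := gcs _ _ hηc cl
      have hin := cs_int (μ := (volume : Measure (ET))) hcont hgs (Ω ×ˢ Ioo 0 T)
      exact int_p hs.meas_p hP hcont hgs hin
    have := (integrable_finsetSum Finset.univ fun i _ => integrable_finsetSum Finset.univ fun j _ => J1 i j).sub J2
    refine this.congr ?_
    have hm : ∀ᵐ z ∂((volume : Measure (ET)).restrict (Ω ×ˢ Ioo 0 T)), z.2 ∈ Ioo 0 T := by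
      rw [prodm]
      exact Measure.quasiMeasurePreserving_snd.ae (ae_restrict_mem measurableSet_Ioo)
    filter_upwards [hm] with z hz
    simp only [Pi.sub_apply, h1 _ hz, one_mul]

lemma swap_ae {F G : (ET) × E3 → ℝ} (hF : Measurable F) (hG : Measurable G) (S B : Set E3) (hB : MeasurableSet B) (T : ℝ)
    (h : ∀ x ∈ B, ∀ᵐ t ∂(volume.restrict (Ioo 0 T)), ∫ w in S, F ((x, t), w) = ∫ w in S, G ((x, t), w)) :
    ∀ᵐ t ∂(volume.restrict (Ioo 0 T)), ∀ᵐ x ∂(volume.restrict B), ∫ w in S, F ((x, t), w) = ∫ w in S, G ((x, t), w) := by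
  have hms : MeasurableSet {z : ET | ∫ w in S, F ((z.1, z.2), w) = ∫ w in S, G ((z.1, z.2), w)} :=
    measurableSet_eq_fun (hF.stronglyMeasurable.integral_prod_right').measurable
      (hG.stronglyMeasurable.integral_prod_right').measurable
  rw [← Measure.ae_ae_comm hms]
  exact (ae_restrict_iff' hB).2 (ae_of_all _ h)

lemma int_ball {Ω S : Set E3} (hΩ : MeasurableSet Ω) (h : S ⊆ Ω) {f : E3 → ℝ} (hf : ∀ w, w ∉ S → f w = 0) :
    ∫ w in Ω, f w = ∫ w in S, f w :=
  setIntegral_eq_of_subset_of_forall_diff_eq_zero hΩ h fun x hx => hf x hx.2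

lemma fd_zero {f : E3 → ℝ} {x : E3} (h : x ∉ tsupport f) (e : E3) : fderiv ℝ f x e = 0 :=
  image_eq_zero_of_notMem_tsupport (f := fun x => fderiv ℝ f x e) fun hh => h (tsupport_fderiv_apply_subset ℝ e hh)

lemma rho_tsupport (r : ℝ) (hr : 0 < r) (n : ℕ) (x : E3) : tsupport (fun w => rho r hr n (x - w)) ⊆ closedBall x r := by
  apply closure_minimal _ isClosed_closedBall
  intro w hw
  have h1 : x - w ∈ Function.support ((mol r hr n).normed volume) := hw
  rw [(mol r hr n).support_normed_eq, mem_ball, dist_zero_right] at h1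
  rw [mem_closedBall, dist_comm, dist_eq_norm]
  refine h1.le.trans ?_
  show r / (n + 2) ≤ r
  exact div_le_self hr.le (by have : (0:ℝ) ≤ n := n.cast_nonneg
                              linarith)

set_option maxHeartbeats 1000000 in
lemma slice_ae {Ω T v Dv p v₀} (hs : IsSuitableWeakSolution Ω T v Dv p v₀) (hΩ : IsOpen Ω) (xo : E3) (r : ℝ) (hr : 0 < r)
    (hb : ball xo (2 * r) ⊆ Ω) : ∀ᵐ t ∂(volume.restrict (Ioo 0 T)),
      Slice (fun x => v (x, t)) (fun x => Dv (x, t)) (fun x => p (x, t)) xo r hr := by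
  have hF' := hs.v_l2_w12
  have hP' := hs.p_l32
  rw [IntegrableOn, prodm] at hF' hP'
  have hcb : ∀ x ∈ ball xo r, closedBall x r ⊆ ball xo (2 * r) := by
    intro x hx w hw
    rw [mem_ball] at *
    rw [mem_closedBall] at hw
    linarith [dist_triangle w x xo]
  have P : Measurable fun q : (ET) × E3 => (q.2, q.1.2) := by fun_prop
  have mw : Measurable fun q : (ET) × E3 => (q.1.1, q.2) := by fun_prop
  have mv : Measurable fun q : (ET) × E3 => v (q.2, q.1.2) := hs.meas_v.comp P
  have mD : Measurable fun q : (ET) × E3 => Dv (q.2, q.1.2) := hs.meas_Dv.comp P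
  have mp : Measurable fun q : (ET) × E3 => p (q.2, q.1.2) := hs.meas_p.comp P
  have mk : ∀ (k : E3 → ℝ), Continuous k → ∀ e : E3, Measurable fun q : (ET) × E3 => fderiv ℝ (fun w => k (q.1.1 - w)) q.2 e := by
    intro k hk e
    have := measurable_fderiv_apply_const_with_param ℝ (f := fun (x w : E3) => k (x - w))
      (by simp only [Function.uncurry_def]; exact hk.comp (continuous_fst.sub continuous_snd)) e
    exact this.comp mw
  have S1 : ∀ n : ℕ, ∀ i j : Fin 3, ∀ᵐ t ∂(volume.restrict (Ioo 0 T)), ∀ᵐ x ∂(volume.restrict (ball xo r)),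
      ∫ w in ball xo (2 * r), v (w, t) j * fderiv ℝ (fun w => rho r hr n (x - w)) w (ee i) =
        ∫ w in ball xo (2 * r), - (Dv (w, t) i j * rho r hr n (x - w)) := by
    intro n i j
    have hrm : Measurable (rho r hr n) := (rho_smooth r hr n).continuous.measurable
    refine swap_ae (F := fun q => v (q.2, q.1.2) j * fderiv ℝ (fun w => rho r hr n (q.1.1 - w)) q.2 (ee i))
      (G := fun q => - (Dv (q.2, q.1.2) i j * rho r hr n (q.1.1 - q.2))) ?_ ?_ _ _ measurableSet_ball T ?_
    · exact (mcomp mv j).mul (mk _ (rho_smooth r hr n).continuous _)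
    · exact ((mDcomp mD i j).mul (hrm.comp (by fun_prop))).neg
    · intro x hx
      have ht := (rho_tsupport r hr n x).trans (hcb x hx)
      have hsm : CD fun w => rho r hr n (x - w) := (rho_smooth r hr n).comp (by fun_prop)
      have hcs : HasCompactSupport fun w => rho r hr n (x - w) :=
        (isCompact_closedBall x r).of_isClosed_subset (isClosed_tsupport _) (rho_tsupport r hr n x)
      filter_upwards [hs.weak_grad _ hsm hcs (ht.trans hb)] with t h
      have h := h i j
      rw [int_ball hΩ.measurableSet hb fun w hw => ?_, int_ball hΩ.measurableSet hb fun w hw => ?_] at h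
      · rw [integral_neg]; exact h
      · rw [image_eq_zero_of_notMem_tsupport (f := fun w => rho r hr n (x - w)) fun hh => hw (ht hh), mul_zero]
      · rw [fd_zero fun hh => hw (ht hh), mul_zero]
  have S2 : ∀ n : ℕ, ∀ᵐ t ∂(volume.restrict (Ioo 0 T)), ∀ᵐ x ∂(volume.restrict (ball xo r)),
      ∫ w in ball xo (2 * r), p (w, t) * lapl (psi r n x) w =
        ∫ w in ball xo (2 * r), ∑ i, fv (fun x => v (x, t)) (fun x => Dv (x, t)) w i * fderiv ℝ (psi r n x) w (ee i) := by
    intro n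
    refine swap_ae (F := fun q => p (q.2, q.1.2) * lapl (psi r n q.1.1) q.2)
      (G := fun q => ∑ i, fv (fun x => v (x, q.1.2)) (fun x => Dv (x, q.1.2)) q.2 i * fderiv ℝ (psi r n q.1.1) q.2 (ee i)) ?_ ?_ _ _ measurableSet_ball T ?_
    · refine mp.mul ?_
      simp only [psi_lapl]
      have := eta_smooth.continuous.measurable
      fun_prop
    · refine Finset.measurable_fun_sum _ fun i _ => ?_
      refine Measurable.mul ?_ (mk _ (MM_smooth r n).continuous _)
      simp only [fv]
      exact Finset.measurable_fun_sum _ fun j _ => (mcomp mv j).mul (mDcomp mD j i)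
    · intro x hx
      have ht := (psi_tsupport r hr n x).trans (hcb x hx)
      have hcs : HasCompactSupport (psi r n x) :=
        (isCompact_closedBall x r).of_isClosed_subset (isClosed_tsupport _) (psi_tsupport r hr n x)
      filter_upwards [press_slice hs (psi_smooth r n x) hcs (ht.trans hb)] with t h
      rw [int_ball hΩ.measurableSet hb fun w hw => ?_, int_ball hΩ.measurableSet hb fun w hw => ?_] at h
      · exact h
      · exact Finset.sum_eq_zero fun i _ => by rw [fd_zero fun hh => hw (ht hh), mul_zero]
      · rw [image_eq_zero_of_notMem_tsupport fun hh => hw (ht (lapl_tsupp _ hh)), mul_zero]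
  filter_upwards [hF'.prod_left_ae, hP'.prod_left_ae, ae_all_iff.2 S2,
    ae_all_iff.2 fun n => ae_all_iff.2 fun i => ae_all_iff.2 fun j => S1 n i j] with t hF hP h2 h1
  have mvt : Measurable fun x => v (x, t) := hs.meas_v.comp measurable_prodMk_right
  have mDt : Measurable fun x => Dv (x, t) := hs.meas_Dv.comp measurable_prodMk_right
  have mpt : Measurable fun x => p (x, t) := hs.meas_p.comp measurable_prodMk_right
  have hfin : volume (ball xo (2 * r)) ≠ ⊤ := measure_ball_lt_top.ne
  have c1 : IntegrableOn (fun _ : E3 => (1:ℝ)) (ball xo (2 * r)) := integrableOn_const hfin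
  refine ⟨mvt, mDt, mpt, ?_, ?_, ?_, h2⟩
  · refine (c1.add (IntegrableOn.mono_set hF hb)).mono' mvt.aestronglyMeasurable (ae_of_all _ fun x => ?_)
    have : 0 ≤ ∑ i, ∑ j, (Dv (x, t) i j) ^ 2 := by positivity
    simp only [Pi.add_apply]
    nlinarith [sq_nonneg (‖v (x, t)‖ - 1)]
  · refine (c1.add (IntegrableOn.mono_set hP hb)).mono' mpt.aestronglyMeasurable (ae_of_all _ fun x => ?_)
    simp only [Pi.add_apply, Real.norm_eq_abs]
    rcases le_total (|p (x, t)|) 1 with h | h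
    · have : 0 ≤ |p (x, t)| ^ (3/2 : ℝ) := by positivity
      linarith
    · have := Real.rpow_le_rpow_of_exponent_le h (show (1:ℝ) ≤ 3/2 by norm_num)
      rw [Real.rpow_one] at this
      linarith
  · intro n
    rw [ae_all_iff]; intro i; rw [ae_all_iff]; intro j
    filter_upwards [h1 n i j] with x hx
    rw [hx, integral_neg]

def Vt (v : ET → E3) (xo : E3) (R t : ℝ) : ℝ≥0∞ := Vn (fun x => v (x, t)) xo R
def Ht (Dv : ET → Fin 3 → Fin 3 → ℝ) (xo : E3) (R t : ℝ) : ℝ≥0∞ := Hn (fun x => Dv (x, t)) xo R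
def At (p : ET → ℝ) (xo : E3) (R t : ℝ) : ℝ≥0∞ := An (fun x => p (x, t)) xo R
def Tt (v : ET → E3) (p : ET → ℝ) (xo : E3) (R t : ℝ) : ℝ≥0∞ := Tn (fun x => v (x, t)) (fun x => p (x, t)) xo R

structure Dat (v : ET → E3) (Dv : ET → Fin 3 → Fin 3 → ℝ) (p : ET → ℝ) (xo : E3) (tq R μ ε δ : ℝ) : Prop where
  A : ∀ᵐ t ∂(volume.restrict (Ioo (tq - R ^ 2) tq)), Vt v xo R t ≤ oR (μ ^ 2 * R)
  E : ∫⁻ t in Ioo (tq - R ^ 2) tq, Ht Dv xo R t ≤ oR (ε ^ 2 * R)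
  D : ∫⁻ t in Ioo (tq - R ^ 2) tq, At p xo R t ^ (3 / 2 : ℝ) ≤ oR (δ ^ 3 * R ^ 8)

lemma Ht_meas {Dv : ET → Fin 3 → Fin 3 → ℝ} (mD : Measurable Dv) (xo : E3) (R : ℝ) : Measurable (Ht Dv xo R) := by
  unfold Ht Hn
  have : Measurable fun q : ℝ × E3 => oR (∑ i, ∑ j, (Dv (q.2, q.1) i j) ^ 2) := by
    refine ENNReal.measurable_ofReal.comp ?_
    exact Finset.measurable_fun_sum _ fun i _ => Finset.measurable_fun_sum _ fun j _ =>
      ((mDcomp mD i j).comp measurable_swap).pow_const 2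
  exact this.lintegral_prod_right'

lemma rp1 (x : ℝ≥0∞) {s : ℝ} (h0 : 0 ≤ s) (h : s ≤ 1) : x ^ s ≤ 1 + x := by
  rcases le_total x 1 with hx | hx
  · exact (rpow_le_one hx h0).trans le_self_add
  · refine (rpow_le_rpow_of_exponent_le hx h).trans ?_
    rw [rpow_one]; exact le_add_self

lemma rp2 (x : ℝ≥0∞) : x ≤ 1 + x ^ (3 / 2 : ℝ) := by
  rcases le_total x 1 with hx | hx
  · exact hx.trans le_self_add
  · refine le_trans ?_ le_add_self
    calc x = x ^ (1:ℝ) := (rpow_one x).symm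
      _ ≤ _ := rpow_le_rpow_of_exponent_le hx (by norm_num)

lemma sq32 {x : ℝ} (hx : 0 ≤ x) : oR (x ^ 2) ^ (3 / 2 : ℝ) = oR (x ^ 3) := by
  rw [ofReal_rpow_of_nonneg pz (by norm_num)]
  congr 1
  rw [← Real.rpow_natCast, ← Real.rpow_natCast, ← Real.rpow_mul hx]
  norm_num

lemma sq34 {x : ℝ} (hx : 0 ≤ x) : oR (x ^ 4) ^ (3 / 4 : ℝ) = oR (x ^ 3) := by
  rw [ofReal_rpow_of_nonneg pz (by norm_num)]
  congr 1
  rw [← Real.rpow_natCast, ← Real.rpow_natCast, ← Real.rpow_mul hx]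
  norm_num

lemma vol_win (tq R : ℝ) : (volume.restrict (Ioo (tq - R ^ 2) tq)) univ = oR (R ^ 2) := by
  rw [Measure.restrict_apply_univ, Real.volume_Ioo]; congr 1; ring

lemma orr {a : ℝ} (ha : 0 < a) (x : ℝ≥0∞) : x = oR a * (oR a⁻¹ * x) := by
  rw [← mul_assoc, ← ofReal_mul ha.le, mul_inv_cancel₀ ha.ne', ofReal_one, one_mul]

lemma win_slices {Ω T v Dv p v₀} (hs : IsSuitableWeakSolution Ω T v Dv p v₀) (hΩ : IsOpen Ω) {xo : E3} {tq R : ℝ}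
    (hR : 0 < R) (hb : ball xo R ⊆ Ω) (ht : Ioo (tq - R ^ 2) tq ⊆ Ioo 0 T) :
    ∀ᵐ t ∂(volume.restrict (Ioo (tq - R ^ 2) tq)),
      Slice (fun x => v (x, t)) (fun x => Dv (x, t)) (fun x => p (x, t)) xo (R / 2) (half_pos hR) :=
  ae_mono (Measure.restrict_mono ht le_rfl) (slice_ae hs hΩ xo (R / 2) (half_pos hR) (by rwa [mul_div_cancel₀ _ two_ne_zero]))

lemma time_T : ∃ C : ℝ, 0 < C ∧ ∀ {Ω T v Dv p v₀}, IsSuitableWeakSolution Ω T v Dv p v₀ → IsOpen Ω → ∀ {xo : E3} {tq R μ ε δ : ℝ},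
    0 < R → ball xo R ⊆ Ω → Ioo (tq - R ^ 2) tq ⊆ Ioo 0 T → 0 < μ → 0 < ε → 0 < δ → Dat v Dv p xo tq R μ ε δ →
    ∫⁻ t in Ioo (tq - R ^ 2) tq, Tt v p xo (R / 2) t ≤ oR (C * R ^ 5 * (ε * μ * (ε + μ) + μ * δ ^ 2)) := by
  obtain ⟨C, hC, h⟩ := Tn_bound
  refine ⟨66 * C, by positivity, fun {Ω T v Dv p v₀} hs hΩ {xo tq R μ ε δ} hR hb ht hμ hε hδ hd => ?_⟩
  obtain ⟨J, hJ⟩ : ∃ J, J = ε * μ * (ε + μ) + μ * δ ^ 2 := ⟨_, rfl⟩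
  have hJ0 : 0 ≤ J := by rw [hJ]; positivity
  obtain ⟨r, hr⟩ : ∃ r, r = R / 2 := ⟨_, rfl⟩
  have hr0 : 0 < r := by rw [hr]; positivity
  have hR2 : R = 2 * r := by rw [hr]; ring
  obtain ⟨X, hX⟩ : ∃ X : ℝ → ℝ≥0∞, X = fun t => 1 + (oR (ε ^ 2 * r⁻¹)⁻¹ * Ht Dv xo R t +
    oR ((δ * r ^ 2) ^ 3)⁻¹ * At p xo R t ^ (3 / 2 : ℝ)) := ⟨_, rfl⟩
  have hpt : ∀ᵐ t ∂(volume.restrict (Ioo (tq - R ^ 2) tq)), Tt v p xo (R / 2) t ≤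
      oR (C * (r ^ 3 * (8 * J))) * X t := by
    filter_upwards [win_slices hs hΩ hR hb ht, hd.A] with t hS hA
    have hS' : Slice (fun x => v (x, t)) (fun x => Dv (x, t)) (fun x => p (x, t)) xo r hr0 := by simpa only [hr] using hS
    rw [← hr]
    have h1 : 1 ≤ X t := by rw [hX]; exact le_self_add
    refine (h _ _ _ xo r hr0 hS' (2 * μ) ε δ (X t) pz hε.le hδ.le h1 ?_ ?_ ?_).trans ?_
    · rw [← hR2]
      exact hA.trans (ofReal_le_ofReal (by rw [hR2]; nlinarith [mul_pos (pow_pos hμ 2) hr0]))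
    · rw [← hR2]
      calc Hn (fun x => Dv (x, t)) xo R = _ := orr (a := ε ^ 2 * r⁻¹) pz _
        _ ≤ _ := by
          refine mul_le_mul' le_rfl ?_
          rw [hX]
          exact le_self_add.trans le_add_self
    · rw [← hR2]
      calc An (fun x => p (x, t)) xo R = _ := orr (a := δ ^ 2 * r ^ 4) pz _
        _ ≤ _ := by
          refine mul_le_mul' le_rfl ?_
          rw [hX]
          refine (rp2 _).trans ?_
          refine add_le_add le_rfl (le_trans (le_of_eq ?_) le_add_self)
          rw [ENNReal.mul_rpow_of_nonneg _ _ (by norm_num), show (δ ^ 2 * r ^ 4)⁻¹ = ((δ * r ^ 2)⁻¹) ^ 2 by rw [inv_pow]; congr 1; ring,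
            sq32 pz, inv_pow]
          rfl
    · refine mul_le_mul' (ofReal_le_ofReal ?_) le_rfl
      refine mul_le_mul_of_nonneg_left (mul_le_mul_of_nonneg_left ?_ pz) hC.le
      rw [hJ]
      nlinarith [mul_pos hμ (pow_pos hδ 2), mul_pos (mul_pos hε hμ) hε, mul_pos (mul_pos hε hμ) hμ]
  have hXi : ∫⁻ t in Ioo (tq - R ^ 2) tq, X t ≤ oR (66 * R ^ 2) := by
    rw [hX]
    rw [lintegral_add_left measurable_const, lintegral_add_left ((Ht_meas hs.meas_Dv xo R).const_mul _), lintegral_const, vol_win, one_mul,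
      lintegral_const_mul' _ _ ofReal_ne_top, lintegral_const_mul' _ _ ofReal_ne_top]
    calc _ ≤ oR (R ^ 2) + (oR (ε ^ 2 * r⁻¹)⁻¹ * oR (ε ^ 2 * R) +
          oR ((δ * r ^ 2) ^ 3)⁻¹ * oR (δ ^ 3 * R ^ 8)) :=
        add_le_add le_rfl (add_le_add (mul_le_mul' le_rfl hd.E) (mul_le_mul' le_rfl hd.D))
      _ = oR (R ^ 2 + ((ε ^ 2 * r⁻¹)⁻¹ * (ε ^ 2 * R) + ((δ * r ^ 2) ^ 3)⁻¹ * (δ ^ 3 * R ^ 8))) := by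
        rw [← ofReal_mul pz, ← ofReal_mul pz, ← ofReal_add pz pz,
          ← ofReal_add pz pz]
      _ ≤ _ := by
        apply ofReal_le_ofReal
        rw [hR2]
        have e : (2 * r) ^ 2 + ((ε ^ 2 * r⁻¹)⁻¹ * (ε ^ 2 * (2 * r)) + ((δ * r ^ 2) ^ 3)⁻¹ * (δ ^ 3 * (2 * r) ^ 8)) = 262 * r ^ 2 := by
          field_simp; ring
        rw [e]; nlinarith [sq_nonneg r]
  calc _ ≤ ∫⁻ t in Ioo (tq - R ^ 2) tq, oR (C * (r ^ 3 * (8 * J))) * X t := lintegral_mono_ae hpt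
    _ ≤ oR (C * (r ^ 3 * (8 * J))) * oR (66 * R ^ 2) := by
      rw [lintegral_const_mul' _ _ ofReal_ne_top]; exact mul_le_mul' le_rfl hXi
    _ = _ := by
      rw [← ofReal_mul pz, ← hJ, hR2]; congr 1; ring

lemma time_D : ∃ C : ℝ, 0 < C ∧ ∀ {Ω T v Dv p v₀}, IsSuitableWeakSolution Ω T v Dv p v₀ → IsOpen Ω → ∀ {xo : E3} {tq R μ ε δ : ℝ},
    0 < R → ball xo R ⊆ Ω → Ioo (tq - R ^ 2) tq ⊆ Ioo 0 T → 0 < μ → 0 < ε → 0 < δ → Dat v Dv p xo tq R μ ε δ →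
    ∀ θ s : ℝ, 0 < θ → θ ^ 2 = μ * ε → 0 < s → s ^ 2 ≤ 1 / 2 →
    ∫⁻ t in Ioo (tq - (s ^ 2 * R) ^ 2) tq, At p xo (s ^ 2 * R) t ^ (3 / 2 : ℝ) ≤
      oR (C * (s ^ 5 * δ ^ 3 + s⁻¹ ^ 4 * θ ^ 3) * (s ^ 2 * R) ^ 8) := by
  obtain ⟨C, hC, h⟩ := press_decay
  obtain ⟨K, hK⟩ : ∃ K, K = 12 * (1 + C) := ⟨_, rfl⟩
  have hK0 : 0 < K := by rw [hK]; positivity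
  refine ⟨4 * K ^ 3, by positivity, fun {Ω T v Dv p v₀} hs hΩ {xo tq R μ ε δ} hR hb ht hμ hε hδ hd θ s hθ hθ2 hs0 hs1 => ?_⟩
  have hsub : Ioo (tq - (s ^ 2 * R) ^ 2) tq ⊆ Ioo (tq - R ^ 2) tq := by
    apply Ioo_subset_Ioo_left
    have h1 : s ^ 2 * R ≤ R := by nlinarith
    have h2 : (s ^ 2 * R) ^ 2 ≤ R ^ 2 := pow_le_pow_left₀ pz h1 2
    linarith
  have hKa : ∀ n : ℕ, n ≤ 7 → C * 2 ^ n ≤ K ^ 2 := by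
    intro n hn
    have : (2:ℝ) ^ n ≤ 2 ^ 7 := pow_le_pow_right₀ (by norm_num) hn
    have h3 : C * 2 ^ n ≤ C * 128 := mul_le_mul_of_nonneg_left (this.trans (by norm_num)) hC.le
    rw [hK]; nlinarith
  have hpt : ∀ᵐ t ∂(volume.restrict (Ioo (tq - R ^ 2) tq)), At p xo (s ^ 2 * R) t ^ (3 / 2 : ℝ) ≤
      oR (2 * ((K * (s ^ 2 * R) ^ 2) ^ 3 * θ ^ 3)) * (1 + oR (ε ^ 2 * R⁻¹)⁻¹ * Ht Dv xo R t) +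
      oR (2 * (K * s ^ 7) ^ 3) * At p xo R t ^ (3 / 2 : ℝ) := by
    filter_upwards [win_slices hs hΩ hR hb ht, hd.A] with t hS hA
    have h1 := h _ _ _ xo (R / 2) (half_pos hR) hS (s ^ 2 * R) pz (by nlinarith)
    rw [mul_div_cancel₀ _ (two_ne_zero' ℝ)] at h1
    have hf2 := fn_sq hS.mu hS.mD xo R
    have hf : fn (fun x => v (x, t)) (fun x => Dv (x, t)) xo R ^ (3 / 2 : ℝ) ≤
        oR (θ ^ 3) * (1 + oR (ε ^ 2 * R⁻¹)⁻¹ * Ht Dv xo R t) := by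
      calc _ = (fn (fun x => v (x, t)) (fun x => Dv (x, t)) xo R ^ 2) ^ (3 / 4 : ℝ) := by
            rw [← rpow_natCast, ← rpow_mul]; norm_num
        _ ≤ (oR (θ ^ 4) * (oR (ε ^ 2 * R⁻¹)⁻¹ * Ht Dv xo R t)) ^ (3 / 4 : ℝ) := by
            refine rpow_le_rpow (hf2.trans ?_) (by norm_num)
            refine (mul_le_mul' hA le_rfl).trans (le_of_eq ?_)
            rw [← mul_assoc, ← ofReal_mul pz]
            congr 2
            rw [show θ ^ 4 = (θ ^ 2) ^ 2 by ring, hθ2]; field_simp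
        _ ≤ _ := by
            rw [ENNReal.mul_rpow_of_nonneg _ _ (by norm_num), sq34 hθ.le]
            exact mul_le_mul' le_rfl (rp1 _ (by norm_num) (by norm_num))
    have h2 : At p xo (s ^ 2 * R) t ≤ oR ((K * (s ^ 2 * R) ^ 2) ^ 2) * fn (fun x => v (x, t)) (fun x => Dv (x, t)) xo R +
        oR ((K * s ^ 7) ^ 2) * At p xo R t := by
      refine h1.trans (add_le_add (mul_le_mul' (ofReal_le_ofReal ?_) le_rfl) (mul_le_mul' (ofReal_le_ofReal ?_) le_rfl))
      · have := hKa 0 (by norm_num)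
        have h5 : 0 ≤ (s ^ 2 * R) ^ 4 := by positivity
        calc _ = C * 2 ^ 0 * (s ^ 2 * R) ^ 4 := by ring
          _ ≤ K ^ 2 * (s ^ 2 * R) ^ 4 := mul_le_mul_of_nonneg_right this h5
          _ = _ := by ring
      · have := hKa 7 (by norm_num)
        have h5 : 0 ≤ s ^ 14 := by positivity
        calc _ = C * 2 ^ 7 * s ^ 14 := by field_simp
          _ ≤ K ^ 2 * s ^ 14 := mul_le_mul_of_nonneg_right this h5
          _ = _ := by ring
    have h22 : (2:ℝ≥0∞) ^ ((3 / 2 : ℝ) - 1) ≤ oR 2 := by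
      rw [show oR 2 = 2 by simp]
      calc (2:ℝ≥0∞) ^ ((3 / 2 : ℝ) - 1) ≤ 2 ^ (1:ℝ) := rpow_le_rpow_of_exponent_le (by norm_num) (by norm_num)
        _ = 2 := rpow_one _
    calc _ ≤ _ := rpow_le_rpow h2 (by norm_num)
      _ ≤ _ := rpow_add_le_mul_rpow_add_rpow _ _ (by norm_num)
      _ ≤ oR 2 * (oR ((K * (s ^ 2 * R) ^ 2) ^ 3) * (oR (θ ^ 3) * (1 + oR (ε ^ 2 * R⁻¹)⁻¹ * Ht Dv xo R t)) +
          oR ((K * s ^ 7) ^ 3) * At p xo R t ^ (3 / 2 : ℝ)) := by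
        refine mul_le_mul' h22 ?_
        rw [ENNReal.mul_rpow_of_nonneg _ _ (by norm_num), ENNReal.mul_rpow_of_nonneg _ _ (by norm_num), sq32 pz, sq32 pz]
        exact add_le_add (mul_le_mul' le_rfl hf) le_rfl
      _ = _ := by
        rw [ofReal_mul (p := 2) (by norm_num), ofReal_mul (p := 2) (by norm_num), ofReal_mul (p := (K * (s ^ 2 * R) ^ 2) ^ 3) pz]
        ring
  calc _ ≤ ∫⁻ t in Ioo (tq - R ^ 2) tq, At p xo (s ^ 2 * R) t ^ (3 / 2 : ℝ) := lintegral_mono_set hsub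
    _ ≤ _ := lintegral_mono_ae hpt
    _ ≤ oR (2 * ((K * (s ^ 2 * R) ^ 2) ^ 3 * θ ^ 3)) * (oR (R ^ 2) + oR (ε ^ 2 * R⁻¹)⁻¹ * oR (ε ^ 2 * R)) +
      oR (2 * (K * s ^ 7) ^ 3) * oR (δ ^ 3 * R ^ 8) := by
      rw [lintegral_add_left ((((Ht_meas hs.meas_Dv xo R).const_mul _).const_add _).const_mul _), lintegral_const_mul' _ _ ofReal_ne_top,
        lintegral_const_mul' _ _ ofReal_ne_top, lintegral_add_left measurable_const, lintegral_const, vol_win, one_mul,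
        lintegral_const_mul' _ _ ofReal_ne_top]
      exact add_le_add (mul_le_mul' le_rfl (add_le_add le_rfl (mul_le_mul' le_rfl hd.E))) (mul_le_mul' le_rfl hd.D)
    _ = oR (2 * ((K * (s ^ 2 * R) ^ 2) ^ 3 * θ ^ 3) * (R ^ 2 + (ε ^ 2 * R⁻¹)⁻¹ * (ε ^ 2 * R)) + 2 * (K * s ^ 7) ^ 3 * (δ ^ 3 * R ^ 8)) := by
      rw [← ofReal_mul pz, ← ofReal_mul pz, ← ofReal_add pz pz,
          ← ofReal_mul pz, ← ofReal_add pz pz]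
    _ ≤ _ := by
      apply ofReal_le_ofReal
      have e : 4 * K ^ 3 * (s ^ 5 * δ ^ 3 + s⁻¹ ^ 4 * θ ^ 3) * (s ^ 2 * R) ^ 8 -
        (2 * ((K * (s ^ 2 * R) ^ 2) ^ 3 * θ ^ 3) * (R ^ 2 + (ε ^ 2 * R⁻¹)⁻¹ * (ε ^ 2 * R)) + 2 * (K * s ^ 7) ^ 3 * (δ ^ 3 * R ^ 8)) =
        2 * K ^ 3 * s ^ 21 * δ ^ 3 * R ^ 8 := by field_simp; ring
      have : 0 ≤ 2 * K ^ 3 * s ^ 21 * δ ^ 3 * R ^ 8 := by positivity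
      linarith

lemma oint {X : Type*} [MeasurableSpace X] {μ : Measure X} (f : X → ℝ) :
    oR (∫ x, f x ∂μ) ≤ ∫⁻ x, oR (f x) ∂μ := by
  by_cases hf : Integrable f μ
  · have h1 : ∫ x, f x ∂μ ≤ ∫ x, max (f x) 0 ∂μ := integral_mono hf hf.pos_part fun x => le_max_left _ _
    refine (ofReal_le_ofReal h1).trans ?_
    rw [ofReal_integral_eq_lintegral_ofReal hf.pos_part (ae_of_all _ fun x => le_max_right _ _)]
    refine lintegral_mono fun x => ?_
    rw [ofReal_max, ofReal_zero]; exact max_le le_rfl bot_le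
  · rw [integral_undef hf]; simp

lemma comp_le (a : E3) (i : Fin 3) : |a i| ≤ ‖a‖ :=
  abs_le_of_sq_le_sq (by simpa using comp_sq_le a i) (norm_nonneg a)

lemma flux {u : E3 → E3} {p : E3 → ℝ} (mu : Measurable u) (mp : Measurable p) {Ω : Set E3}
    {xo : E3} {r M : ℝ} (hr : 0 < r) (hM : 0 ≤ M) {w : E3 → Fin 3 → ℝ} (mw : ∀ i, Measurable fun x => w x i)
    (hw : ∀ x i, |w x i| ≤ M) (hw0 : ∀ x i, x ∉ ball xo r → w x i = 0)
    (hI : IntegrableOn (fun x => ∑ i, u x i * w x i) Ω) (hz : ∫ x in Ω, ∑ i, u x i * w x i = 0) :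
    oR (3 * M / (bb * r ^ 3)) * Tn u p xo r = ⊤ ∨
    (IntegrableOn (fun x => (‖u x‖ ^ 2 + 2 * p x) * ∑ i, u x i * w x i) Ω ∧
      oR (∫ x in Ω, (‖u x‖ ^ 2 + 2 * p x) * ∑ i, u x i * w x i) ≤
        oR (3 * M / (bb * r ^ 3)) * Tn u p xo r) := by
  have hb := bb_pos
  rcases hM.eq_or_lt with h0 | hM0
  · right
    have : ∀ x i, w x i = 0 := fun x i => by have := hw x i; rw [← h0] at this; exact abs_nonpos_iff.1 this
    simp [this]
  by_cases hT : Tn u p xo r = ⊤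
  · left
    rw [hT, ENNReal.mul_top]
    simp only [ne_eq, ofReal_eq_zero, not_le]; positivity
  right
  obtain ⟨q, hq⟩ : ∃ q : E3 → ℝ, q = fun x => ‖u x‖ ^ 2 + 2 * p x := ⟨_, rfl⟩
  have mq : Measurable q := by rw [hq]; exact (mu.norm.pow_const 2).add (mp.const_mul 2)
  have hmm : Measurable fun z : E3 × E3 => ‖q z.2 - q z.1‖ₑ * ‖u z.2‖ₑ :=
    ((mq.comp measurable_snd).sub (mq.comp measurable_fst)).enorm.mul (mu.comp measurable_snd).enorm
  obtain ⟨y, hy⟩ := good_pt xo r hr (g := fun y => ∫⁻ x in ball xo r, ‖q x - q y‖ₑ * ‖u x‖ₑ) hmm.lintegral_prod_right'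
  rw [lintegral_lintegral_swap hmm.aemeasurable] at hy
  have hTn : Tn u p xo r = ∫⁻ x in ball xo r, ∫⁻ y in ball xo r, ‖q x - q y‖ₑ * ‖u x‖ₑ := by rw [hq]; rfl
  rw [← hTn] at hy
  obtain ⟨S, hS⟩ : ∃ S : E3 → ℝ, S = fun x => ∑ i, u x i * w x i := ⟨_, rfl⟩
  have mS : Measurable S := by
    rw [hS]; exact Finset.measurable_fun_sum _ fun i _ => (mcomp mu i).mul (mw i)
  have hSb : ∀ x, |S x| ≤ 3 * M * ‖u x‖ := by
    intro x
    rw [hS]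
    refine (Finset.abs_sum_le_sum_abs _ _).trans ?_
    calc ∑ i, |u x i * w x i| ≤ ∑ _i : Fin 3, ‖u x‖ * M := Finset.sum_le_sum fun i _ => by
          rw [abs_mul]; exact mul_le_mul (comp_le _ _) (hw x i) (abs_nonneg _) (norm_nonneg _)
      _ = _ := by simp; ring
  have hS0 : ∀ x, x ∉ ball xo r → S x = 0 := fun x hx => by rw [hS]; simp [hw0 x _ hx]
  have key : ∫⁻ x in Ω, ‖(q x - q y) * S x‖ₑ ≤ oR (3 * M / (bb * r ^ 3)) * Tn u p xo r := by
    calc ∫⁻ x in Ω, ‖(q x - q y) * S x‖ₑ ≤ ∫⁻ x, (ball xo r).indicator (fun x => oR (3 * M) * (‖q x - q y‖ₑ * ‖u x‖ₑ)) x := by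
          refine (setLIntegral_le_lintegral _ _).trans (lintegral_mono fun x => ?_)
          by_cases hx : x ∈ ball xo r
          · rw [indicator_of_mem hx, enorm_mul]
            calc ‖q x - q y‖ₑ * ‖S x‖ₑ ≤ ‖q x - q y‖ₑ * (oR (3 * M) * ‖u x‖ₑ) := by
                  refine mul_le_mul' le_rfl ?_
                  rw [← ofReal_norm, ← ofReal_norm, ← ofReal_mul pz]
                  exact ofReal_le_ofReal (hSb x)
              _ = _ := by ring
          · rw [indicator_of_notMem hx, hS0 x hx]; simp
      _ = oR (3 * M) * ∫⁻ x in ball xo r, ‖q x - q y‖ₑ * ‖u x‖ₑ := by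
          rw [lintegral_indicator measurableSet_ball, lintegral_const_mul' _ _ ofReal_ne_top]
      _ = oR (3 * M / (bb * r ^ 3)) * (oR (bb * r ^ 3) * ∫⁻ x in ball xo r, ‖q x - q y‖ₑ * ‖u x‖ₑ) := by
          rw [← mul_assoc, ← ofReal_mul pz, div_mul_cancel₀ _ pz]
      _ ≤ _ := mul_le_mul' le_rfl hy
  have hi1 : IntegrableOn (fun x => (q x - q y) * S x) Ω :=
    ⟨((mq.sub_const _).mul mS).aestronglyMeasurable, key.trans_lt (ENNReal.mul_lt_top ofReal_lt_top (lt_top_iff_ne_top.2 hT))⟩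
  have hi2 : IntegrableOn (fun x => q y * S x) Ω := by rw [hS]; exact hI.const_mul _
  have e : (fun x => (‖u x‖ ^ 2 + 2 * p x) * ∑ i, u x i * w x i) = fun x => (q x - q y) * S x + q y * S x := by
    funext x; rw [hq, hS]; ring
  rw [e]
  refine ⟨hi1.add hi2, ?_⟩
  have hz2 : ∫ x in Ω, q y * S x = 0 := by rw [integral_const_mul, hS, hz, mul_zero]
  rw [integral_add hi1 hi2, hz2, add_zero]
  exact (oint _).trans ((lintegral_mono fun x => Real.ofReal_le_enorm _).trans key)

lemma slice_en {u : E3 → E3} {p : E3 → ℝ} (mu : Measurable u) (mp : Measurable p) {Ω : Set E3}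
    {xo : E3} {R L : ℝ} (hL : 0 ≤ L) {P : E3 → ℝ} (hP : ∀ x, P x ≤ L) (hP0 : ∀ x, x ∉ ball xo R → P x ≤ 0)
    (hPi : IntegrableOn (fun x => ‖u x‖ ^ 2 * P x) Ω) {m : ℕ}
    {r M : ℕ → ℝ} (hr : ∀ k, 0 < r k) (hM : ∀ k, 0 ≤ M k) {w : ℕ → E3 → Fin 3 → ℝ} (mw : ∀ k i, Measurable fun x => w k x i)
    (hw : ∀ k x i, |w k x i| ≤ M k) (hw0 : ∀ k x i, x ∉ ball xo (r k) → w k x i = 0)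
    (hI : ∀ k, IntegrableOn (fun x => ∑ i, u x i * w k x i) Ω) (hz : ∀ k, ∫ x in Ω, ∑ i, u x i * w k x i = 0) :
    oR (∫ x in Ω, (‖u x‖ ^ 2 * P x + (‖u x‖ ^ 2 + 2 * p x) * ∑ i, u x i * ∑ k ∈ Finset.range m, w k x i)) ≤
      oR L * Vn u xo R + ∑ k ∈ Finset.range m, oR (3 * M k / (bb * r k ^ 3)) * Tn u p xo (r k) := by
  have hf := fun k => flux mu mp (hr k) (hM k) (mw k) (hw k) (hw0 k) (hI k) (hz k)
  by_cases hT : ∃ k ∈ Finset.range m, oR (3 * M k / (bb * r k ^ 3)) * Tn u p xo (r k) = ⊤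
  · have := ENNReal.sum_eq_top.2 hT
    rw [this, add_top]; exact le_top
  push Not at hT
  have hf2 := fun k hk => (hf k).resolve_left (hT k hk)
  have e : ∀ x, (‖u x‖ ^ 2 + 2 * p x) * ∑ i, u x i * ∑ k ∈ Finset.range m, w k x i =
      ∑ k ∈ Finset.range m, (‖u x‖ ^ 2 + 2 * p x) * ∑ i, u x i * w k x i := by
    intro x
    rw [← Finset.mul_sum]
    simp only [Finset.mul_sum]
    rw [Finset.sum_comm]
  have hint : IntegrableOn (fun x => ∑ k ∈ Finset.range m, (‖u x‖ ^ 2 + 2 * p x) * ∑ i, u x i * w k x i) Ω :=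
    integrable_finsetSum _ fun k hk => (hf2 k hk).1
  simp only [e]
  rw [integral_add hPi hint, integral_finsetSum _ fun k hk => (hf2 k hk).1]
  refine ofReal_add_le.trans (add_le_add ?_ ?_)
  · refine (oint _).trans ?_
    calc ∫⁻ x in Ω, oR (‖u x‖ ^ 2 * P x) ≤ ∫⁻ x, (ball xo R).indicator (fun x => oR L * ‖u x‖ₑ ^ 2) x := by
          refine (setLIntegral_le_lintegral _ _).trans (lintegral_mono fun x => ?_)
          by_cases hx : x ∈ ball xo R
          · rw [indicator_of_mem hx, ← ofReal_norm, ← ofReal_pow (norm_nonneg _), ← ofReal_mul hL]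
            exact ofReal_le_ofReal (by nlinarith [hP x, sq_nonneg ‖u x‖])
          · rw [indicator_of_notMem hx, ofReal_of_nonpos]
            nlinarith [hP0 x hx, sq_nonneg ‖u x‖]
      _ = _ := by rw [lintegral_indicator measurableSet_ball, lintegral_const_mul' _ _ ofReal_ne_top]; rfl
  · clear hint e
    have : ∀ s : Finset ℕ, s ⊆ Finset.range m → oR (∑ k ∈ s, ∫ x in Ω, (‖u x‖ ^ 2 + 2 * p x) * ∑ i, u x i * w k x i) ≤
        ∑ k ∈ s, oR (3 * M k / (bb * r k ^ 3)) * Tn u p xo (r k) := by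
      intro s hs
      induction s using Finset.induction_on with
      | empty => simp
      | insert a s ha ih =>
        rw [Finset.sum_insert ha, Finset.sum_insert ha]
        exact ofReal_add_le.trans (add_le_add (hf2 a (hs (Finset.mem_insert_self _ _))).2
          (ih ((Finset.subset_insert _ _).trans hs)))
    exact this _ subset_rfl

lemma Vt_meas {v : ET → E3} (mv : Measurable v) (xo : E3) (R : ℝ) : Measurable (Vt v xo R) := by
  unfold Vt Vn
  have : Measurable fun q : ℝ × E3 => ‖v (q.2, q.1)‖ₑ ^ 2 := (mv.comp measurable_swap).enorm.pow_const 2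
  exact this.lintegral_prod_right'

lemma Tt_meas {v : ET → E3} {p : ET → ℝ} (mv : Measurable v) (mp : Measurable p) (xo : E3) (R : ℝ) :
    Measurable (Tt v p xo R) := by
  unfold Tt Tn
  have mq : Measurable fun z => ‖v z‖ ^ 2 + 2 * p z := (mv.norm.pow_const 2).add (mp.const_mul 2)
  have h1 : Measurable fun q : (ℝ × E3) × E3 => (q.1.2, q.1.1) := measurable_swap.comp measurable_fst
  have h2 : Measurable fun q : (ℝ × E3) × E3 => (q.2, q.1.1) := measurable_snd.prodMk (measurable_fst.comp measurable_fst)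
  have : Measurable fun q : (ℝ × E3) × E3 =>
      ‖(‖v (q.1.2, q.1.1)‖ ^ 2 + 2 * p (q.1.2, q.1.1)) - (‖v (q.2, q.1.1)‖ ^ 2 + 2 * p (q.2, q.1.1))‖ₑ * ‖v (q.1.2, q.1.1)‖ₑ :=
    ((mq.comp h1).sub (mq.comp h2)).enorm.mul (mv.comp h1).enorm
  have h3 : Measurable fun q : ℝ × E3 => ∫⁻ y in ball xo R,
      ‖(‖v (q.2, q.1)‖ ^ 2 + 2 * p (q.2, q.1)) - (‖v (y, q.1)‖ ^ 2 + 2 * p (y, q.1))‖ₑ * ‖v (q.2, q.1)‖ₑ :=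
    this.lintegral_prod_right'
  exact h3.lintegral_prod_right'

lemma tdz_smooth {φ : ET → ℝ} (hφ : CD φ) : CD (tdz φ) :=
  (hφ.fderiv_right (by simp)).clm_apply contDiff_const

lemma tdz_cs {φ : ET → ℝ} (hφ : HasCompactSupport φ) : HasCompactSupport (tdz φ) :=
  HasCompactSupport.fderiv_apply ℝ hφ _

def Pop (φ : ET → ℝ) (z : ET) : ℝ := tdz φ z + ∑ i, sdz (fun w => sdz φ i w) i z

lemma Pop_cont {φ : ET → ℝ} (hφ : CD φ) : Continuous (Pop φ) :=
  (tdz_smooth hφ).continuous.add (continuous_finsetSum _ fun i _ => (sdz_smooth (sdz_smooth hφ i) i).continuous)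

lemma Pop_cs {φ : ET → ℝ} (hφ : HasCompactSupport φ) : HasCompactSupport (Pop φ) := by
  have h : ∀ i, HasCompactSupport (sdz (fun w => sdz φ i w) i) := fun i => sdz_cs (sdz_cs hφ i) i
  have e : Pop φ = fun z => tdz φ z + (sdz (fun w => sdz φ 0 w) 0 z + sdz (fun w => sdz φ 1 w) 1 z + sdz (fun w => sdz φ 2 w) 2 z) := by
    funext z; simp only [Pop, Fin.sum_univ_three]
  rw [e]
  exact (tdz_cs hφ).add (((h 0).add (h 1)).add (h 2))

lemma lind {f : ℝ → ℝ≥0∞} {s : Set ℝ} {W : Set ℝ} (hW : MeasurableSet W) (c : ℝ) :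
    ∫⁻ t in s, W.indicator (fun t => oR c * f t) t ≤ oR c * ∫⁻ t in W, f t := by
  refine (setLIntegral_le_lintegral _ _).trans ?_
  rw [lintegral_indicator hW, lintegral_const_mul' _ _ ofReal_ne_top]

structure Tst (Ω : Set E3) (T : ℝ) (φ : ET → ℝ) : Prop where
  sm : CD φ
  cs : HasCompactSupport φ
  su : tsupport φ ⊆ Ω ×ˢ Ioo 0 T

lemma en_rhs {Ω T v Dv p v₀} (hs : IsSuitableWeakSolution Ω T v Dv p v₀) {xo : E3} {tq R L : ℝ}
    (hL : 0 ≤ L) {m : ℕ} {r M : ℕ → ℝ} (hr : ∀ k, 0 < r k) (hM : ∀ k, 0 ≤ M k) {φ : ET → ℝ} {ψ : ℕ → ET → ℝ}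
    (hφ : Tst Ω T φ) (hψ : ∀ k, Tst Ω T (ψ k)) (hsum : ∀ i z, sdz φ i z = ∑ k ∈ Finset.range m, sdz (ψ k) i z)
    (hM1 : ∀ k x t i, t < tq → |sdz (ψ k) i (x, t)| ≤ M k)
    (hM0 : ∀ k x t i, t < tq → (x ∉ ball xo (r k) ∨ t ≤ tq - (2 * r k) ^ 2) → sdz (ψ k) i (x, t) = 0)
    (hP : ∀ x t, t < tq → Pop φ (x, t) ≤ L)
    (hP0 : ∀ x t, t < tq → (x ∉ ball xo R ∨ t ≤ tq - R ^ 2) → Pop φ (x, t) ≤ 0) {t₁ : ℝ} (ht₁ : t₁ < tq) (hT₁ : t₁ ≤ T) :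
    oR (∫ z in Ω ×ˢ Ioo 0 t₁, (‖v z‖ ^ 2 * Pop φ z + (‖v z‖ ^ 2 + 2 * p z) * ∑ i, v z i * sdz φ i z)) ≤
      oR L * (∫⁻ t in Ioo (tq - R ^ 2) tq, Vt v xo R t) + ∑ k ∈ Finset.range m,
        oR (3 * M k / (bb * r k ^ 3)) * ∫⁻ t in Ioo (tq - (2 * r k) ^ 2) tq, Tt v p xo (r k) t := by
  have hb := bb_pos
  by_cases hF : IntegrableOn (fun z => ‖v z‖ ^ 2 * Pop φ z + (‖v z‖ ^ 2 + 2 * p z) * ∑ i, v z i * sdz φ i z) (Ω ×ˢ Ioo 0 t₁)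
  swap
  · rw [integral_undef hF]; simp
  rw [IntegrableOn, prodm] at hF
  rw [prodm, integral_prod_symm _ hF]
  refine (oint _).trans ?_
  have hsub : Ioo 0 t₁ ⊆ Ioo 0 T := Ioo_subset_Ioo_right hT₁
  have i1 : IntegrableOn (fun z => ‖v z‖ ^ 2 * Pop φ z) (Ω ×ˢ Ioo 0 T) := by
    refine dom_int (hs.meas_v.norm.pow_const 2) hs.v_l2_w12 (fun z => ?_) (Pop_cont hφ.sm) (Pop_cs hφ.cs) (cs_int (Pop_cont hφ.sm) (Pop_cs hφ.cs) _)
    have : 0 ≤ ∑ i, ∑ j, (Dv z i j) ^ 2 := by positivity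
    rw [abs_of_nonneg pz]; linarith
  have i2 : ∀ k, IntegrableOn (fun z => ∑ i, v z i * sdz (ψ k) i z) (Ω ×ˢ Ioo 0 T) := fun k =>
    integrable_finsetSum _ fun i _ => (int_fam hs.meas_v hs.meas_Dv hs.v_l2_w12 (sdz_smooth (hψ k).sm i).continuous
      (sdz_cs (hψ k).cs i) (cs_int (sdz_smooth (hψ k).sm i).continuous (sdz_cs (hψ k).cs i) _)).1 i
  rw [IntegrableOn, prodm] at i1
  simp only [IntegrableOn, prodm] at i2
  have a2 := ae_all_iff.2 fun k => (i2 k).prod_left_ae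
  have a3 := ae_all_iff.2 fun k => div_slice hs (hψ k).sm (hψ k).cs (hψ k).su
  have hpt : ∀ᵐ t ∂(volume.restrict (Ioo 0 t₁)), oR (∫ x in Ω, (‖v (x, t)‖ ^ 2 * Pop φ (x, t) +
      (‖v (x, t)‖ ^ 2 + 2 * p (x, t)) * ∑ i, v (x, t) i * sdz φ i (x, t))) ≤
      (Ioo (tq - R ^ 2) tq).indicator (fun t => oR L * Vt v xo R t) t + ∑ k ∈ Finset.range m,
        (Ioo (tq - (2 * r k) ^ 2) tq).indicator (fun t => oR (3 * M k / (bb * r k ^ 3)) * Tt v p xo (r k) t) t := by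
    filter_upwards [ae_restrict_of_ae_restrict_of_subset hsub i1.prod_left_ae, ae_restrict_of_ae_restrict_of_subset hsub a2,
      ae_restrict_of_ae_restrict_of_subset hsub a3, ae_restrict_mem measurableSet_Ioo] with t h1 h2 h3 ht
    have ht0 : t < tq := ht.2.trans ht₁
    simp only [hsum]
    classical
    refine (slice_en (xo := xo) (R := R) (L := if t ∈ Ioo (tq - R ^ 2) tq then L else 0) (P := fun x => Pop φ (x, t)) (r := r)
      (M := fun k => if t ∈ Ioo (tq - (2 * r k) ^ 2) tq then M k else 0) (w := fun k x i => sdz (ψ k) i (x, t))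
      (hs.meas_v.comp measurable_prodMk_right) (hs.meas_p.comp measurable_prodMk_right) ?_ ?_ ?_ h1 hr ?_ ?_ ?_ ?_ h2 h3).trans ?_
    · split_ifs <;> linarith
    · intro x
      split_ifs with hh
      · exact hP x t ht0
      · exact hP0 x t ht0 (Or.inr (by by_contra h; exact hh ⟨not_le.1 h, ht0⟩))
    · intro x hx; exact hP0 x t ht0 (Or.inl hx)
    · intro k; split_ifs; exacts [hM k, le_rfl]
    · intro k i
      exact (sdz_smooth (hψ k).sm i).continuous.measurable.comp measurable_prodMk_right
    · intro k x i
      split_ifs with hh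
      · exact hM1 k x t i ht0
      · rw [hM0 k x t i ht0 (Or.inr (by by_contra h; exact hh ⟨not_le.1 h, ht0⟩)), abs_zero]
    · intro k x i hx; exact hM0 k x t i ht0 (Or.inl hx)
    · refine add_le_add ?_ (Finset.sum_le_sum fun k _ => ?_)
      · by_cases hh : t ∈ Ioo (tq - R ^ 2) tq
        · rw [if_pos hh, indicator_of_mem hh]; rfl
        · rw [if_neg hh]; simp
      · by_cases hh : t ∈ Ioo (tq - (2 * r k) ^ 2) tq
        · rw [if_pos hh, indicator_of_mem hh]; rfl
        · rw [if_neg hh]; simp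
  refine (lintegral_mono_ae hpt).trans ?_
  rw [lintegral_add_left (((Vt_meas hs.meas_v xo R).const_mul _).indicator measurableSet_Ioo),
    lintegral_finsetSum _ fun k _ => (((Tt_meas hs.meas_v hs.meas_p xo (r k)).const_mul _).indicator measurableSet_Ioo)]
  exact add_le_add (lind measurableSet_Ioo _) (Finset.sum_le_sum fun k _ => lind measurableSet_Ioo _)

lemma en_time {Ω T v Dv p v₀} (hs : IsSuitableWeakSolution Ω T v Dv p v₀) {φ : ET → ℝ}
    (hφ : Tst Ω T φ) (h0 : ∀ z, 0 ≤ φ z) {tq : ℝ} {B : ℝ≥0∞} (hB : ∀ t₁ < tq, t₁ ≤ T →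
      oR (∫ z in Ω ×ˢ Ioo 0 t₁, (‖v z‖ ^ 2 * Pop φ z + (‖v z‖ ^ 2 + 2 * p z) * ∑ i, v z i * sdz φ i z)) ≤ B) :
    ∀ᵐ t₁ ∂(volume.restrict (Ioo 0 T)), t₁ < tq →
      (∫⁻ x in Ω, ‖v (x, t₁)‖ₑ ^ 2 * oR (φ (x, t₁)) ≤ B ∧
      ∫⁻ z in Ω ×ˢ Ioo 0 t₁, oR (∑ i, ∑ j, (Dv z i j) ^ 2) * oR (φ z) ≤ B) := by
  have hD0 : ∀ z, 0 ≤ ∑ i, ∑ j, (Dv z i j) ^ 2 := fun z => by positivity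
  have gi := cs_int (μ := volume) hφ.sm.continuous hφ.cs (Ω ×ˢ Ioo 0 T)
  have i1 : IntegrableOn (fun z => ‖v z‖ ^ 2 * φ z) (Ω ×ˢ Ioo 0 T) := by
    refine dom_int (hs.meas_v.norm.pow_const 2) hs.v_l2_w12 (fun z => ?_) hφ.sm.continuous hφ.cs gi
    rw [abs_of_nonneg pz]; linarith [hD0 z]
  have i2 : IntegrableOn (fun z => (∑ i, ∑ j, (Dv z i j) ^ 2) * φ z) (Ω ×ˢ Ioo 0 T) := by
    refine dom_int ?_ hs.v_l2_w12 (fun z => ?_) hφ.sm.continuous hφ.cs gi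
    · exact Finset.measurable_fun_sum _ fun i _ => Finset.measurable_fun_sum _ fun j _ => (mDcomp hs.meas_Dv i j).pow_const 2
    · rw [abs_of_nonneg (hD0 z)]; linarith [sq_nonneg ‖v z‖]
  rw [IntegrableOn, prodm] at i1
  filter_upwards [hs.local_energy, i1.prod_left_ae, ae_restrict_mem measurableSet_Ioo] with t₁ he h1 ht hlt
  have h := he φ hφ.sm hφ.cs hφ.su h0
  have h2 := hB t₁ hlt ht.2.le
  have i3 : IntegrableOn (fun z => (∑ i, ∑ j, (Dv z i j) ^ 2) * φ z) (Ω ×ˢ Ioo 0 t₁) :=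
    i2.mono_set (prod_mono_right (Ioo_subset_Ioo_right ht.2.le))
  have n1 : 0 ≤ ∫ x in Ω, ‖v (x, t₁)‖ ^ 2 * φ (x, t₁) := integral_nonneg fun x => mul_nonneg pz (h0 _)
  have n2 : 0 ≤ ∫ z in Ω ×ˢ Ioo 0 t₁, (∑ i, ∑ j, (Dv z i j) ^ 2) * φ z := integral_nonneg fun z => mul_nonneg (hD0 z) (h0 _)
  have m1 := le_add_of_nonneg_right (a := ∫ x in Ω, ‖v (x, t₁)‖ ^ 2 * φ (x, t₁)) (mul_nonneg zero_le_two n2)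
  have m2 := le_add_of_nonneg_of_le n1 (le_mul_of_one_le_left n2 one_le_two)
  constructor
  · refine le_trans (le_of_eq ?_) ((ofReal_le_ofReal (le_trans m1 h)).trans h2)
    rw [ofReal_integral_eq_lintegral_ofReal h1 (ae_of_all _ fun x => mul_nonneg pz (h0 _))]
    refine lintegral_congr fun x => ?_
    rw [ofReal_mul pz, ofReal_pow (norm_nonneg _), ofReal_norm]
  · refine le_trans (le_of_eq ?_) ((ofReal_le_ofReal (le_trans m2 h)).trans h2)
    rw [ofReal_integral_eq_lintegral_ofReal i3 (ae_of_all _ fun x => mul_nonneg (hD0 _) (h0 _))]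
    exact lintegral_congr fun x => (ofReal_mul (hD0 _)).symm

structure Cut (C : ℝ) (xo : E3) (tq R : ℝ) (χ : ET → ℝ) : Prop where
  sm : CD χ
  nn : ∀ z, 0 ≤ χ z
  le : ∀ z, χ z ≤ 1
  su : tsupport χ ⊆ closedBall xo (2 / 5 * R) ×ˢ Icc (tq - R ^ 2 / 4) (tq + R ^ 2 / 4)
  one : ∀ x t, dist x xo < R / 4 → |t - tq| < R ^ 2 / 16 → χ (x, t) = 1
  d1 : ∀ i z, |sdz χ i z| ≤ C / R
  d2 : ∀ z, |Pop χ z| ≤ C / R ^ 2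

lemma loc_const {χ : ET → ℝ} {z : ET} {c : ℝ} (h : χ =ᶠ[𝓝 z] fun _ => c) : (∀ i, sdz χ i z = 0) ∧ Pop χ z = 0 := by
  have h1 : ∀ i, sdz χ i =ᶠ[𝓝 z] fun _ => 0 := by
    intro i
    filter_upwards [h.eventuallyEq_nhds] with w hw
    rw [sdz, hw.fderiv_eq]; simp
  refine ⟨fun i => (h1 i).eq_of_nhds, ?_⟩
  have h2 : ∀ i, sdz (fun w => sdz χ i w) i z = 0 := fun i => by
    have := (h1 i).fderiv_eq (𝕜 := ℝ)
    rw [sdz, show (fun w => sdz χ i w) = sdz χ i from rfl, this]; simp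
  rw [Pop, Finset.sum_eq_zero fun i _ => h2 i, tdz, h.fderiv_eq]; simp

lemma Cut.z {C : ℝ} {xo : E3} {tq R : ℝ} {χ : ET → ℝ} (h : Cut C xo tq R χ) {x : E3} {t : ℝ}
    (hx : dist x xo < R / 4) (ht : |t - tq| < R ^ 2 / 16) : (∀ i, sdz χ i (x, t) = 0) ∧ Pop χ (x, t) = 0 := by
  apply loc_const (c := 1)
  have o1 : IsOpen {z : ET | dist z.1 xo < R / 4 ∧ |z.2 - tq| < R ^ 2 / 16} :=
    (isOpen_lt (f := fun z : ET => dist z.1 xo) (by fun_prop) continuous_const).inter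
      (isOpen_lt (f := fun z : ET => |z.2 - tq|) (by fun_prop) continuous_const)
  filter_upwards [o1.mem_nhds (show (x, t) ∈ _ from ⟨hx, ht⟩)] with w hw
  exact h.one w.1 w.2 hw.1 hw.2

def scm (b : ℝ) (xo : E3) (tq : ℝ) (z : ET) : ET := (b • (z.1 - xo), b ^ 2 * (z.2 - tq))

lemma scm_smooth (b : ℝ) (xo : E3) (tq : ℝ) : CD (scm b xo tq) := by
  unfold scm; fun_prop

lemma scm_der (b : ℝ) (xo : E3) (tq : ℝ) (z : ET) : HasFDerivAt (scm b xo tq)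
    ((b • ContinuousLinearMap.fst ℝ E3 ℝ).prod (b ^ 2 • ContinuousLinearMap.snd ℝ E3 ℝ)) z :=
  HasFDerivAt.prodMk ((hasFDerivAt_fst.sub_const xo).const_smul b) ((hasFDerivAt_snd.sub_const tq).const_mul (b ^ 2))

lemma sdz_scm {f : ET → ℝ} (hf : CD f) (b : ℝ) (xo : E3) (tq : ℝ) (i : Fin 3) (z : ET) :
    sdz (fun w => f (scm b xo tq w)) i z = b * sdz f i (scm b xo tq z) := by
  have h := ((hf.differentiable (by simp)) (scm b xo tq z)).hasFDerivAt.comp z (scm_der b xo tq z)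
  have h' : HasFDerivAt (fun w => f (scm b xo tq w)) _ z := h
  rw [sdz, h'.fderiv, sdz, ← smul_eq_mul, ← map_smul]
  simp

lemma tdz_scm {f : ET → ℝ} (hf : CD f) (b : ℝ) (xo : E3) (tq : ℝ) (z : ET) :
    tdz (fun w => f (scm b xo tq w)) z = b ^ 2 * tdz f (scm b xo tq z) := by
  have h := ((hf.differentiable (by simp)) (scm b xo tq z)).hasFDerivAt.comp z (scm_der b xo tq z)
  have h' : HasFDerivAt (fun w => f (scm b xo tq w)) _ z := h
  rw [tdz, h'.fderiv, tdz, ← smul_eq_mul, ← map_smul]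
  simp

lemma Pop_scm {f : ET → ℝ} (hf : CD f) (b : ℝ) (xo : E3) (tq : ℝ) (z : ET) :
    Pop (fun w => f (scm b xo tq w)) z = b ^ 2 * Pop f (scm b xo tq z) := by
  have h : ∀ i, sdz (fun w => sdz (fun w => f (scm b xo tq w)) i w) i z = b ^ 2 * sdz (fun w => sdz f i w) i (scm b xo tq z) := by
    intro i
    have e : (fun w => sdz (fun w => f (scm b xo tq w)) i w) = fun w => (fun y => b * sdz f i y) (scm b xo tq w) := by
      funext w; exact sdz_scm hf b xo tq i w
    rw [e, sdz_scm (contDiff_const.mul (sdz_smooth hf i))]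
    have h2 := (((sdz_smooth hf i).differentiable (by simp)) (scm b xo tq z)).hasFDerivAt.const_mul b
    rw [sdz, h2.fderiv]
    simp only [ContinuousLinearMap.smul_apply, smul_eq_mul]
    rw [← mul_assoc, ← sq]; rfl
  simp only [Pop, h, tdz_scm hf, ← Finset.mul_sum]
  ring

lemma cut_exists : ∃ C : ℝ, 0 < C ∧ ∀ (xo : E3) (tq R : ℝ), 0 < R → ∃ χ, Cut C xo tq R χ := by
  let B : ContDiffBump (0 : E3) := ⟨1 / 4, 2 / 5, by norm_num, by norm_num⟩
  let τ : ContDiffBump (0 : ℝ) := ⟨1 / 16, 1 / 4, by norm_num, by norm_num⟩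
  obtain ⟨f, hf⟩ : ∃ f : ET → ℝ, f = fun z => τ z.2 * B z.1 := ⟨_, rfl⟩
  have sm : CD f := by
    rw [hf]; exact (τ.contDiff.comp contDiff_snd).mul (B.contDiff.comp contDiff_fst)
  have su : tsupport f ⊆ closedBall 0 (2 / 5) ×ˢ closedBall 0 (1 / 4) := by
    rw [hf]; refine tens_tsupp.trans ?_
    rw [B.tsupport_eq, τ.tsupport_eq]
  have cs : HasCompactSupport f :=
    IsCompact.of_isClosed_subset ((isCompact_closedBall _ _).prod (isCompact_closedBall _ _)) (isClosed_tsupport f) su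
  have hs := fun i => (sdz_smooth sm i).continuous.bounded_above_of_compact_support (sdz_cs cs i)
  choose c hc using hs
  obtain ⟨d, hd⟩ := (Pop_cont sm).bounded_above_of_compact_support (Pop_cs cs)
  refine ⟨|c 0| + |c 1| + |c 2| + |d| + 1, by positivity, fun xo tq R hR => ⟨fun z => f (scm R⁻¹ xo tq z), ?_⟩⟩
  have hn : ∀ w : E3, ‖R⁻¹ • w‖ = R⁻¹ * ‖w‖ := fun w => by rw [norm_smul, Real.norm_of_nonneg pz]
  refine ⟨sm.comp (scm_smooth _ _ _), fun z => ?_, fun z => ?_, ?_, fun x t hx ht => ?_, fun i z => ?_, fun z => ?_⟩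
  · rw [hf]; exact mul_nonneg τ.nonneg B.nonneg
  · rw [hf]; exact mul_le_one₀ τ.le_one B.nonneg B.le_one
  · refine (tsupport_comp_subset_preimage f (scm_smooth _ _ _).continuous).trans fun z hz => ?_
    obtain ⟨h1, h2⟩ := su hz
    simp only [scm, mem_closedBall_zero_iff, hn, norm_mul, Real.norm_eq_abs] at h1 h2
    rw [abs_of_nonneg (show 0 ≤ R⁻¹ ^ 2 by positivity)] at h2
    rw [inv_mul_le_iff₀ hR] at h1
    rw [inv_pow, inv_mul_le_iff₀ pz] at h2
    have := abs_le.1 h2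
    refine ⟨?_, ?_, ?_⟩
    · rw [mem_closedBall, dist_eq_norm]; linarith
    · linarith
    · linarith
  · rw [hf, scm]
    dsimp only
    rw [B.one_of_mem_closedBall, τ.one_of_mem_closedBall, mul_one]
    · rw [mem_closedBall_zero_iff, norm_mul, Real.norm_of_nonneg pz, Real.norm_eq_abs, inv_pow, inv_mul_le_iff₀ pz]
      exact ht.le.trans (le_of_eq (by ring))
    · rw [mem_closedBall_zero_iff, hn, inv_mul_le_iff₀ hR, ← dist_eq_norm]
      exact hx.le.trans (le_of_eq (by ring))
  · rw [sdz_scm sm, abs_mul, abs_of_nonneg pz, div_eq_inv_mul]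
    refine mul_le_mul_of_nonneg_left ((hc i _).trans ?_) pz
    have h3 : |c i| ≤ ∑ i, |c i| := Finset.single_le_sum (f := fun i => |c i|) (fun _ _ => abs_nonneg _) (Finset.mem_univ i)
    rw [Fin.sum_univ_three] at h3
    linarith [abs_nonneg d, le_abs_self (c i)]
  · rw [Pop_scm sm, abs_mul, abs_of_nonneg pz, div_eq_inv_mul, inv_pow]
    refine mul_le_mul_of_nonneg_left ((hd _).trans ?_) pz
    have := le_abs_self d
    have := abs_nonneg (c 0)
    have := abs_nonneg (c 1)
    have := abs_nonneg (c 2)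
    linarith

lemma sdz_line {f : ET → ℝ} (hf : CD f) {i : Fin 3} {z : ET} {d : ℝ}
    (h : HasDerivAt (fun s : ℝ => f (z.1 + s • ee i, z.2)) d 0) : sdz f i z = d := by
  have h1 : HasDerivAt (fun s : ℝ => (z.1 + s • ee i, z.2)) (ee i, (0:ℝ)) 0 := by
    have := ((hasDerivAt_id (0:ℝ)).smul_const (ee i)).const_add z.1
    rw [one_smul] at this
    exact this.prodMk (hasDerivAt_const _ _)
  have h2 : HasFDerivAt f (fderiv ℝ f z) ((fun s : ℝ => (z.1 + s • ee i, z.2)) 0) := by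
    simpa using ((hf.differentiable (by simp)) z).hasFDerivAt
  exact (h2.comp_hasDerivAt 0 h1).unique h

lemma tdz_line {f : ET → ℝ} (hf : CD f) {z : ET} {d : ℝ}
    (h : HasDerivAt (fun t : ℝ => f (z.1, t)) d z.2) : tdz f z = d := by
  have h1 : HasDerivAt (fun t : ℝ => (z.1, t)) ((0 : E3), (1:ℝ)) z.2 := (hasDerivAt_const _ _).prodMk (hasDerivAt_id _)
  have h2 : HasFDerivAt f (fderiv ℝ f z) ((fun t : ℝ => (z.1, t)) z.2) := ((hf.differentiable (by simp)) z).hasFDerivAt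
  exact (h2.comp_hasDerivAt z.2 h1).unique h

lemma norm_line (y : E3) (i : Fin 3) (s : ℝ) : ‖y + s • ee i‖ ^ 2 = ‖y‖ ^ 2 + 2 * y i * s + s ^ 2 := by
  rw [norm_add_sq_real, inner_smul_right, norm_smul]
  simp [ee, EuclideanSpace.inner_single_right]
  ring

def gg (s : ℝ) : ℝ := 1 / 2 + (s + 1 / 2) * Real.smoothTransition (2 * s + 1)

lemma gg_smooth : CD gg := by
  unfold gg
  have : CD fun s : ℝ => Real.smoothTransition (2 * s + 1) :=
    Real.smoothTransition.contDiff.comp (by fun_prop)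
  fun_prop

lemma gg_pos (s : ℝ) : 0 < gg s := by
  unfold gg
  rcases le_total (2 * s + 1) 0 with h | h
  · rw [Real.smoothTransition.zero_of_nonpos h]; norm_num
  · have := mul_nonneg (show 0 ≤ s + 1 / 2 by linarith) (Real.smoothTransition.nonneg (2 * s + 1))
    linarith

lemma gg_eq {s : ℝ} (hs : 0 ≤ s) : gg s = s + 1 := by
  rw [gg, Real.smoothTransition.one_of_one_le (by linarith)]; ring

def Gm (xo : E3) (σ : ℝ → ℝ) (z : ET) : ℝ := Real.exp (-(3 / 2) * Real.log (σ z.2) - ‖z.1 - xo‖ ^ 2 / (4 * σ z.2))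

structure Gs (xo : E3) (tq ρ : ℝ) (Γ : ET → ℝ) : Prop where
  sm : CD Γ
  pos : ∀ z, 0 < Γ z
  up : ∀ x t A, t < tq → 0 < A → (A ≤ dist x xo ∨ A ^ 2 ≤ tq - t + ρ ^ 2) →
    Γ (x, t) ≤ 400 / A ^ 3 ∧ ∀ i, |sdz Γ i (x, t)| ≤ 400 / A ^ 4
  heat : ∀ x t, t < tq → Pop Γ (x, t) = 0
  low : ∀ x t, dist x xo < ρ → tq - ρ ^ 2 < t → t < tq → 1 / (8 * ρ ^ 3) ≤ Γ (x, t)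

lemma Gm_sm {xo : E3} {σ : ℝ → ℝ} (hσ : CD σ) (hp : ∀ t, 0 < σ t) : CD (Gm xo σ) := by
  unfold Gm
  have h0 : ∀ z : ET, σ z.2 ≠ 0 := fun z => (hp z.2).ne'
  have h1 : CD fun z : ET => σ z.2 := hσ.comp contDiff_snd
  have h2 : CD fun z : ET => ‖z.1 - xo‖ ^ 2 := (contDiff_fst.sub contDiff_const).norm_sq ℝ
  exact ((contDiff_const.mul (h1.log h0)).sub (h2.div (contDiff_const.mul h1) fun z => mul_ne_zero four_ne_zero (h0 z))).exp

lemma Gm_sdz {xo : E3} {σ : ℝ → ℝ} (hσ : CD σ) (hp : ∀ t, 0 < σ t) (i : Fin 3) (z : ET) :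
    sdz (Gm xo σ) i z = Gm xo σ z * (-(z.1 i - xo i) / (2 * σ z.2)) := by
  apply sdz_line (Gm_sm hσ hp)
  have hs := (hp z.2).ne'
  have e : ∀ s : ℝ, z.1 + s • ee i - xo = (z.1 - xo) + s • ee i := fun s => by abel
  simp only [Gm, e, norm_line]
  have h1 : HasDerivAt (fun s : ℝ => ‖z.1 - xo‖ ^ 2 + 2 * (z.1 - xo) i * s + s ^ 2) (2 * (z.1 - xo) i) 0 := by
    have h0 : HasDerivAt (fun s : ℝ => s) 1 0 := hasDerivAt_id 0
    exact (((h0.const_mul (2 * (z.1 - xo) i)).const_add (‖z.1 - xo‖ ^ 2)).fun_add (h0.fun_pow 2)).congr_deriv (by simp)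
  have h2 := ((h1.div_const (4 * σ z.2)).const_sub (-(3 / 2) * Real.log (σ z.2))).exp
  refine h2.congr_deriv ?_
  rw [mul_zero, add_zero, zero_pow two_ne_zero, add_zero, PiLp.sub_apply]
  generalize Real.exp _ = E
  field_simp
  ring

lemma Gm_heat {xo : E3} {σ : ℝ → ℝ} (hσ : CD σ) (hp : ∀ t, 0 < σ t) (z : ET) (hd : HasDerivAt σ (-1) z.2) :
    Pop (Gm xo σ) z = 0 := by
  have hs := (hp z.2).ne'
  have sm := Gm_sm (xo := xo) hσ hp
  have h1 : tdz (Gm xo σ) z = Gm xo σ z * (3 / 2 / σ z.2 - ‖z.1 - xo‖ ^ 2 / (4 * σ z.2 ^ 2)) := by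
    apply tdz_line sm
    have h2 := (((hd.log hs).const_mul (-(3 / 2))).fun_sub ((hasDerivAt_const z.2 (‖z.1 - xo‖ ^ 2)).fun_div (hd.const_mul 4) (mul_ne_zero four_ne_zero hs))).exp
    refine h2.congr_deriv ?_
    rw [Gm]
    generalize Real.exp _ = E
    field_simp
    ring
  have h2 : ∀ i, sdz (fun w => sdz (Gm xo σ) i w) i z = Gm xo σ z * ((z.1 i - xo i) ^ 2 / (4 * σ z.2 ^ 2) - 1 / (2 * σ z.2)) := by
    intro i
    have e := funext (Gm_sdz (xo := xo) hσ hp i)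
    apply sdz_line (sdz_smooth sm i)
    have e2 : (fun s : ℝ => sdz (Gm xo σ) i (z.1 + s • ee i, z.2)) = fun s =>
        Gm xo σ (z.1 + s • ee i, z.2) * (-(z.1 i + s - xo i) / (2 * σ z.2)) := by
      funext s; rw [Gm_sdz hσ hp]; simp [ee]
    rw [e2]
    have h3 : HasDerivAt (fun s : ℝ => -(z.1 i + s - xo i) / (2 * σ z.2)) (-1 / (2 * σ z.2)) 0 :=
      (((hasDerivAt_id (0:ℝ)).const_add (z.1 i)).sub_const (xo i)).neg.div_const _
    have h4 : HasDerivAt (fun s : ℝ => Gm xo σ (z.1 + s • ee i, z.2)) (sdz (Gm xo σ) i z) 0 := by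
      have h1 : HasDerivAt (fun s : ℝ => (z.1 + s • ee i, z.2)) (ee i, (0:ℝ)) 0 := by
        have := ((hasDerivAt_id (0:ℝ)).smul_const (ee i)).const_add z.1
        rw [one_smul] at this
        exact this.prodMk (hasDerivAt_const _ _)
      have h2 : HasFDerivAt (Gm xo σ) (fderiv ℝ (Gm xo σ) z) ((fun s : ℝ => (z.1 + s • ee i, z.2)) 0) := by
        simpa using ((sm.differentiable (by simp)) z).hasFDerivAt
      exact h2.comp_hasDerivAt 0 h1
    refine (h4.fun_mul h3).congr_deriv ?_
    rw [Gm_sdz hσ hp, zero_smul, add_zero, add_zero]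
    generalize Gm xo σ _ = E
    field_simp
    ring
  have h3 : ‖z.1 - xo‖ ^ 2 = ∑ i, (z.1 i - xo i) ^ 2 := by
    rw [EuclideanSpace.norm_sq_eq]; simp
  rw [Pop, h1]
  simp only [h2]
  rw [h3, Fin.sum_univ_three, Fin.sum_univ_three]
  field_simp
  ring

lemma gauss_num {X : ℝ} (hX : 0 ≤ X) : Real.exp (-(X ^ 2 / 4)) * X ^ 3 ≤ 400 ∧ Real.exp (-(X ^ 2 / 4)) * X ^ 5 ≤ 400 ∧
    Real.exp (-(X ^ 2 / 4)) * X ≤ 400 := by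
  have h := Real.pow_div_factorial_le_exp (X ^ 2 / 4) pz 3
  have h1 := Real.one_le_exp (show 0 ≤ X ^ 2 / 4 by positivity)
  have h2 : X ^ 6 ≤ 384 * Real.exp (X ^ 2 / 4) := by
    norm_num [Nat.factorial] at h
    nlinarith
  have m1 : X ≤ 1 + X ^ 6 ∧ X ^ 3 ≤ 1 + X ^ 6 ∧ X ^ 5 ≤ 1 + X ^ 6 := by
    rcases le_total X 1 with hh | hh
    · have := pow_le_one₀ (n := 3) hX hh
      have := pow_le_one₀ (n := 5) hX hh
      have : 0 ≤ X ^ 6 := by positivity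
      refine ⟨?_, ?_, ?_⟩ <;> linarith
    · have a1 := pow_le_pow_right₀ hh (show 1 ≤ 6 by norm_num)
      have a3 := pow_le_pow_right₀ hh (show 3 ≤ 6 by norm_num)
      have a5 := pow_le_pow_right₀ hh (show 5 ≤ 6 by norm_num)
      refine ⟨?_, ?_, ?_⟩ <;> linarith
  rw [Real.exp_neg]
  have hp := Real.exp_pos (X ^ 2 / 4)
  refine ⟨?_, ?_, ?_⟩ <;> rw [inv_mul_le_iff₀ hp] <;> linarith [m1.1, m1.2.1, m1.2.2]

lemma Gm_up {h y A d : ℝ} (hh : 0 < h) (hA : 0 < A) (hd : |d| ≤ y) (hc : A ≤ y ∨ A ≤ h) :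
    h⁻¹ ^ 3 * Real.exp (-(y ^ 2 / (4 * h ^ 2))) ≤ 400 / A ^ 3 ∧
    |h⁻¹ ^ 3 * Real.exp (-(y ^ 2 / (4 * h ^ 2))) * (-d / (2 * h ^ 2))| ≤ 400 / A ^ 4 := by
  have hy : 0 ≤ y := (abs_nonneg d).trans hd
  obtain ⟨X, hX⟩ : ∃ X, X = y / h := ⟨_, rfl⟩
  have hyX : y = X * h := by rw [hX]; field_simp
  have hX0 : 0 ≤ X := by rw [hX]; positivity
  have e : y ^ 2 / (4 * h ^ 2) = X ^ 2 / 4 := by rw [hyX]; field_simp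
  obtain ⟨E, hE⟩ : ∃ E, E = Real.exp (-(X ^ 2 / 4)) := ⟨_, rfl⟩
  have hE0 : 0 < E := by rw [hE]; exact Real.exp_pos _
  have hE1 : E ≤ 1 := by rw [hE]; exact Real.exp_le_one_iff.2 (by nlinarith [sq_nonneg X])
  obtain ⟨g1, g2, g3⟩ := gauss_num hX0
  rw [e, ← hE]
  rw [← hE] at g1 g2 g3
  have hb : |h⁻¹ ^ 3 * E * (-d / (2 * h ^ 2))| ≤ h⁻¹ ^ 4 * (E * X) := by
    rw [abs_mul, abs_of_pos pz, abs_div, abs_neg, abs_of_pos (show 0 < 2 * h ^ 2 by positivity)]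
    calc h⁻¹ ^ 3 * E * (|d| / (2 * h ^ 2)) ≤ h⁻¹ ^ 3 * E * (X * h / (1 * h ^ 2)) := by
          rw [← hyX]; gcongr; norm_num
      _ = _ := by field_simp
  rcases hc with hc | hc
  · have hX1 : 0 < X := by rw [hX]; exact div_pos (hA.trans_le hc) hh
    have hle : h⁻¹ ≤ X / A := by
      rw [hX, div_div, le_div_iff₀ pz, mul_comm h A, ← mul_assoc]; field_simp; exact hc
    constructor
    · calc h⁻¹ ^ 3 * E ≤ (X / A) ^ 3 * E := by gcongr
        _ = (E * X ^ 3) / A ^ 3 := by rw [div_pow]; ring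
        _ ≤ _ := by gcongr
    · refine hb.trans ?_
      calc h⁻¹ ^ 4 * (E * X) ≤ (X / A) ^ 4 * (E * X) := by gcongr
        _ = (E * X ^ 5) / A ^ 4 := by rw [div_pow]; ring
        _ ≤ _ := by gcongr
  · have hle : h⁻¹ ≤ A⁻¹ := inv_anti₀ hA hc
    constructor
    · calc h⁻¹ ^ 3 * E ≤ A⁻¹ ^ 3 * 400 := by gcongr; linarith
        _ = _ := by rw [inv_pow]; ring
    · refine hb.trans ?_
      calc h⁻¹ ^ 4 * (E * X) ≤ A⁻¹ ^ 4 * 400 := by gcongr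
        _ = _ := by rw [inv_pow]; ring

lemma gauss_exists (xo : E3) (tq : ℝ) {ρ : ℝ} (hρ : 0 < ρ) : ∃ Γ, Gs xo tq ρ Γ := by
  obtain ⟨σ, hσ⟩ : ∃ σ : ℝ → ℝ, σ = fun t => ρ ^ 2 * gg ((tq - t) / ρ ^ 2) := ⟨_, rfl⟩
  have sm : CD σ := by
    rw [hσ]; exact contDiff_const.mul (gg_smooth.comp (by fun_prop))
  have hp : ∀ t, 0 < σ t := fun t => by rw [hσ]; exact mul_pos pz (gg_pos _)
  have he : ∀ t, t < tq → σ t = tq - t + ρ ^ 2 := fun t ht => by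
    rw [hσ]; dsimp only; rw [gg_eq (div_nonneg (by linarith) pz)]; field_simp
  have hG : ∀ x t, Gm xo σ (x, t) = (√(σ t))⁻¹ ^ 3 * Real.exp (-(dist x xo ^ 2 / (4 * √(σ t) ^ 2))) := by
    intro x t
    have hsp := Real.sqrt_pos.2 (hp t)
    have h1 : (√(σ t))⁻¹ ^ 3 = Real.exp (-(3 / 2) * Real.log (σ t)) := by
      rw [← Real.exp_log (show 0 < (√(σ t))⁻¹ ^ 3 by positivity), Real.log_pow, Real.log_inv, Real.log_sqrt (hp t).le]
      congr 1; push_cast; ring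
    rw [h1, Real.sq_sqrt (hp t).le, ← Real.exp_add, dist_eq_norm]; rfl
  refine ⟨Gm xo σ, Gm_sm sm hp, fun z => Real.exp_pos _, fun x t A ht hA hc => ?_, fun x t ht => ?_, fun x t hx h1 h2 => ?_⟩
  · have hc' : A ≤ dist x xo ∨ A ≤ √(σ t) := hc.imp id fun h => Real.le_sqrt_of_sq_le (by rw [he t ht]; exact h)
    have hd : ∀ i, |x i - xo i| ≤ dist x xo := fun i => by rw [dist_eq_norm]; exact comp_le (x - xo) i
    have hsp := Real.sqrt_pos.2 (hp t)
    refine ⟨?_, fun i => ?_⟩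
    · rw [hG]; exact (Gm_up hsp hA (hd 0) hc').1
    · rw [Gm_sdz sm hp, hG]
      have := (Gm_up hsp hA (hd i) hc').2
      rwa [Real.sq_sqrt (hp t).le] at this ⊢
  · refine Gm_heat sm hp _ ?_
    have h1 : HasDerivAt (fun s => tq - s + ρ ^ 2) (-1) t := ((hasDerivAt_id t).const_sub tq).add_const _
    refine h1.congr_of_eventuallyEq ?_
    filter_upwards [Iio_mem_nhds ht] with s hs using he s hs
  · have hs : σ t ≤ 2 * ρ ^ 2 ∧ ρ ^ 2 ≤ σ t := by rw [he t h2]; constructor <;> linarith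
    have hsp := Real.sqrt_pos.2 (hp t)
    have hu : √(σ t) ≤ 3 / 2 * ρ := Real.sqrt_le_iff.2 ⟨by positivity, by nlinarith [hs.1, sq_nonneg ρ]⟩
    rw [hG]
    have hE : 3 / 4 ≤ Real.exp (-(dist x xo ^ 2 / (4 * √(σ t) ^ 2))) := by
      have h3 : dist x xo ^ 2 / (4 * √(σ t) ^ 2) ≤ 1 / 4 := by
        rw [Real.sq_sqrt (hp t).le, div_le_iff₀ (by have := hp t; positivity)]
        nlinarith [dist_nonneg (x := x) (y := xo)]
      have := Real.add_one_le_exp (-(dist x xo ^ 2 / (4 * √(σ t) ^ 2)))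
      linarith
    calc 1 / (8 * ρ ^ 3) ≤ (3 / 2 * ρ)⁻¹ ^ 3 * (3 / 4) := by
          rw [inv_pow, mul_pow, div_le_iff₀ pz]; field_simp; norm_num
      _ ≤ _ := by gcongr

lemma fd_mul {f g : ET → ℝ} (hf : CD f) (hg : CD g) (z w : ET) :
    fderiv ℝ (fun z => f z * g z) z w = fderiv ℝ f z w * g z + f z * fderiv ℝ g z w := by
  have h := ((hf.differentiable (by simp)) z).hasFDerivAt.fun_mul ((hg.differentiable (by simp)) z).hasFDerivAt
  rw [h.fderiv]
  simp only [add_apply, smul_apply, smul_eq_mul]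
  ring

lemma sdz_add {f g : ET → ℝ} (hf : CD f) (hg : CD g) (i : Fin 3) (z : ET) :
    sdz (fun z => f z + g z) i z = sdz f i z + sdz g i z := by
  have h := ((hf.differentiable (by simp)) z).hasFDerivAt.fun_add ((hg.differentiable (by simp)) z).hasFDerivAt
  rw [sdz, h.fderiv]; rfl

lemma sdz_mul {f g : ET → ℝ} (hf : CD f) (hg : CD g) (i : Fin 3) (z : ET) :
    sdz (fun z => f z * g z) i z = sdz f i z * g z + f z * sdz g i z := fd_mul hf hg z _

lemma Pop_mul {f g : ET → ℝ} (hf : CD f) (hg : CD g) (z : ET) :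
    Pop (fun z => f z * g z) z = Pop f z * g z + f z * Pop g z + 2 * ∑ i, sdz f i z * sdz g i z := by
  have h2 : ∀ i, sdz (fun w => sdz (fun z => f z * g z) i w) i z =
      sdz (fun w => sdz f i w) i z * g z + 2 * (sdz f i z * sdz g i z) + f z * sdz (fun w => sdz g i w) i z := by
    intro i
    simp only [sdz_mul hf hg]
    rw [sdz_add ((sdz_smooth hf i).mul hg) (hf.mul (sdz_smooth hg i)), sdz_mul (sdz_smooth hf i) hg, sdz_mul hf (sdz_smooth hg i)]
    ring
  rw [Pop, Pop, Pop, tdz, fd_mul hf hg]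
  simp only [h2, Fin.sum_univ_three, tdz]
  ring

lemma Cut.o {C : ℝ} {xo : E3} {tq R : ℝ} {χ : ET → ℝ} (h : Cut C xo tq R χ) (hR : 0 < R) {x : E3} {t : ℝ}
    (hx : x ∉ ball xo (R / 2) ∨ t ≤ tq - R ^ 2) : χ (x, t) = 0 ∧ (∀ i, sdz χ i (x, t) = 0) ∧ Pop χ (x, t) = 0 := by
  have hn : (x, t) ∉ tsupport χ := fun hc => by
    obtain ⟨h1, h2, h3⟩ := h.su hc
    rw [mem_closedBall] at h1
    rcases hx with hx | hx
    · rw [mem_ball, not_lt] at hx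
      have : dist x xo ≤ 2 / 5 * R := h1
      linarith
    · have : tq - R ^ 2 / 4 ≤ t := h2
      nlinarith [pow_pos hR 2]
  refine ⟨image_eq_zero_of_notMem_tsupport hn, loc_const (c := 0) (notMem_tsupport_iff_eventuallyEq.1 hn)⟩

lemma shell {C : ℝ} (hC : 0 < C) {xo : E3} {tq R ρ : ℝ} {χ Γ : ET → ℝ} (h : Cut C xo tq R χ) (g : Gs xo tq ρ Γ) (hR : 0 < R) {x : E3} {t : ℝ}
    (ht : t < tq) (i : Fin 3) : |sdz χ i (x, t) * Γ (x, t)| ≤ 25600 * C / R ^ 4 ∧ |sdz χ i (x, t) * sdz Γ i (x, t)| ≤ 102400 * C / R ^ 5 ∧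
      |Pop χ (x, t) * Γ (x, t)| ≤ 25600 * C / R ^ 5 := by
  by_cases hc : dist x xo < R / 4 ∧ |t - tq| < R ^ 2 / 16
  · obtain ⟨h1, h2⟩ := h.z hc.1 hc.2
    rw [h1 i, h2, zero_mul, zero_mul, abs_zero]
    refine ⟨?_, ?_, ?_⟩ <;> positivity
  · have hc' : R / 4 ≤ dist x xo ∨ (R / 4) ^ 2 ≤ tq - t + ρ ^ 2 := by
      by_contra hn
      push Not at hn
      refine hc ⟨hn.1, ?_⟩
      rw [abs_of_neg (by linarith)]
      nlinarith [hn.2, sq_nonneg ρ]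
    obtain ⟨g1, g2⟩ := g.up x t (R / 4) ht pz hc'
    have g2 := g2 i
    have d1 := h.d1 i (x, t)
    have d2 := h.d2 (x, t)
    rw [abs_mul, abs_mul, abs_mul, abs_of_pos (g.pos _)]
    have gp := (g.pos (x, t)).le
    refine ⟨?_, ?_, ?_⟩
    · calc _ ≤ C / R * (400 / (R / 4) ^ 3) := by gcongr
        _ = _ := by field_simp; norm_num
    · calc _ ≤ C / R * (400 / (R / 4) ^ 4) := by gcongr
        _ = _ := by field_simp; norm_num
    · calc _ ≤ C / R ^ 2 * (400 / (R / 4) ^ 3) := by gcongr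
        _ = _ := by field_simp; norm_num

structure Fam (C : ℝ) (xo : E3) (tq : ℝ) (Rk : ℕ → ℝ) (n : ℕ) (φ : ET → ℝ) (ψ : ℕ → ET → ℝ) : Prop where
  sm : CD φ
  su : tsupport φ ⊆ closedBall xo (2 / 5 * Rk 0) ×ˢ Icc (tq - Rk 0 ^ 2 / 4) (tq + Rk 0 ^ 2 / 4)
  sm' : ∀ k, CD (ψ k)
  su' : ∀ k, tsupport (ψ k) ⊆ closedBall xo (2 / 5 * Rk 0) ×ˢ Icc (tq - Rk 0 ^ 2 / 4) (tq + Rk 0 ^ 2 / 4)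
  nn : ∀ z, 0 ≤ φ z
  sum : ∀ i z, sdz φ i z = ∑ k ∈ Finset.range (n + 1), sdz (ψ k) i z
  M1 : ∀ k x t i, t < tq → |sdz (ψ k) i (x, t)| ≤ C / Rk (k + 1) ^ 4
  M0 : ∀ k x t i, t < tq → (x ∉ ball xo (Rk k / 2) ∨ t ≤ tq - (2 * (Rk k / 2)) ^ 2) → sdz (ψ k) i (x, t) = 0
  P : ∀ x t, t < tq → Pop φ (x, t) ≤ C / Rk 0 ^ 5
  P0 : ∀ x t, t < tq → (x ∉ ball xo (Rk 0) ∨ t ≤ tq - Rk 0 ^ 2) → Pop φ (x, t) ≤ 0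
  low : ∀ x t, dist x xo < Rk (n + 1) → tq - Rk (n + 1) ^ 2 < t → t < tq → 1 / (8 * Rk (n + 1) ^ 3) ≤ φ (x, t)

lemma fam_exists : ∃ C : ℝ, 0 < C ∧ ∀ (xo : E3) (tq : ℝ) (Rk : ℕ → ℝ) (n : ℕ), (∀ k, 0 < Rk k) → (∀ k, Rk (k + 1) ≤ Rk k) →
    Rk (n + 1) ≤ Rk 0 / 8 → ∃ φ ψ, Fam C xo tq Rk n φ ψ := by
  obtain ⟨C, hC, h⟩ := cut_exists
  refine ⟨640000 * C + 102400, by positivity, fun xo tq Rk n hR hd hρ => ?_⟩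
  choose χ hχ using fun k => h xo tq (Rk k) (hR k)
  obtain ⟨Γ, hΓ⟩ := gauss_exists xo tq (hR (n + 1))
  have anti : ∀ k, Rk k ≤ Rk 0 := fun k => antitone_nat_of_succ_le hd (Nat.zero_le k)
  obtain ⟨a, ha⟩ : ∃ a : ℕ → ℝ, a = fun k => if k ≤ n then 1 else 0 := ⟨_, rfl⟩
  have a1 : ∀ k, |a k| ≤ 1 := fun k => by rw [ha]; dsimp only; split_ifs <;> simp
  obtain ⟨X, hX⟩ : ∃ X : ℕ → ET → ℝ, X = fun k z => a k * χ k z + (-a (k + 1)) * χ (k + 1) z := ⟨_, rfl⟩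
  have smX : ∀ k, CD (X k) := fun k => by
    rw [hX]; exact (contDiff_const.mul (hχ k).sm).add (contDiff_const.mul (hχ (k + 1)).sm)
  have sc : ∀ (c : ℝ) k i z, sdz (fun z => c * χ k z) i z = c * sdz (χ k) i z := fun c k i z => by
    rw [sdz_mul contDiff_const (hχ k).sm, show sdz (fun _ => c) i z = 0 by simp [sdz]]; ring
  have sX : ∀ k i z, sdz (X k) i z = a k * sdz (χ k) i z + (-a (k + 1)) * sdz (χ (k + 1)) i z := fun k i z => by
    rw [hX]; dsimp only
    rw [sdz_add (contDiff_const.mul (hχ k).sm) (contDiff_const.mul (hχ (k + 1)).sm), sc, sc]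
  have sψ : ∀ k i z, sdz (fun z => X k z * Γ z) i z = sdz (X k) i z * Γ z + X k z * sdz Γ i z := fun k i z => sdz_mul (smX k) hΓ.sm i z
  have sφ : ∀ i z, sdz (fun z => χ 0 z * Γ z) i z = sdz (χ 0) i z * Γ z + χ 0 z * sdz Γ i z := fun i z => sdz_mul (hχ 0).sm hΓ.sm i z
  have tel : ∀ f : ℕ → ℝ, ∑ k ∈ Finset.range (n + 1), (a k * f k + (-a (k + 1)) * f (k + 1)) = f 0 := fun f => by
    have := Finset.sum_range_sub' (fun k => a k * f k) (n + 1)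
    rw [show a 0 = 1 by rw [ha]; simp, show a (n + 1) = 0 by rw [ha]; simp] at this
    rw [one_mul, zero_mul, sub_zero] at this
    rw [← this]; exact Finset.sum_congr rfl fun k _ => by ring
  have zz : ∀ k x t, x ∉ ball xo (Rk k / 2) ∨ t ≤ tq - Rk k ^ 2 → x ∉ ball xo (Rk (k + 1) / 2) ∨ t ≤ tq - Rk (k + 1) ^ 2 := by
    intro k x t hx
    refine hx.imp (fun h h' => h (ball_subset_ball (by linarith [hd k]) h')) fun h => ?_
    have := pow_le_pow_left₀ (hR (k + 1)).le (hd k) 2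
    linarith
  have suχ : ∀ k, tsupport (χ k) ⊆ closedBall xo (2 / 5 * Rk 0) ×ˢ Icc (tq - Rk 0 ^ 2 / 4) (tq + Rk 0 ^ 2 / 4) := fun k => by
    have := pow_le_pow_left₀ (hR k).le (anti k) 2
    refine (hχ k).su.trans (prod_mono (closedBall_subset_closedBall (by linarith [anti k])) (Icc_subset_Icc ?_ ?_)) <;> linarith
  have cl : IsClosed (closedBall xo (2 / 5 * Rk 0) ×ˢ Icc (tq - Rk 0 ^ 2 / 4) (tq + Rk 0 ^ 2 / 4)) := isClosed_closedBall.prod isClosed_Icc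
  have R0 := hR 0
  refine ⟨fun z => χ 0 z * Γ z, fun k z => X k z * Γ z, (hχ 0).sm.mul hΓ.sm, (tsupport_mul_subset_left).trans (suχ 0),
    fun k => (smX k).mul hΓ.sm, fun k => (tsupport_mul_subset_left).trans ?_, fun z => mul_nonneg ((hχ 0).nn z) (hΓ.pos z).le,
    fun i z => ?_, fun k x t i ht => ?_, fun k x t i ht hx => ?_, fun x t ht => ?_, fun x t ht hx => ?_, fun x t hx h1 h2 => ?_⟩
  · refine closure_minimal (fun z hz => ?_) cl
    by_contra hn
    refine hz ?_
    have e : ∀ k, χ k z = 0 := fun k => image_eq_zero_of_notMem_tsupport fun h' => hn (suχ k h')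
    rw [hX]; dsimp only; rw [e, e]; ring
  · simp only [sφ, sψ, sX]
    simp only [hX]
    rw [Finset.sum_add_distrib, ← Finset.sum_mul, ← Finset.sum_mul, tel (fun k => sdz (χ k) i z), tel (fun k => χ k z)]
  · rw [sψ, sX]
    have R1 := hR (k + 1)
    have s1 := (shell hC (hχ k) hΓ (hR k) (x := x) ht i).1
    have s2 := (shell hC (hχ (k + 1)) hΓ R1 (x := x) ht i).1
    have s1' : |sdz (χ k) i (x, t) * Γ (x, t)| ≤ 25600 * C / Rk (k + 1) ^ 4 := s1.trans (by
      have := pow_le_pow_left₀ R1.le (hd k) 4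
      gcongr)
    have Xb : |X k (x, t)| ≤ 1 := by
      rw [hX, ha]; dsimp only
      have b1 := (hχ k).nn (x, t)
      have b2 := (hχ k).le (x, t)
      have b3 := (hχ (k + 1)).nn (x, t)
      have b4 := (hχ (k + 1)).le (x, t)
      rw [abs_le]
      split_ifs <;> constructor <;> linarith
    have s3 : |X k (x, t) * sdz Γ i (x, t)| ≤ 102400 / Rk (k + 1) ^ 4 := by
      by_cases hX0 : X k (x, t) = 0
      · rw [hX0, zero_mul, abs_zero]; positivity
      have hc : Rk (k + 1) / 4 ≤ dist x xo ∨ (Rk (k + 1) / 4) ^ 2 ≤ tq - t + Rk (n + 1) ^ 2 := by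
        by_contra hn
        push Not at hn
        apply hX0
        have hkn : k ≠ n := fun e => by
          rw [e] at hn
          nlinarith [hn.2, hR (n + 1)]
        have ht2 : |t - tq| < Rk (k + 1) ^ 2 / 16 := by
          rw [abs_of_neg (by linarith)]; nlinarith [hn.2, sq_nonneg (Rk (n + 1))]
        have := pow_le_pow_left₀ R1.le (hd k) 2
        rw [hX]; dsimp only
        rw [(hχ k).one x t (by linarith [hn.1, hd k]) (by linarith), (hχ (k + 1)).one x t hn.1 ht2, ha]; dsimp only
        rcases lt_or_gt_of_ne hkn with h | h
        · rw [if_pos h.le, if_pos (by omega)]; ring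
        · rw [if_neg (by omega), if_neg (by omega)]; ring
      have g2 := (hΓ.up x t (Rk (k + 1) / 4) ht pz hc).2 i
      rw [abs_mul]
      calc _ ≤ 1 * (400 / (Rk (k + 1) / 4) ^ 4) := by gcongr
        _ = _ := by field_simp; norm_num
    have e : (a k * sdz (χ k) i (x, t) + -a (k + 1) * sdz (χ (k + 1)) i (x, t)) * Γ (x, t) + X k (x, t) * sdz Γ i (x, t) =
      a k * (sdz (χ k) i (x, t) * Γ (x, t)) + -a (k + 1) * (sdz (χ (k + 1)) i (x, t) * Γ (x, t)) + X k (x, t) * sdz Γ i (x, t) := by ring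
    rw [e]
    refine (abs_add_le _ _).trans ((add_le_add (abs_add_le _ _) s3).trans ?_)
    rw [abs_mul (a k), abs_mul (-a (k + 1)), abs_neg]
    have m1 := mul_le_mul (a1 k) s1' (abs_nonneg _) zero_le_one
    have m2 := mul_le_mul (a1 (k + 1)) s2 (abs_nonneg _) zero_le_one
    have : 0 ≤ C / Rk (k + 1) ^ 4 := by positivity
    calc _ ≤ 1 * (25600 * C / Rk (k + 1) ^ 4) + 1 * (25600 * C / Rk (k + 1) ^ 4) + 102400 / Rk (k + 1) ^ 4 := by linarith
      _ = 51200 * (C / Rk (k + 1) ^ 4) + 102400 / Rk (k + 1) ^ 4 := by ring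
      _ ≤ 640000 * (C / Rk (k + 1) ^ 4) + 102400 / Rk (k + 1) ^ 4 := by linarith
      _ = _ := by ring
  · rw [mul_div_cancel₀ _ two_ne_zero] at hx
    obtain ⟨c1, c2, -⟩ := (hχ k).o (hR k) hx
    obtain ⟨d1, d2, -⟩ := (hχ (k + 1)).o (hR (k + 1)) (zz k x t hx)
    rw [sψ, sX, c2, d2, hX]; dsimp only; rw [c1, d1]; ring
  · rw [Pop_mul (hχ 0).sm hΓ.sm, hΓ.heat x t ht]
    have s := fun i => shell hC (hχ 0) hΓ R0 (x := x) ht i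
    have s1 := (abs_le.1 (s 0).2.2).2
    have q := fun i => (abs_le.1 (s i).2.1).2
    have q0 := q 0
    have q1 := q 1
    have q2 := q 2
    rw [Fin.sum_univ_three]
    have : (640000 * C + 102400) / Rk 0 ^ 5 = 25600 * C / Rk 0 ^ 5 + 6 * (102400 * C / Rk 0 ^ 5) + 102400 / Rk 0 ^ 5 := by ring
    have : 0 ≤ 102400 / Rk 0 ^ 5 := by positivity
    linarith
  · have hx' : x ∉ ball xo (Rk 0 / 2) ∨ t ≤ tq - Rk 0 ^ 2 :=
      hx.imp (fun h h' => h (ball_subset_ball (by linarith) h')) id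
    obtain ⟨c1, c2, c3⟩ := (hχ 0).o R0 hx'
    rw [Pop_mul (hχ 0).sm hΓ.sm, c1, c3]
    simp only [c2]
    simp
  · have := hR (n + 1)
    rw [(hχ 0).one x t (by linarith) (by rw [abs_of_neg (by linarith)]; nlinarith), one_mul]
    exact hΓ.low x t hx h1 h2

lemma Ht_prod {Dv : ET → Fin 3 → Fin 3 → ℝ} (mD : Measurable Dv) (xo : E3) (ρ a b : ℝ) :
    ∫⁻ t in Ioo a b, Ht Dv xo ρ t = ∫⁻ z in ball xo ρ ×ˢ Ioo a b, oR (∑ i, ∑ j, (Dv z i j) ^ 2) := by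
  have m : Measurable fun z => oR (∑ i, ∑ j, (Dv z i j) ^ 2) := ENNReal.measurable_ofReal.comp
    (Finset.measurable_fun_sum _ fun i _ => Finset.measurable_fun_sum _ fun j _ => (mDcomp mD i j).pow_const 2)
  rw [Measure.volume_eq_prod, ← Measure.prod_restrict, lintegral_prod_symm' _ m]; rfl

lemma win_lim {f : ℝ → ℝ≥0∞} {a b T : ℝ} {B : ℝ≥0∞} (ha : 0 ≤ a) (hab : a < b) (hb : b ≤ T)
    (h : ∀ᵐ t ∂(volume.restrict (Ioo 0 T)), t < b → ∫⁻ s in Ioo a t, f s ≤ B) : ∫⁻ s in Ioo a b, f s ≤ B := by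
  have h1 : ∀ c, c < b → ∫⁻ s in Ioo a c, f s ≤ B := by
    intro c hc
    have hc' : max a c < b := max_lt hab hc
    have h2 : ∀ᵐ t ∂(volume.restrict (Ioo (max a c) b)), t < b → ∫⁻ s in Ioo a t, f s ≤ B :=
      ae_mono (Measure.restrict_mono (Ioo_subset_Ioo (ha.trans (le_max_left a c)) hb) le_rfl) h
    have : (ae (volume.restrict (Ioo (max a c) b))).NeBot := by
      rw [ae_restrict_neBot, Real.volume_Ioo]
      simpa using hc'
    obtain ⟨t, h3, h4⟩ := (h2.and (ae_restrict_mem measurableSet_Ioo)).exists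
    exact (lintegral_mono_set (Ioo_subset_Ioo_right ((le_max_right a c).trans h4.1.le))).trans (h3 h4.2)
  obtain ⟨u, hu, hu2, hu3⟩ := exists_seq_strictMono_tendsto b
  have e : Ioo a b = ⋃ n, Ioo a (u n) := by
    ext s
    simp only [mem_iUnion, mem_Ioo]
    constructor
    · rintro ⟨h1, h2⟩
      obtain ⟨n, hn⟩ := (hu3.eventually (lt_mem_nhds h2)).exists
      exact ⟨n, h1, hn⟩
    · rintro ⟨n, h1, h2⟩; exact ⟨h1, h2.trans (hu2 n)⟩
  rw [e, setLIntegral_iUnion_of_directed]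
  · exact iSup_le fun n => h1 _ (hu2 n)
  · exact Monotone.directed_le fun m n hmn => Ioo_subset_Ioo_right (hu.monotone hmn)

lemma energy : ∃ C : ℝ, 0 < C ∧ ∀ {Ω T v Dv p v₀}, IsSuitableWeakSolution Ω T v Dv p v₀ → IsOpen Ω →
    ∀ {xo : E3} {tq : ℝ} {Rk : ℕ → ℝ} {n : ℕ}, (∀ k, 0 < Rk k) → (∀ k, Rk (k + 1) ≤ Rk k) → Rk (n + 1) ≤ Rk 0 / 8 →
    ball xo (Rk 0) ⊆ Ω → 0 ≤ tq - Rk 0 ^ 2 → tq + Rk 0 ^ 2 ≤ T → ∀ {μ ε δ : ℕ → ℝ}, (∀ k, 0 < μ k) → (∀ k, 0 < ε k) →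
    (∀ k, 0 < δ k) → (∀ k ≤ n, Dat v Dv p xo tq (Rk k) (μ k) (ε k) (δ k)) → ∀ K : ℝ,
    C * (Rk (n + 1) ^ 2 * (μ 0 ^ 2 / Rk 0 ^ 2 + ∑ k ∈ Finset.range (n + 1), Rk k ^ 2 / Rk (k + 1) ^ 4 *
      (ε k * μ k * (ε k + μ k) + μ k * δ k ^ 2))) ≤ K →
    (∀ᵐ t ∂(volume.restrict (Ioo (tq - Rk (n + 1) ^ 2) tq)), Vt v xo (Rk (n + 1)) t ≤ oR (K * Rk (n + 1))) ∧
    ∫⁻ t in Ioo (tq - Rk (n + 1) ^ 2) tq, Ht Dv xo (Rk (n + 1)) t ≤ oR (K * Rk (n + 1)) := by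
  obtain ⟨c₁, hc₁, hf⟩ := fam_exists
  obtain ⟨c₂, hc₂, hT⟩ := time_T
  have hbb := bb_pos
  refine ⟨8 * c₁ * (1 + 24 * c₂ / bb), by positivity, fun {Ω T v Dv p v₀} hs hΩ {xo tq Rk n} hR hd hρ hB h0 h1 {μ ε δ} hμ hε hδ hD K hK => ?_⟩
  obtain ⟨φ, ψ, F⟩ := hf xo tq Rk n hR hd hρ
  have anti : ∀ k, Rk k ≤ Rk 0 := fun k => antitone_nat_of_succ_le hd (Nat.zero_le k)
  obtain ⟨J, hJ⟩ : ∃ J : ℕ → ℝ, J = fun k => ε k * μ k * (ε k + μ k) + μ k * δ k ^ 2 := ⟨_, rfl⟩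
  have J0 : ∀ k, 0 ≤ J k := fun k => by
    rw [hJ]; have := hμ k; have := hε k; have := hδ k; positivity
  obtain ⟨ρ, hρe⟩ : ∃ ρ, ρ = Rk (n + 1) := ⟨_, rfl⟩
  have R0 := hR 0
  have hρ0 : 0 < ρ := hρe ▸ hR (n + 1)
  have cpt : IsCompact (closedBall xo (2 / 5 * Rk 0) ×ˢ Icc (tq - Rk 0 ^ 2 / 4) (tq + Rk 0 ^ 2 / 4)) :=
    (isCompact_closedBall _ _).prod isCompact_Icc
  have csub : closedBall xo (2 / 5 * Rk 0) ×ˢ Icc (tq - Rk 0 ^ 2 / 4) (tq + Rk 0 ^ 2 / 4) ⊆ Ω ×ˢ Ioo 0 T := by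
    have := pow_pos R0 2
    refine prod_mono ((closedBall_subset_ball (by linarith)).trans hB) fun t ht => ⟨?_, ?_⟩
    · linarith [ht.1]
    · linarith [ht.2]
  have tφ : Tst Ω T φ := ⟨F.sm, cpt.of_isClosed_subset (isClosed_tsupport _) F.su, F.su.trans csub⟩
  have tψ : ∀ k, Tst Ω T (ψ k) := fun k => ⟨F.sm' k, cpt.of_isClosed_subset (isClosed_tsupport _) (F.su' k), (F.su' k).trans csub⟩
  have hwin : ∀ k, Ioo (tq - Rk k ^ 2) tq ⊆ Ioo 0 T := fun k => by
    have := pow_le_pow_left₀ (hR k).le (anti k) 2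
    have := pow_pos R0 2
    exact Ioo_subset_Ioo (by linarith) (by linarith)
  obtain ⟨B, hBe⟩ : ∃ B, B = c₁ * (1 + 24 * c₂ / bb) * (μ 0 ^ 2 / Rk 0 ^ 2 + ∑ k ∈ Finset.range (n + 1), Rk k ^ 2 / Rk (k + 1) ^ 4 * J k) := ⟨_, rfl⟩
  have hKB : 8 * ρ ^ 3 * B ≤ K * ρ := by
    have : 8 * ρ ^ 2 * B ≤ K := by
      refine le_trans (le_of_eq ?_) hK
      rw [hBe, hJ, ← hρe]; ring
    nlinarith
  have hVi : ∫⁻ t in Ioo (tq - Rk 0 ^ 2) tq, Vt v xo (Rk 0) t ≤ oR (μ 0 ^ 2 * Rk 0 ^ 3) := by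
    refine (lintegral_mono_ae (hD 0 (Nat.zero_le n)).A).trans ?_
    rw [lintegral_const, vol_win, ← ofReal_mul pz]
    exact le_of_eq (by congr 1; ring)
  have hBB : ∀ t₁ < tq, t₁ ≤ T → oR (∫ z in Ω ×ˢ Ioo 0 t₁, (‖v z‖ ^ 2 * Pop φ z + (‖v z‖ ^ 2 + 2 * p z) * ∑ i, v z i * sdz φ i z)) ≤ oR B := by
    intro t₁ ht₁ hT₁
    refine (en_rhs hs (xo := xo) (R := Rk 0) (L := c₁ / Rk 0 ^ 5) pz (m := n + 1) (r := fun k => Rk k / 2)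
      (M := fun k => c₁ / Rk (k + 1) ^ 4) (fun k => half_pos (hR k)) (fun k => by have := hR (k + 1); positivity)
      tφ tψ F.sum F.M1 F.M0 F.P F.P0 ht₁ hT₁).trans ?_
    have s1 : oR (c₁ / Rk 0 ^ 5) * (∫⁻ t in Ioo (tq - Rk 0 ^ 2) tq, Vt v xo (Rk 0) t) ≤ oR (c₁ * (μ 0 ^ 2 / Rk 0 ^ 2)) := by
      refine (mul_le_mul' le_rfl hVi).trans ?_
      rw [← ofReal_mul pz]
      exact ofReal_le_ofReal (le_of_eq (by field_simp))
    have s2 : ∀ k ∈ Finset.range (n + 1), oR (3 * (c₁ / Rk (k + 1) ^ 4) / (bb * (Rk k / 2) ^ 3)) *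
        ∫⁻ t in Ioo (tq - (2 * (Rk k / 2)) ^ 2) tq, Tt v p xo (Rk k / 2) t ≤
        oR (c₁ * (24 * c₂ / bb) * (Rk k ^ 2 / Rk (k + 1) ^ 4 * J k)) := by
      intro k hk
      have Rk0 := hR k
      have Rk1 := hR (k + 1)
      rw [mul_div_cancel₀ _ two_ne_zero]
      have := hT hs hΩ Rk0 ((ball_subset_ball (anti k)).trans hB) (hwin k) (hμ k) (hε k) (hδ k) (hD k (Nat.lt_succ_iff.1 (Finset.mem_range.1 hk)))
      refine (mul_le_mul' le_rfl this).trans ?_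
      rw [← ofReal_mul pz]
      refine ofReal_le_ofReal (le_of_eq ?_)
      rw [hJ]; dsimp only
      field_simp
      ring
    refine (add_le_add s1 (Finset.sum_le_sum s2)).trans ?_
    have nn : ∀ k, 0 ≤ Rk k ^ 2 / Rk (k + 1) ^ 4 * J k := fun k => mul_nonneg (by have := hR k; have := hR (k + 1); positivity) (J0 k)
    have nS : 0 ≤ ∑ k ∈ Finset.range (n + 1), Rk k ^ 2 / Rk (k + 1) ^ 4 * J k := Finset.sum_nonneg fun k _ => nn k
    rw [← ofReal_sum_of_nonneg fun k _ => mul_nonneg pz (nn k), ← ofReal_add pz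
      (Finset.sum_nonneg fun k _ => mul_nonneg pz (nn k)), ← Finset.mul_sum]
    refine ofReal_le_ofReal ?_
    rw [hBe]
    have q1 : 0 ≤ c₁ * (24 * c₂ / bb) * (μ 0 ^ 2 / Rk 0 ^ 2) := by positivity
    have q2 := mul_nonneg hc₁.le nS
    nlinarith
  have key := en_time hs tφ F.nn hBB
  have hfin : oR (8 * ρ ^ 3) * oR B ≤ oR (K * ρ) := by
    rw [← ofReal_mul pz]; exact ofReal_le_ofReal hKB
  have hlow : ∀ x ∈ ball xo ρ, ∀ t ∈ Ioo (tq - ρ ^ 2) tq, ∀ y : ℝ≥0∞, y ≤ oR (8 * ρ ^ 3) * (y * oR (φ (x, t))) := by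
    intro x hx t ht y
    have := F.low x t (by rw [← hρe]; exact hx) (by rw [← hρe]; exact ht.1) ht.2
    rw [← hρe] at this
    have h2 : 1 ≤ oR (8 * ρ ^ 3) * oR (φ (x, t)) := by
      rw [← ofReal_mul pz, ← ofReal_one]
      refine ofReal_le_ofReal ?_
      rw [div_le_iff₀ pz] at this
      linarith
    calc y = y * 1 := (mul_one y).symm
      _ ≤ y * (oR (8 * ρ ^ 3) * oR (φ (x, t))) := mul_le_mul' le_rfl h2
      _ = _ := by ring
  have hρR : ρ ≤ Rk 0 := hρe ▸ anti (n + 1)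
  have bsub : ball xo ρ ⊆ Ω := (ball_subset_ball hρR).trans hB
  have hw := hwin (n + 1)
  rw [← hρe] at hw ⊢
  have hρ2 := pow_pos hρ0 2
  have t0ρ : 0 ≤ tq - ρ ^ 2 := by
    have := pow_le_pow_left₀ hρ0.le hρR 2
    linarith
  constructor
  · filter_upwards [ae_mono (Measure.restrict_mono hw le_rfl) key, ae_restrict_mem measurableSet_Ioo] with t hk ht
    refine le_trans ?_ hfin
    refine le_trans ?_ (mul_le_mul' le_rfl (hk ht.2).1)
    rw [← lintegral_const_mul' _ _ ofReal_ne_top]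
    exact (setLIntegral_mono' measurableSet_ball fun x hx => hlow x hx t ht _).trans (lintegral_mono_set bsub)
  · refine win_lim t0ρ (by linarith) (by have := pow_pos R0 2; linarith : tq ≤ T) ?_
    filter_upwards [key] with t₁ hk ht
    refine le_trans ?_ hfin
    refine le_trans ?_ (mul_le_mul' le_rfl (hk ht).2)
    rw [← lintegral_const_mul' _ _ ofReal_ne_top, Ht_prod hs.meas_Dv]
    refine (setLIntegral_mono' (measurableSet_ball.prod measurableSet_Ioo) fun z hz => ?_).trans
      (lintegral_mono_set (prod_mono bsub (Ioo_subset_Ioo_left t0ρ)))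
    exact hlow z.1 hz.1 z.2 ⟨hz.2.1, hz.2.2.trans ht⟩ _

lemma Dat.mono {v Dv p} {xo : E3} {tq R μ ε δ μ' ε' δ' : ℝ} (h : Dat v Dv p xo tq R μ ε δ) (hR : 0 ≤ R) (h1 : 0 ≤ μ)
    (h2 : 0 ≤ ε) (h3 : 0 ≤ δ) (g1 : μ ≤ μ') (g2 : ε ≤ ε') (g3 : δ ≤ δ') : Dat v Dv p xo tq R μ' ε' δ' where
  A := h.A.mono fun t ht => ht.trans (ofReal_le_ofReal (by gcongr))
  E := h.E.trans (ofReal_le_ofReal (by gcongr))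
  D := h.D.trans (ofReal_le_ofReal (by gcongr))

lemma stepA_const (C D : ℝ) (hC : 0 < C) (hD : 0 < D) : ∃ κ β η : ℝ, 0 < κ ∧ κ ≤ 1 / 2 ∧ 0 < β ∧ β ≤ 1 ∧ 0 < η ∧ η ≤ β ^ 3 ∧
    D * κ ^ 3 ≤ 1 / 2 ∧ D * β ^ 3 ≤ κ ^ 24 / 2 ∧ 6 * C * β ≤ κ ^ 24 / 2 ∧ C * η ^ 2 ≤ β ^ 6 / 2 := by
  obtain ⟨κ, hκ⟩ : ∃ κ, κ = 1 / (2 * (1 + D)) := ⟨_, rfl⟩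
  have k0 : 0 < κ := by rw [hκ]; positivity
  have kD : κ * (2 * (1 + D)) = 1 := by rw [hκ]; field_simp
  have k1 : κ ≤ 1 / 2 := by linarith [mul_pos k0 hD]
  obtain ⟨β, hβ⟩ : ∃ β, β = κ ^ 24 / (12 * (1 + C) * (1 + D)) := ⟨_, rfl⟩
  have b0 : 0 < β := by rw [hβ]; positivity
  have bD : β * (12 * (1 + C) * (1 + D)) = κ ^ 24 := by rw [hβ]; field_simp
  have kp : κ ^ 24 ≤ 1 := pow_le_one₀ k0.le (by linarith)
  have bC := mul_pos b0 hC
  have bDD := mul_pos b0 hD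
  have bCD := mul_pos bC hD
  have b1 : β ≤ 1 := by linarith
  have b3 : β ^ 3 ≤ β := by simpa using pow_le_pow_of_le_one b0.le b1 (show 1 ≤ 3 by norm_num)
  obtain ⟨η, hη⟩ : ∃ η, η = β ^ 3 / (2 * (1 + C)) := ⟨_, rfl⟩
  have e0 : 0 < η := by rw [hη]; positivity
  have eC : β ^ 3 = η * (2 * (1 + C)) := by rw [hη]; field_simp
  refine ⟨κ, β, η, k0, k1, b0, b1, e0, ?_, ?_, ?_, ?_, ?_⟩
  · linarith [mul_pos e0 hC]
  · have : κ ^ 3 ≤ κ := by simpa using pow_le_pow_of_le_one k0.le (by linarith) (show 1 ≤ 3 by norm_num)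
    linarith [mul_le_mul_of_nonneg_left this hD.le]
  · linarith [mul_le_mul_of_nonneg_left b3 hD.le]
  · linarith
  · rw [show β ^ 6 = (β ^ 3) ^ 2 by ring, eC]
    have e2 : 0 < η ^ 2 := by positivity
    linarith [mul_pos e2 hC, mul_pos (mul_pos e2 hC) hC]

lemma stepA : ∃ κ β η : ℝ, 0 < κ ∧ κ ≤ 1 / 2 ∧ 0 < β ∧ 0 < η ∧ ∀ {Ω T v Dv p v₀}, IsSuitableWeakSolution Ω T v Dv p v₀ → IsOpen Ω →
    ∀ {xo : E3} {tq R : ℝ}, 0 < R → ball xo R ⊆ Ω → 0 ≤ tq - R ^ 2 → tq + R ^ 2 ≤ T → Dat v Dv p xo tq R η η η →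
    ∀ k : ℕ, ∃ ε δ, Dat v Dv p xo tq ((κ ^ 6) ^ k * R) (β * (κ ^ 6) ^ k) ε δ := by
  obtain ⟨C, hC, hE⟩ := energy
  obtain ⟨D, hD, hT⟩ := time_D
  obtain ⟨κ, β, η, k0, k1, b0, b1, e0, e1, c1, c2, c3, c4⟩ := stepA_const C D hC hD
  refine ⟨κ, β ^ 3, η, k0, k1, by positivity, e0, fun {Ω T v Dv p v₀} hs hΩ {xo tq R} hR hB h0 h1 hd => ?_⟩
  obtain ⟨Rk, hRk⟩ : ∃ Rk : ℕ → ℝ, Rk = fun k => (κ ^ 6) ^ k * R := ⟨_, rfl⟩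
  obtain ⟨μ, hμ⟩ : ∃ μ : ℕ → ℝ, μ = fun k => if k = 0 then η else β ^ 3 * (κ ^ 6) ^ k := ⟨_, rfl⟩
  obtain ⟨δ, hδ⟩ : ∃ δ : ℕ → ℝ, δ = fun k => β ^ 2 * (κ ^ 4) ^ k := ⟨_, rfl⟩
  have Rk0 : ∀ k, 0 < Rk k := fun k => by rw [hRk]; positivity
  have μ0 : ∀ k, 0 < μ k := fun k => by rw [hμ]; dsimp only; split_ifs <;> positivity
  have δ0 : ∀ k, 0 < δ k := fun k => by rw [hδ]; positivity
  have μle : ∀ k, μ k ≤ β ^ 3 * (κ ^ 6) ^ k := fun k => by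
    rw [hμ]; dsimp only; split_ifs with h
    · rw [h]; simpa using e1
    · exact le_rfl
  have κ6 : κ ^ 6 ≤ 1 / 8 := (pow_le_pow_left₀ k0.le k1 6).trans (by norm_num)
  have κ60 : 0 < κ ^ 6 := by positivity
  have Rs : ∀ k, Rk (k + 1) = κ ^ 6 * Rk k := fun k => by rw [hRk]; ring
  have Rd : ∀ k, Rk (k + 1) ≤ Rk k := fun k => by rw [Rs]; nlinarith [Rk0 k]
  have anti : ∀ k, Rk k ≤ Rk 0 := fun k => antitone_nat_of_succ_le Rd (Nat.zero_le k)
  have R00 : Rk 0 = R := by rw [hRk]; simp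
  have main : ∀ n k, k ≤ n → Dat v Dv p xo tq (Rk k) (μ k) (μ k) (δ k) := by
    intro n
    induction n with
    | zero =>
      intro k hk
      obtain rfl : k = 0 := by omega
      have : β ^ 3 ≤ β ^ 2 := pow_le_pow_of_le_one b0.le b1 (by norm_num)
      have := hd.mono hR.le e0.le e0.le e0.le le_rfl le_rfl (e1.trans this)
      rw [R00, hμ, hδ]; simpa using this
    | succ n ih =>
      intro k hk
      rcases Nat.lt_or_ge k (n + 1) with h | h
      · exact ih k (by omega)
      obtain rfl : k = n + 1 := by omega
      have μe : μ (n + 1) = β ^ 3 * (κ ^ 6) ^ (n + 1) := by rw [hμ]; simp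
      have en := hE hs hΩ (xo := xo) (tq := tq) (n := n) Rk0 Rd (by
        have := Rd n; rw [Rs]; have := anti n; nlinarith [Rk0 n]) (by rwa [R00]) (by rwa [R00]) (by rwa [R00]) μ0 μ0 δ0 ih (μ (n + 1) ^ 2) (by
        have t1 : ∀ k, Rk k ^ 2 / Rk (k + 1) ^ 4 * (μ k * μ k * (μ k + μ k) + μ k * δ k ^ 2) ≤ 3 * β ^ 7 / (κ ^ 24 * R ^ 2) * (κ ^ 2) ^ k := by
          intro k
          have e : 3 * β ^ 7 / (κ ^ 24 * R ^ 2) * (κ ^ 2) ^ k = Rk k ^ 2 / Rk (k + 1) ^ 4 * (3 * β ^ 7 * (κ ^ 14) ^ k) := by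
            rw [hRk]; dsimp only
            have : (κ ^ 14) ^ k = (κ ^ 2) ^ k * ((κ ^ 6) ^ k) ^ 2 := by ring
            rw [this]; field_simp; ring
          rw [e]
          refine mul_le_mul_of_nonneg_left ?_ (by have := Rk0 k; have := Rk0 (k + 1); positivity)
          have a1 := μle k
          have a2 : μ k * μ k * (μ k + μ k) + μ k * δ k ^ 2 ≤ (β ^ 3 * (κ ^ 6) ^ k) * (β ^ 3 * (κ ^ 6) ^ k) *
              ((β ^ 3 * (κ ^ 6) ^ k) + (β ^ 3 * (κ ^ 6) ^ k)) + (β ^ 3 * (κ ^ 6) ^ k) * δ k ^ 2 := by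
            have := (μ0 k).le; gcongr
          refine a2.trans ?_
          rw [hδ]; dsimp only
          have a3 : (β ^ 3 * (κ ^ 6) ^ k) * (β ^ 3 * (κ ^ 6) ^ k) * ((β ^ 3 * (κ ^ 6) ^ k) + (β ^ 3 * (κ ^ 6) ^ k)) +
              (β ^ 3 * (κ ^ 6) ^ k) * (β ^ 2 * (κ ^ 4) ^ k) ^ 2 = 2 * (β ^ 7 * (κ ^ 14) ^ k) * (β ^ 2 * (κ ^ 4) ^ k) + β ^ 7 * (κ ^ 14) ^ k := by ring
          have a4 : β ^ 2 * (κ ^ 4) ^ k ≤ 1 := mul_le_one₀ (pow_le_one₀ b0.le b1) pz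
            (pow_le_one₀ pz (pow_le_one₀ k0.le (by linarith)))
          rw [a3]
          have : 0 < β ^ 7 * (κ ^ 14) ^ k := by positivity
          nlinarith
        have gs : ∑ k ∈ Finset.range (n + 1), (κ ^ 2) ^ k ≤ 2 := by
          have hk2 : κ ^ 2 ≤ 1 / 2 := by nlinarith
          calc _ ≤ ∑ k ∈ Finset.range (n + 1), (1 / 2 : ℝ) ^ k := Finset.sum_le_sum fun k _ => pow_le_pow_left₀ pz hk2 k
            _ ≤ 2 := sum_geometric_two_le _
        have t2 := Finset.sum_le_sum fun k (_ : k ∈ Finset.range (n + 1)) => t1 k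
        rw [← Finset.mul_sum] at t2
        have t3 := t2.trans (mul_le_mul_of_nonneg_left gs pz)
        have m0 : μ 0 = η := by rw [hμ]; simp
        have q : Rk (n + 1) ^ 2 = ((κ ^ 6) ^ (n + 1)) ^ 2 * R ^ 2 := by rw [hRk]; ring
        rw [q, m0, R00, μe]
        obtain ⟨X, hX⟩ : ∃ X, X = ((κ ^ 6) ^ (n + 1)) := ⟨_, rfl⟩
        rw [← hX]
        have X0 : 0 < X := by rw [hX]; positivity
        calc _ ≤ C * (X ^ 2 * R ^ 2 * (η ^ 2 / R ^ 2 + 3 * β ^ 7 / (κ ^ 24 * R ^ 2) * 2)) := by gcongr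
          _ = X ^ 2 * (C * η ^ 2 + β ^ 6 * (6 * C * β) / κ ^ 24) := by field_simp; ring
          _ ≤ X ^ 2 * (β ^ 6 / 2 + β ^ 6 * (κ ^ 24 / 2) / κ ^ 24) := by gcongr
          _ = _ := by field_simp; ring)
      have tm := hT hs hΩ (Rk0 n) ((ball_subset_ball ((anti n).trans_eq R00)).trans hB) (by
        have := pow_le_pow_left₀ (Rk0 n).le ((anti n).trans_eq R00) 2
        exact Ioo_subset_Ioo (by linarith) (by linarith [sq_nonneg R])) (μ0 n) (μ0 n) (δ0 n) (ih n le_rfl) (μ n) (κ ^ 3) (μ0 n) (sq _) pz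
        (by rw [← pow_mul]; linarith)
      rw [show (κ ^ 3) ^ 2 * Rk n = Rk (n + 1) by rw [Rs]; ring] at tm
      refine ⟨en.1, en.2, tm.trans (ofReal_le_ofReal (mul_le_mul_of_nonneg_right ?_ (by have := Rk0 (n + 1); positivity)))⟩
      have a1 := pow_le_pow_left₀ (μ0 n).le (μle n) 3
      have a5 : (κ ^ 18) ^ n ≤ (κ ^ 12) ^ n := pow_le_pow_left₀ pz (pow_le_pow_of_le_one k0.le (by linarith) (by norm_num)) n
      rw [hδ]; dsimp only
      calc _ ≤ D * ((κ ^ 3) ^ 5 * (β ^ 2 * (κ ^ 4) ^ n) ^ 3 + (κ ^ 3)⁻¹ ^ 4 * (β ^ 3 * (κ ^ 6) ^ n) ^ 3) := by gcongr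
        _ = (κ ^ 12 * β ^ 6 * (κ ^ 12) ^ n) * (D * κ ^ 3) + κ⁻¹ ^ 12 * β ^ 6 * (κ ^ 18) ^ n * (D * β ^ 3) := by ring
        _ ≤ (κ ^ 12 * β ^ 6 * (κ ^ 12) ^ n) * (1 / 2) + κ⁻¹ ^ 12 * β ^ 6 * (κ ^ 12) ^ n * (κ ^ 24 / 2) := by gcongr
        _ = _ := by rw [pow_succ]; field_simp; ring
  intro k
  have := (main k k le_rfl).mono (Rk0 k).le (μ0 k).le (μ0 k).le (δ0 k).le (μle k) le_rfl le_rfl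
  rw [hRk] at this
  exact ⟨_, _, this⟩

lemma ev_small (M w : ℝ) (hw : 0 < w) : ∀ᶠ b in 𝓝[>] (0 : ℝ), M * b ≤ w := by
  have : Tendsto (fun b : ℝ => M * b) (𝓝[>] 0) (𝓝 (M * 0)) := ((continuous_const.mul continuous_id).tendsto 0).mono_left nhdsWithin_le_nhds
  rw [mul_zero] at this
  exact (this.eventually (gt_mem_nhds hw)).mono fun _ h => h.le

lemma stepB_alg {C c k ki N e m d t c' : ℝ} (hk : 0 < k) (hki : 0 < ki) (hC : 0 < C) (hc : 0 < c) (hN : 0 < N) (he : 0 < e) (he1 : e ≤ 1)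
    (hm : 0 < m) (hd : 0 < d) (ht : 0 < t) (tt : t ^ 2 = m * e) (hc' : c' = C * ki ^ 12) (hNc : N = 8 * c' ^ 2)
    (g1 : C * k ^ 12 ≤ 1 / 8) (g2 : 8 * c ^ 4 * k ^ 20 ≤ 1 / 4) (g3 : 16 * c' * e ≤ 1) (g4 : 64 * c ^ 4 * N * ki ^ 16 * e ≤ 1) :
    C * (k ^ 12 * m ^ 2 + ki ^ 12 * (e * m * (e + m) + m * d ^ 2)) + N * (c * (k ^ 5 * d + ki ^ 4 * t)) ^ 4 ≤ (m ^ 2 + N * d ^ 4) / 2 + c' * e ^ 2 := by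
  have c0 : 0 < c' := by rw [hc']; positivity
  have p4 : (c * (k ^ 5 * d + ki ^ 4 * t)) ^ 4 ≤ 8 * c ^ 4 * (k ^ 20 * d ^ 4 + ki ^ 16 * t ^ 4) := by
    have := add_pow_le (show 0 ≤ k ^ 5 * d by positivity) (show 0 ≤ ki ^ 4 * t by positivity) 4
    rw [mul_pow]
    have h2 := mul_le_mul_of_nonneg_left this (show 0 ≤ c ^ 4 by positivity)
    refine h2.trans (le_of_eq ?_); norm_num; ring
  have t4 : t ^ 4 = m ^ 2 * e ^ 2 := by rw [show t ^ 4 = (t ^ 2) ^ 2 by ring, tt]; ring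
  rw [t4] at p4
  have e2 : e ^ 2 ≤ e := by nlinarith
  have m2 : 0 < m ^ 2 := by positivity
  have d4 : 0 < d ^ 4 := by positivity
  have q1 := mul_le_mul_of_nonneg_right g1 m2.le
  have q2 := mul_le_mul_of_nonneg_right g2 (show 0 ≤ N * d ^ 4 by positivity)
  have q3 : c' * (e * m * (e + m)) ≤ c' * e ^ 2 + m ^ 2 / 8 := by
    have : e * m * (e + m) ≤ e ^ 2 + 2 * e * m ^ 2 := by
      nlinarith [mul_le_mul_of_nonneg_right e2 m2.le, sq_nonneg (m - 1), mul_nonneg (sq_nonneg e) (sq_nonneg (m - 1)), sq_nonneg (e * m)]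
    linarith [mul_le_mul_of_nonneg_left this c0.le, mul_le_mul_of_nonneg_right g3 m2.le]
  have q4 : c' * (m * d ^ 2) ≤ m ^ 2 / 8 + N * d ^ 4 / 4 := by
    rw [hNc]; linarith [sq_nonneg (m - 4 * c' * d ^ 2)]
  have q5 : N * (8 * c ^ 4 * (ki ^ 16 * (m ^ 2 * e ^ 2))) ≤ m ^ 2 / 8 := by
    have a : 0 ≤ 8 * (c ^ 4 * N * ki ^ 16 * m ^ 2) := by positivity
    have := mul_le_mul_of_nonneg_left e2 a
    linarith [mul_le_mul_of_nonneg_right g4 m2.le]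
  have q6 := mul_le_mul_of_nonneg_left p4 hN.le
  rw [hc'] at q3 q4 ⊢
  linarith

lemma stepB_const (C D η : ℝ) (hC : 0 < C) (hD : 0 < D) (hη : 0 < η) : ∃ κ N c' b : ℝ, 0 < κ ∧ κ ≤ 1 / 2 ∧ 0 < N ∧ 0 < c' ∧ 0 < b ∧ b ^ 2 ≤ η ∧
    3 * c' * (b ^ 2) ^ 2 ≤ η ^ 2 ∧ 3 * c' * (b ^ 2) ^ 2 ≤ N * η ^ 4 ∧ ∀ a δ : ℝ, 0 < a → 0 < δ → ∃ a' δ', 0 < a' ∧ 0 < δ' ∧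
    C * (κ ^ 12 * (a ^ 2) ^ 2 + κ⁻¹ ^ 12 * (b ^ 2 * a ^ 2 * (b ^ 2 + a ^ 2) + a ^ 2 * δ ^ 2)) ≤ (a' ^ 2) ^ 2 ∧
    D * ((κ ^ 3) ^ 5 * δ ^ 3 + (κ ^ 3)⁻¹ ^ 4 * (a * b) ^ 3) ≤ δ' ^ 3 ∧
    (a' ^ 2) ^ 2 + N * δ' ^ 4 ≤ ((a ^ 2) ^ 2 + N * δ ^ 4) / 2 + c' * (b ^ 2) ^ 2 := by
  obtain ⟨κ, hκ⟩ : ∃ κ, κ = 1 / (8 * (1 + C) * (1 + D)) := ⟨_, rfl⟩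
  have k0 : 0 < κ := by rw [hκ]; positivity
  have kD : κ * (8 * (1 + C) * (1 + D)) = 1 := by rw [hκ]; field_simp
  have kC := mul_pos k0 hC
  have kDD := mul_pos k0 hD
  have kCD := mul_pos kC hD
  have k1 : κ ≤ 1 / 2 := by linarith
  have g1 : C * κ ^ 12 ≤ 1 / 8 := by
    have : κ ^ 12 ≤ κ := by simpa using pow_le_pow_of_le_one k0.le (by linarith) (show 1 ≤ 12 by norm_num)
    linarith [mul_le_mul_of_nonneg_left this hC.le]
  have g2 : 8 * (1 + D) ^ 4 * κ ^ 20 ≤ 1 / 4 := by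
    have a1 : ((1 + D) * κ) ^ 4 ≤ (1 / 8) ^ 4 := pow_le_pow_left₀ pz (by linarith) 4
    have a2 : κ ^ 16 ≤ 1 := pow_le_one₀ k0.le (by linarith)
    have : 8 * (1 + D) ^ 4 * κ ^ 20 = 8 * ((1 + D) * κ) ^ 4 * κ ^ 16 := by ring
    rw [this]
    have a3 : 0 ≤ ((1 + D) * κ) ^ 4 := by positivity
    linarith [mul_le_mul_of_nonneg_left a2 a3]
  obtain ⟨c', hc'⟩ : ∃ c', c' = C * κ⁻¹ ^ 12 := ⟨_, rfl⟩
  have c0 : 0 < c' := by rw [hc']; positivity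
  obtain ⟨N, hN⟩ : ∃ N, N = 8 * c' ^ 2 := ⟨_, rfl⟩
  have N0 : 0 < N := by rw [hN]; positivity
  obtain ⟨b, b0, b1, b2, b3, b4, b5, b6⟩ := ((show ∀ᶠ b in 𝓝[>] (0 : ℝ), b ∈ Ioi (0 : ℝ) from self_mem_nhdsWithin).and ((ev_small 1 1 one_pos).and
    ((ev_small 1 η hη).and ((ev_small (3 * c') _ (sq_pos_of_pos hη)).and ((ev_small (3 * c') (N * η ^ 4) pz).and
    ((ev_small (16 * c') 1 one_pos).and (ev_small (64 * (1 + D) ^ 4 * N * κ⁻¹ ^ 16) 1 one_pos))))))).exists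
  replace b0 : 0 < b := b0
  rw [one_mul] at b1 b2
  have bb2 : b ^ 2 ≤ b := by nlinarith
  have bb4 : (b ^ 2) ^ 2 ≤ b := by nlinarith [sq_nonneg b]
  refine ⟨κ, N, c', b, k0, k1, N0, c0, b0, bb2.trans b2, (mul_le_mul_of_nonneg_left bb4 pz).trans b3,
    (mul_le_mul_of_nonneg_left bb4 pz).trans b4, fun a δ ha hδ => ?_⟩
  obtain ⟨K, hK⟩ : ∃ K, K = C * (κ ^ 12 * (a ^ 2) ^ 2 + κ⁻¹ ^ 12 * (b ^ 2 * a ^ 2 * (b ^ 2 + a ^ 2) + a ^ 2 * δ ^ 2)) := ⟨_, rfl⟩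
  have K0 : 0 < K := by rw [hK]; positivity
  have Ks : (√(√K) ^ 2) ^ 2 = K := by rw [Real.sq_sqrt (Real.sqrt_nonneg _), Real.sq_sqrt K0.le]
  refine ⟨√(√K), (1 + D) * (κ ^ 5 * δ + κ⁻¹ ^ 4 * (a * b)), by positivity, by positivity, by rw [Ks, hK], ?_, ?_⟩
  · have k' : 0 < κ⁻¹ := inv_pos.2 k0
    have a1 : (κ ^ 5 * δ) ^ 3 + (κ⁻¹ ^ 4 * (a * b)) ^ 3 ≤ (κ ^ 5 * δ + κ⁻¹ ^ 4 * (a * b)) ^ 3 := by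
      have h1 : 0 < κ ^ 5 * δ := by positivity
      have h2 : 0 < κ⁻¹ ^ 4 * (a * b) := by positivity
      linarith [mul_pos h1 h2, mul_pos (mul_pos h1 h2) h1, mul_pos (mul_pos h1 h2) h2]
    have a2 : D ≤ (1 + D) ^ 3 := by linarith [mul_pos hD hD, mul_pos (mul_pos hD hD) hD]
    calc _ = D * ((κ ^ 5 * δ) ^ 3 + (κ⁻¹ ^ 4 * (a * b)) ^ 3) := by rw [← inv_pow]; ring
      _ ≤ (1 + D) ^ 3 * (κ ^ 5 * δ + κ⁻¹ ^ 4 * (a * b)) ^ 3 := mul_le_mul a2 a1 pz pz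
      _ = _ := by ring
  · rw [Ks, hK]
    exact stepB_alg k0 (inv_pos.2 k0) hC pz N0 pz (bb2.trans b1) pz hδ pz (by ring) hc' hN g1 g2
      ((mul_le_mul_of_nonneg_left bb2 pz).trans b5) ((mul_le_mul_of_nonneg_left bb2 pz).trans b6)

lemma stepB {η : ℝ} (hη : 0 < η) : ∃ b : ℝ, 0 < b ∧ ∀ {Ω T v Dv p v₀}, IsSuitableWeakSolution Ω T v Dv p v₀ → IsOpen Ω →
    ∀ {xo : E3} {tq R a δ : ℝ}, 0 < R → ball xo R ⊆ Ω → 0 ≤ tq - R ^ 2 → tq + R ^ 2 ≤ T → 0 < a → 0 < δ → Dat v Dv p xo tq R (a ^ 2) (b ^ 2) δ →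
    (∀ ρ, 0 < ρ → ρ ≤ R → ∫⁻ t in Ioo (tq - ρ ^ 2) tq, Ht Dv xo ρ t ≤ oR ((b ^ 2) ^ 2 * ρ)) →
    ∃ ρ, 0 < ρ ∧ ρ ≤ R ∧ Dat v Dv p xo tq ρ η η η := by
  obtain ⟨C, hC, hE⟩ := energy
  obtain ⟨D, hD, hT⟩ := time_D
  obtain ⟨κ, N, c', b, k0, k1, N0, c0, b0, b1, b2, b3, hst⟩ := stepB_const C D η hC hD hη
  refine ⟨b, b0, fun {Ω T v Dv p v₀} hs hΩ {xo tq R a δ} hR hB h0 h1 ha hδ hd hb => ?_⟩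
  have κ6 : κ ^ 6 ≤ 1 / 8 := (pow_le_pow_left₀ k0.le k1 6).trans (by norm_num)
  have κ60 : 0 < κ ^ 6 := by positivity
  have main : ∀ k : ℕ, ∃ ρ a' δ', 0 < ρ ∧ ρ ≤ R ∧ 0 < a' ∧ 0 < δ' ∧ Dat v Dv p xo tq ρ (a' ^ 2) (b ^ 2) δ' ∧
      (a' ^ 2) ^ 2 + N * δ' ^ 4 ≤ ((a ^ 2) ^ 2 + N * δ ^ 4) * (1 / 2) ^ k + 2 * c' * (b ^ 2) ^ 2 := by
    intro k
    induction k with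
    | zero => exact ⟨R, a, δ, hR, le_rfl, ha, hδ, hd, by rw [pow_zero, mul_one]; exact le_add_of_nonneg_right pz⟩
    | succ k ih =>
      obtain ⟨ρ, a₁, δ₁, hρ, hρR, ha₁, hδ₁, hd₁, hy⟩ := ih
      obtain ⟨a', δ', ha', hδ', f1, f2, f3⟩ := hst a₁ δ₁ ha₁ hδ₁
      have ρ2 := pow_le_pow_left₀ hρ.le hρR 2
      have hBρ := (ball_subset_ball hρR).trans hB
      have en := hE hs hΩ (xo := xo) (tq := tq) (n := 0) (Rk := fun k => (κ ^ 6) ^ k * ρ) (fun k => by positivity) (fun k => mul_le_mul_of_nonneg_right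
        (pow_le_pow_of_le_one κ60.le (by linarith) (Nat.le_succ k)) hρ.le) (by simp only [zero_add, pow_one, pow_zero, one_mul]; linarith [mul_le_mul_of_nonneg_right κ6 hρ.le]) (by simpa using hBρ)
        (by simp only [pow_zero, one_mul]; linarith) (by simp only [pow_zero, one_mul]; linarith) (μ := fun _ => a₁ ^ 2) (ε := fun _ => b ^ 2) (δ := fun _ => δ₁)
        (fun _ => by positivity) (fun _ => by positivity) (fun _ => hδ₁) (fun k hk => by
          obtain rfl : k = 0 := by omega
          simpa using hd₁) ((a' ^ 2) ^ 2) (by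
          refine le_trans (le_of_eq ?_) f1
          simp only [zero_add, pow_one, pow_zero, one_mul, Finset.sum_range_one]
          field_simp)
      have tm := hT hs hΩ hρ hBρ (Ioo_subset_Ioo (by linarith) (by linarith [sq_nonneg R])) pz pz hδ₁ hd₁ (a₁ * b) (κ ^ 3) pz
        (by ring) pz (by rw [← pow_mul]; linarith)
      rw [show (κ ^ 3) ^ 2 = κ ^ 6 by ring] at tm
      simp only [zero_add, pow_one] at en
      have r1 : κ ^ 6 * ρ ≤ R := (mul_le_of_le_one_left hρ.le (by linarith)).trans hρR
      refine ⟨κ ^ 6 * ρ, a', δ', by positivity, r1, ha', hδ', ⟨en.1, hb _ pz r1, tm.trans (ofReal_le_ofReal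
        (mul_le_mul_of_nonneg_right f2 pz))⟩, f3.trans ?_⟩
      rw [pow_succ (1 / 2 : ℝ)]; linarith
  have lim : Tendsto (fun k : ℕ => ((a ^ 2) ^ 2 + N * δ ^ 4) * (1 / 2 : ℝ) ^ k) atTop (𝓝 0) := by
    simpa using (tendsto_pow_atTop_nhds_zero_of_lt_one (by norm_num : (0 : ℝ) ≤ 1 / 2) (by norm_num)).const_mul ((a ^ 2) ^ 2 + N * δ ^ 4)
  obtain ⟨k, hk⟩ := (lim.eventually (gt_mem_nhds (show 0 < c' * (b ^ 2) ^ 2 by positivity))).exists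
  obtain ⟨ρ, a', δ', hρ, hρR, ha', hδ', hd', hy⟩ := main k
  refine ⟨ρ, hρ, hρR, hd'.mono hρ.le pz pz hδ'.le ?_ b1 ?_⟩
  · refine le_of_sq_le_sq ?_ hη.le
    have : 0 < N * δ' ^ 4 := by positivity
    linarith
  · refine le_of_pow_le_pow_left₀ (n := 4) (by norm_num) hη.le (le_of_mul_le_mul_left ?_ N0)
    have : 0 < (a' ^ 2) ^ 2 := by positivity
    linarith

lemma Dat.shift {v Dv p} {xo x : E3} {tq t R η : ℝ} (h : Dat v Dv p xo tq R (η / 8) (η / 8) (η / 8)) (hR : 0 < R) (hη : 0 < η)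
    (hx : x ∈ ball xo (R / 2)) (ht : t ≤ tq) (ht' : tq - R ^ 2 / 2 ≤ t) : Dat v Dv p x t (R / 2) η η η := by
  have hb : ball x (R / 2) ⊆ ball xo R := ball_subset_ball' (by have := mem_ball.1 hx; linarith)
  have hw : Ioo (t - (R / 2) ^ 2) t ⊆ Ioo (tq - R ^ 2) tq := Ioo_subset_Ioo (by nlinarith) ht
  refine ⟨?_, ?_, ?_⟩
  · have : ∀ᵐ s ∂(volume.restrict (Ioo (t - (R / 2) ^ 2) t)), Vt v xo R s ≤ oR ((η / 8) ^ 2 * R) :=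
      ae_mono (Measure.restrict_mono hw le_rfl) h.A
    refine this.mono fun s hs => (lintegral_mono_set hb).trans (hs.trans (ofReal_le_ofReal ?_))
    have : 0 < η ^ 2 * R := by positivity
    linarith
  · refine (lintegral_mono fun s => lintegral_mono_set hb).trans ((lintegral_mono_set hw).trans (h.E.trans (ofReal_le_ofReal ?_)))
    have : 0 < η ^ 2 * R := by positivity
    linarith
  · refine (lintegral_mono fun s => rpow_le_rpow ?_ (by norm_num)).trans
      ((lintegral_mono_set hw).trans (h.D.trans (ofReal_le_ofReal ?_)))
    · exact (lintegral_mono fun y => lintegral_mono_set hb).trans (lintegral_mono_set hb)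
    · have : 0 < η ^ 3 * R ^ 8 := by positivity
      linarith

lemma An_le {p : E3 → ℝ} (mp : Measurable p) (xo : E3) (R : ℝ) : An p xo R ^ (3 / 2 : ℝ) ≤
    (2 * volume (ball xo R) * volume (ball xo R) ^ (1 / 3 : ℝ)) ^ (3 / 2 : ℝ) * ∫⁻ x in ball xo R, ‖p x‖ₑ ^ (3 / 2 : ℝ) := by
  have h1 : An p xo R ≤ 2 * volume (ball xo R) * ∫⁻ x in ball xo R, ‖p x‖ₑ := by
    unfold An
    calc _ ≤ ∫⁻ x in ball xo R, ∫⁻ y in ball xo R, (‖p x‖ₑ + ‖p y‖ₑ) := lintegral_mono fun x => lintegral_mono fun y => enorm_sub_le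
      _ = ∫⁻ x in ball xo R, (‖p x‖ₑ * volume (ball xo R) + ∫⁻ y in ball xo R, ‖p y‖ₑ) := lintegral_congr fun x => by
        rw [lintegral_add_left measurable_const, lintegral_const, Measure.restrict_apply_univ]
      _ = _ := by
        rw [lintegral_add_right _ measurable_const, lintegral_mul_const _ mp.enorm, lintegral_const, Measure.restrict_apply_univ]; ring
  have h2 := ENNReal.lintegral_mul_le_Lp_mul_Lq (volume.restrict (ball xo R)) (p := 3 / 2) (q := 3)
    ⟨by norm_num, by norm_num, by norm_num⟩ (f := fun x => ‖p x‖ₑ) (g := fun _ => 1) mp.enorm.aemeasurable aemeasurable_const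
  simp only [Pi.mul_apply, mul_one, ENNReal.one_rpow, lintegral_const, Measure.restrict_apply_univ, one_mul] at h2
  calc _ ≤ (2 * volume (ball xo R) * ((∫⁻ x in ball xo R, ‖p x‖ₑ ^ (3 / 2 : ℝ)) ^ (1 / (3 / 2) : ℝ) * volume (ball xo R) ^ (1 / 3 : ℝ))) ^ (3 / 2 : ℝ) :=
        rpow_le_rpow (h1.trans (mul_le_mul' le_rfl h2)) (by norm_num)
    _ = ((2 * volume (ball xo R) * volume (ball xo R) ^ (1 / 3 : ℝ)) * (∫⁻ x in ball xo R, ‖p x‖ₑ ^ (3 / 2 : ℝ)) ^ (1 / (3 / 2) : ℝ)) ^ (3 / 2 : ℝ) := by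
        congr 1; ring
    _ = _ := by
        rw [ENNReal.mul_rpow_of_nonneg _ _ (by norm_num : (0 : ℝ) ≤ 3 / 2), ← rpow_mul]
        norm_num

lemma le_ofReal_sq {x : ℝ≥0∞} (hx : x ≠ ∞) {c : ℝ} (hc : 0 < c) {n : ℕ} (hn : n ≠ 0) : ∃ a : ℝ, 0 < a ∧ x ≤ oR (a ^ n * c) := by
  refine ⟨1 + x.toReal / c, by positivity, ?_⟩
  rw [← ofReal_toReal hx]
  refine ofReal_le_ofReal ?_
  rw [ofReal_toReal hx]
  have h0 : 0 ≤ x.toReal / c := by positivity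
  have h1 : 1 + x.toReal / c ≤ (1 + x.toReal / c) ^ n := le_self_pow₀ (by linarith) hn
  calc x.toReal = x.toReal / c * c := by field_simp
    _ ≤ _ := mul_le_mul_of_nonneg_right (by linarith) hc.le

lemma Dat_init {Ω T v Dv p v₀} (hs : IsSuitableWeakSolution Ω T v Dv p v₀) {xo : E3} {tq R b : ℝ} (hR : 0 < R)
    (hB : ball xo R ⊆ Ω) (h0 : 0 ≤ tq - R ^ 2) (h1 : tq ≤ T)
    (hE : ∫⁻ t in Ioo (tq - R ^ 2) tq, Ht Dv xo R t ≤ oR ((b ^ 2) ^ 2 * R)) :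
    ∃ a δ : ℝ, 0 < a ∧ 0 < δ ∧ Dat v Dv p xo tq R (a ^ 2) (b ^ 2) δ := by
  have hw : Ioo (tq - R ^ 2) tq ⊆ Ioo 0 T := Ioo_subset_Ioo h0 h1
  have hv := hs.v_linf_l2
  unfold MemMixed mixedNorm at hv
  rw [if_pos rfl] at hv
  obtain ⟨M, hM⟩ : ∃ M, M = essSup (fun t => eLpNorm (fun x => v (x, t)) 2 (volume.restrict Ω)) (volume.restrict (Ioo 0 T)) := ⟨_, rfl⟩
  rw [← hM] at hv
  have hA : ∀ᵐ t ∂(volume.restrict (Ioo 0 T)), eLpNorm (fun x => v (x, t)) 2 (volume.restrict Ω) ≤ M := hM ▸ ENNReal.ae_le_essSup _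
  have hA' : ∀ᵐ t ∂(volume.restrict (Ioo (tq - R ^ 2) tq)), eLpNorm (fun x => v (x, t)) 2 (volume.restrict Ω) ≤ M :=
    ae_mono (Measure.restrict_mono hw le_rfl) hA
  obtain ⟨a, ha, hMa⟩ := le_ofReal_sq (x := M ^ 2) (by finiteness) hR (n := 4) (by norm_num)
  have hP : ∫⁻ z in Ω ×ˢ Ioo 0 T, ‖p z‖ₑ ^ (3 / 2 : ℝ) < ∞ := by
    have := hs.p_l32.2
    refine lt_of_eq_of_lt (lintegral_congr fun z => ?_) this
    change _ = ‖|p z| ^ (3 / 2 : ℝ)‖ₑ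
    rw [Real.enorm_eq_ofReal_abs (p z), ofReal_rpow_of_nonneg (abs_nonneg _) (by norm_num), ← Real.enorm_eq_ofReal pz]
  have hP2 : ∫⁻ t in Ioo (tq - R ^ 2) tq, ∫⁻ x in ball xo R, ‖p (x, t)‖ₑ ^ (3 / 2 : ℝ) < ∞ := by
    refine lt_of_le_of_lt ?_ hP
    have m : Measurable fun z => ‖p z‖ₑ ^ (3 / 2 : ℝ) := hs.meas_p.enorm.pow_const _
    rw [← lintegral_prod_symm' _ m, Measure.prod_restrict, ← Measure.volume_eq_prod]
    exact lintegral_mono_set (prod_mono hB hw)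
  obtain ⟨c, hc⟩ : ∃ c, c = (2 * volume (ball xo R) * volume (ball xo R) ^ (1 / 3 : ℝ)) ^ (3 / 2 : ℝ) := ⟨_, rfl⟩
  have cf : c ≠ ∞ := by
    rw [hc, vol_ball xo R hR]
    finiteness
  have hD : ∫⁻ t in Ioo (tq - R ^ 2) tq, At p xo R t ^ (3 / 2 : ℝ) < ∞ := by
    calc _ ≤ ∫⁻ t in Ioo (tq - R ^ 2) tq, c * ∫⁻ x in ball xo R, ‖p (x, t)‖ₑ ^ (3 / 2 : ℝ) := lintegral_mono fun t => by
          rw [hc]; exact An_le (hs.meas_p.comp measurable_prodMk_right) xo R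
      _ = c * ∫⁻ t in Ioo (tq - R ^ 2) tq, ∫⁻ x in ball xo R, ‖p (x, t)‖ₑ ^ (3 / 2 : ℝ) := lintegral_const_mul' _ _ cf
      _ < ∞ := ENNReal.mul_lt_top cf.lt_top hP2
  obtain ⟨δ, hδ, hDδ⟩ := le_ofReal_sq hD.ne (c := R ^ 8) pz (n := 3) (by norm_num)
  refine ⟨a, δ, ha, hδ, ⟨hA'.mono fun t ht => ?_, hE, hDδ⟩⟩
  rw [show (a ^ 2) ^ 2 = a ^ 4 by ring]
  refine le_trans ?_ hMa
  refine le_trans ?_ (pow_le_pow_left' ht 2)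
  rw [eLpNorm_eq_lintegral_rpow_enorm_toReal (by norm_num) (by norm_num), ← rpow_natCast, ← rpow_mul]
  simp only [ENNReal.toReal_ofNat, rpow_ofNat, Nat.cast_ofNat, one_div, ne_eq, OfNat.ofNat_ne_zero, not_false_eq_true, inv_mul_cancel₀, rpow_one]
  exact lintegral_mono_set hB

lemma leb_bdd {f : E3 → ℝ≥0∞} (mf : Measurable f) {xo : E3} {r M : ℝ} (hM : 0 < M) {ρ : ℕ → ℝ} (hρ : ∀ k, 0 < ρ k)
    (hl : Tendsto ρ atTop (𝓝 0)) (h : ∀ y ∈ ball xo r, ∀ k, ∫⁻ x in ball y (ρ k / 2), f x ≤ oR (M * ρ k ^ 3)) :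
    ∀ᵐ y ∂(volume.restrict (ball xo r)), f y ≤ oR (64 * M / bb) := by
  have hbb := bb_pos
  obtain ⟨c, hc⟩ : ∃ c, c = oR (64 * M / bb) := ⟨_, rfl⟩
  have hcf : c ≠ ∞ := hc ▸ ofReal_ne_top
  haveI : IsLocallyFiniteMeasure (c • (volume : Measure E3)) := ⟨fun x => ⟨ball x 1, ball_mem_nhds x one_pos, by
    rw [Measure.smul_apply, smul_eq_mul]; exact ENNReal.mul_lt_top hcf.lt_top measure_ball_lt_top⟩⟩
  rw [← hc]
  refine ae_le_of_forall_setLIntegral_le_of_sigmaFinite (g := fun _ => c) mf fun s hs _ => ?_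
  rw [Measure.restrict_restrict hs, setLIntegral_const, ← withDensity_apply _ (hs.inter measurableSet_ball)]
  refine (Besicovitch.vitaliFamily (volume : Measure E3)).measure_le_of_frequently_le (ρ := volume.withDensity f) (c • volume)
    (withDensity_absolutelyContinuous _ _) _ fun y hy => ?_
  have ht : Tendsto (fun k => ρ k / 4) atTop (𝓝[>] 0) := tendsto_nhdsWithin_iff.2 ⟨by simpa using hl.div_const 4,
    Eventually.of_forall fun k => by have := hρ k; exact mem_Ioi.2 pz⟩
  refine ((Besicovitch.tendsto_filterAt volume y).comp ht).frequently (Eventually.of_forall fun k => ?_).frequently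
  have hk := hρ k
  rw [Function.comp_apply, withDensity_apply _ measurableSet_closedBall, Measure.smul_apply, smul_eq_mul]
  calc _ ≤ ∫⁻ x in ball y (ρ k / 2), f x := lintegral_mono_set (closedBall_subset_ball (by linarith))
    _ ≤ oR (M * ρ k ^ 3) := h y hy.2 k
    _ = c * volume (ball y (ρ k / 4)) := by
      rw [vol_ball y _ pz, hc, ← ofReal_mul pz]
      congr 1; field_simp; norm_num
    _ ≤ _ := mul_le_mul' le_rfl (measure_mono ball_subset_closedBall)

lemma bdd_of_decay {v : ET → E3} (mv : Measurable v) {xo : E3} {tq r M L : ℝ} (hr : 0 < r) (hM : 0 < M) (hL : 0 < L) (hL1 : L < 1)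
    (h : ∀ x ∈ ball xo r, ∀ t, t ≤ tq → tq - 2 * r ^ 2 ≤ t → ∀ k : ℕ, ∀ᵐ s ∂(volume.restrict (Ioo (t - (L ^ k * r) ^ 2) t)),
      Vt v x (L ^ k * r) s ≤ oR (M * (L ^ k * r) ^ 3)) :
    ∃ B : ℝ, ∀ᵐ w ∂(volume.restrict (pcyl (xo, tq) r)), ‖v w‖ ≤ B := by
  have hbb := bb_pos
  have ρ0 : ∀ k : ℕ, 0 < L ^ k * r := fun k => by positivity
  have all : ∀ᵐ s : ℝ, ∀ (k i : ℕ) (q : ℚ), TopologicalSpace.denseSeq E3 i ∈ ball xo r → (q : ℝ) ≤ tq → tq - 2 * r ^ 2 ≤ q →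
      s ∈ Ioo ((q : ℝ) - (L ^ k * r) ^ 2) q → Vt v (TopologicalSpace.denseSeq E3 i) (L ^ k * r) s ≤ oR (M * (L ^ k * r) ^ 3) := by
    refine ae_all_iff.2 fun k => ae_all_iff.2 fun i => ae_all_iff.2 fun q => ?_
    by_cases hc : TopologicalSpace.denseSeq E3 i ∈ ball xo r ∧ (q : ℝ) ≤ tq ∧ tq - 2 * r ^ 2 ≤ q
    · exact ((ae_restrict_iff' measurableSet_Ioo).1 (h _ hc.1 q hc.2.1 hc.2.2 k)).mono fun s hs _ _ _ => hs
    · exact Eventually.of_forall fun s h1 h2 h3 => absurd ⟨h1, h2, h3⟩ hc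
  have fin : ∀ᵐ s ∂(volume.restrict (Ioo (tq - r ^ 2) tq)), ∀ᵐ y ∂(volume.restrict (ball xo r)), ‖v (y, s)‖ₑ ^ 2 ≤ oR (64 * M / bb) := by
    refine (ae_restrict_iff' measurableSet_Ioo).2 (all.mono fun s hs hsI => ?_)
    have lim : Tendsto (fun k : ℕ => L ^ k * r) atTop (𝓝 0) := by simpa using (tendsto_pow_atTop_nhds_zero_of_lt_one hL.le hL1).mul_const r
    refine leb_bdd ((mv.comp measurable_prodMk_right).enorm.pow_const 2) hM ρ0 lim fun y hy k => ?_
    have hk := ρ0 k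
    obtain ⟨q, q1, q2⟩ := exists_rat_btwn (lt_min hsI.2 (show s < s + (L ^ k * r) ^ 2 by linarith [pow_pos hk 2]))
    obtain ⟨q2, q3⟩ := lt_min_iff.1 q2
    obtain ⟨i, hi1, hi2⟩ := (TopologicalSpace.denseRange_denseSeq E3).exists_mem_open (isOpen_ball.inter isOpen_ball)
      (⟨y, mem_ball_self (half_pos hk), hy⟩ : (ball y (L ^ k * r / 2) ∩ ball xo r).Nonempty)
    refine (lintegral_mono_set (ball_subset_ball' ?_)).trans (hs k i q hi2 q2.le (by have := hsI.1; nlinarith) ⟨by linarith, q1⟩)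
    rw [dist_comm]; have := mem_ball.1 hi1; linarith
  refine ⟨√(64 * M / bb), ?_⟩
  have ms : MeasurableSet {x : ET | ‖v x‖ ≤ √(64 * M / bb)} := measurableSet_le mv.norm measurable_const
  unfold pcyl
  rw [Measure.volume_eq_prod, ← Measure.prod_restrict]
  refine (Measure.ae_prod_iff_ae_ae ms).2 ((Measure.ae_ae_comm (p := fun y s => ‖v (y, s)‖ ≤ √(64 * M / bb)) ms).2 (fin.mono fun s hs => hs.mono fun y hy => ?_))
  refine Real.le_sqrt_of_sq_le ?_
  rw [← ofReal_norm, ← ofReal_pow (norm_nonneg _)] at hy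
  exact (ofReal_le_ofReal_iff pz).1 hy

/-- **Proposition 2.1** (Caffarelli–Kohn–Nirenberg): there is an absolute
constant `ε₁ > 0` such that if `(v,p)` is a suitable weak solution of the
Navier–Stokes equations in `Q_T = Ω × (0,T)`, `z₀ ∈ Q_T` and the closure of
`Q_{z₀,r}` is contained in `Q_T` for some `r > 0`, and
`limsup_{ρ→0+} ρ⁻¹ ∫∫_{Q_{z₀,ρ}} |∇v|² dx dt ≤ ε₁`, then `z₀` is a regular
point of `v`. -/
theorem ckn_small_gradient_limsup_implies_regular :
    ∃ ε₁ : ℝ, 0 < ε₁ ∧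
      ∀ (Ω : Set E3) (T : ℝ) (v : E3 × ℝ → E3) (Dv : E3 × ℝ → Fin 3 → Fin 3 → ℝ)
        (p : E3 × ℝ → ℝ) (v₀ : E3 → E3) (z₀ : E3 × ℝ) (r : ℝ),
        IsOpen Ω → 0 < T →
        IsSuitableWeakSolution Ω T v Dv p v₀ →
        z₀ ∈ Ω ×ˢ Ioo 0 T → 0 < r →
        closure (pcyl z₀ r) ⊆ Ω ×ˢ Ioo 0 T →
        Filter.limsup
            (fun ρ : ℝ => (ENNReal.ofReal ρ)⁻¹ *
              ∫⁻ z in pcyl z₀ ρ, ENNReal.ofReal (∑ i, ∑ j, (Dv z i j) ^ 2))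
            (nhdsWithin 0 (Ioi 0))
          ≤ ENNReal.ofReal ε₁ →
        RegularPoint Ω T v z₀ := by
  obtain ⟨κ, β, η, k0, k1, b0, e0, hA⟩ := stepA
  obtain ⟨b, hb, hBst⟩ := stepB (show 0 < η / 8 by positivity)
  refine ⟨(b ^ 2) ^ 2 / 2, by positivity, fun Ω T v Dv p v₀ z₀ _ hΩ hT hs hz _ _ hlim => ?_⟩
  obtain ⟨xo, tq⟩ := z₀
  obtain ⟨hx, ht0, htT⟩ : xo ∈ Ω ∧ 0 < tq ∧ tq < T := ⟨hz.1, hz.2.1, hz.2.2⟩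
  have ev := eventually_lt_of_limsup_lt (hlim.trans_lt ((ofReal_lt_ofReal_iff (show 0 < (b ^ 2) ^ 2 by positivity)).2
    (half_lt_self pz)))
  obtain ⟨u, hu, hus⟩ := mem_nhdsGT_iff_exists_Ioo_subset.1 ev
  obtain ⟨e, he, hes⟩ := Metric.isOpen_iff.1 hΩ xo hx
  replace hu : 0 < u := hu
  obtain ⟨R, hR⟩ : ∃ R, R = min (u / 2) (min e (min 1 (min tq (T - tq)))) := ⟨_, rfl⟩
  have R0 : 0 < R := by
    rw [hR]; exact lt_min pz (lt_min he (lt_min one_pos (lt_min ht0 (by linarith))))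
  obtain ⟨R1, R2, R3, R4, R5⟩ : R ≤ u / 2 ∧ R ≤ e ∧ R ≤ 1 ∧ R ≤ tq ∧ R ≤ T - tq := by
    simpa only [le_min_iff] using hR.le
  have RR : R ^ 2 ≤ R := by nlinarith
  have hE : ∀ ρ, 0 < ρ → ρ ≤ R → ∫⁻ t in Ioo (tq - ρ ^ 2) tq, Ht Dv xo ρ t ≤ oR ((b ^ 2) ^ 2 * ρ) := by
    intro ρ hρ hρR
    have h1 := (show (oR ρ)⁻¹ * ∫⁻ z in pcyl (xo, tq) ρ, oR (∑ i, ∑ j, (Dv z i j) ^ 2) < _ from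
      hus ⟨hρ, by linarith⟩).le
    rw [Ht_prod hs.meas_Dv, ofReal_mul pz, mul_comm]
    rw [mul_comm, ← div_eq_mul_inv] at h1
    have := (ENNReal.div_le_iff (ofReal_pos.2 hρ).ne' ofReal_ne_top).1 h1
    rw [mul_comm]; exact this
  have hB := (ball_subset_ball R2).trans hes
  obtain ⟨a, δ, ha, hδ, hd⟩ := Dat_init hs R0 hB (by linarith) htT.le (hE R R0 le_rfl)
  obtain ⟨ρ, hρ, hρR, hdρ⟩ := hBst hs hΩ R0 hB (by linarith) (by linarith) ha hδ hd hE
  have ρρ := pow_le_pow_left₀ hρ.le hρR 2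
  have hBρ := (ball_subset_ball hρR).trans hB
  obtain ⟨B, hBd⟩ := bdd_of_decay hs.meas_v (xo := xo) (tq := tq) (r := ρ / 2) (M := β ^ 2 / (ρ / 2) ^ 2) (L := κ ^ 6) pz pz
    pz (pow_lt_one₀ k0.le (by linarith) (by norm_num)) fun x hx t ht ht' k => by
      have hb' : ball x (ρ / 2) ⊆ Ω := (ball_subset_ball' (by have := mem_ball.1 hx; linarith)).trans hBρ
      obtain ⟨_, _, D⟩ := hA hs hΩ (half_pos hρ) hb' (by linarith) (by linarith) (hdρ.shift hρ e0 hx ht (by linarith)) k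
      refine D.A.mono fun s hs => hs.trans (le_of_eq ?_)
      congr 1; field_simp
  refine ⟨ρ / 2, half_pos hρ, prod_mono ((ball_subset_ball (by linarith)).trans hBρ) (Ioo_subset_Ioo ?_ htT.le), B, hBd⟩
  dsimp only; linarith

end
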